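/- For every totally real number field F there exists a finite totally real field extension L of F such that the norm-induced homomorphism Cl(𝓞_L) → Cl(𝓞_F) on ideal class groups is the trivial homomorphism (every ideal class of L has principal norm in F). -/

import Mathlib

open NumberField IntermediateField
open scoped nonZeroDivisors

/-- A subfield of `ℂ` is totally real if every field embedding of it into `ℂ`
has image contained in `ℝ`. -/
def TotallyReal (F : IntermediateField ℚ ℂ) : Prop :=
  ∀ φ : F →+* ℂ, ∀ x : F, (φ x).im = 0

instance (F : IntermediateField ℚ ℂ) [FiniteDimensional ℚ F] : NumberField F :=
  NumberField.of_module_finite ℚ F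

/-- The relative ideal norm `Nm_{L/F}` for subfields `F ⊆ L` of `ℂ`: the ideal of `𝓞 F`
generated by the field norms `Nm_{L/F}(x)` of the elements `x` of the given ideal of
`𝓞 L`. -/
noncomputable def idealNorm (F L : IntermediateField ℚ ℂ) (h : F ≤ L)
    (I : Ideal (𝓞 L)) : Ideal (𝓞 F) :=
  letI : Algebra F L := (IntermediateField.inclusion h).toRingHom.toAlgebra
  Ideal.span {y : 𝓞 F | ∃ x ∈ I, (y : F) = Algebra.norm F (x : L)}

section P1a
open Polynomial Finset

/-- geometric polynomial -/
noncomputable def geomPoly (p : ℕ) : ℤ[X] := ∑ i ∈ range p, X ^ i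

lemma geomPoly_mul (p : ℕ) : geomPoly p * (X - 1) = X ^ p - 1 := by
  rw [geomPoly, geom_sum_mul]

lemma geomPoly_exists_g (p : ℕ) [hp : Fact p.Prime] :
    ∃ g : ℤ[X], (X - 1 : ℤ[X]) ^ (p - 1) = geomPoly p + C (p : ℤ) * g := by
  have h1 : (geomPoly p - (X - 1) ^ (p - 1)).map (Int.castRingHom (ZMod p)) = 0 := by
    have hne : (X - 1 : (ZMod p)[X]) ≠ 0 := X_sub_C_ne_zero (1 : ZMod p)
    apply mul_right_cancel₀ hne
    have h2 : (geomPoly p).map (Int.castRingHom (ZMod p)) * (X - 1) = X ^ p - 1 := by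
      have := congrArg (Polynomial.map (Int.castRingHom (ZMod p))) (geomPoly_mul p)
      simpa using this
    have h3 : (X - 1 : (ZMod p)[X]) ^ p = X ^ p - 1 := by
      have := sub_pow_char (R := (ZMod p)[X]) (p := p) X 1
      simpa using this
    simp only [Polynomial.map_sub, Polynomial.map_pow, map_X, Polynomial.map_one, sub_mul, h2,
      zero_mul]
    rw [← pow_succ, Nat.sub_add_cancel hp.out.one_le, h3, sub_self]
  have h4 : C (p : ℤ) ∣ geomPoly p - (X - 1) ^ (p - 1) := by
    rw [C_dvd_iff_dvd_coeff]
    intro i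
    have := congrArg (fun q => coeff q i) h1
    simp only [coeff_map, coeff_zero] at this
    exact (ZMod.intCast_zmod_eq_zero_iff_dvd _ p).1 (by simpa using this)
  obtain ⟨g, hg⟩ := h4
  exact ⟨-g, by linear_combination -hg⟩

lemma geomPoly_eval_one (p : ℕ) : (geomPoly p).eval 1 = p := by
  simp [geomPoly, eval_finset_sum]

lemma geomPoly_monic (p : ℕ) (hp : p ≠ 0) : (geomPoly p).Monic := monic_geom_sum_X hp

/-- key polynomial identity -/
lemma geomPoly_key (p : ℕ) [hp : Fact p.Prime] :
    ∃ g h h1 k : ℤ[X], (X - 1 : ℤ[X]) ^ (p - 1) = geomPoly p + C (p : ℤ) * g ∧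
      g * h = 1 + geomPoly p * k ∧
      C (p : ℤ) = geomPoly p * h1 + (X - 1) ^ (p - 1) * h := by
  obtain ⟨g, hg⟩ := geomPoly_exists_g p
  have hp0 : (p : ℤ) ≠ 0 := by exact_mod_cast hp.out.ne_zero
  have hp1 : 0 < p - 1 := Nat.sub_pos_of_lt hp.out.one_lt
  have hg1 : g.eval 1 = -1 := by
    have := congrArg (eval 1) hg
    simp only [eval_pow, eval_sub, eval_X, eval_one, sub_self, eval_add, eval_mul, eval_C,
      geomPoly_eval_one, zero_pow hp1.ne'] at this
    have h2 : (p : ℤ) * (g.eval 1 + 1) = 0 := by linarith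
    rcases mul_eq_zero.1 h2 with h | h
    · exact absurd h hp0
    · linarith
  obtain ⟨g', hg'⟩ : (X - C 1 : ℤ[X]) ∣ g + 1 := by
    rw [dvd_iff_isRoot]; simp [hg1]
  rw [C_1] at hg'
  set u : ℤ[X] := (X - 1) * g' with hu
  have hgu : g = u - 1 := by linear_combination hg'
  have hgeom : (∑ i ∈ range (p - 1), u ^ i) * (u - 1) = u ^ (p - 1) - 1 := geom_sum_mul u (p - 1)
  set s : ℤ[X] := ∑ i ∈ range (p - 1), u ^ i with hs
  have hupow : u ^ (p - 1) = (X - 1) ^ (p - 1) * g' ^ (p - 1) := by rw [hu, mul_pow]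
  -- p * (u - 1) = (X-1)^(p-1) - Φ ; multiply by s
  have key : C (p : ℤ) = geomPoly p * s + (X - 1) ^ (p - 1) * (C (p : ℤ) * g' ^ (p - 1) - s) := by
    have e1 : C (p : ℤ) * (u - 1) = (X - 1) ^ (p - 1) - geomPoly p := by
      rw [hg, ← hgu]; ring
    have e2 : C (p : ℤ) * (u ^ (p - 1) - 1) = ((X - 1) ^ (p - 1) - geomPoly p) * s := by
      rw [← hgeom, ← e1]; ring
    rw [hupow] at e2
    linear_combination -e2
  set h : ℤ[X] := C (p : ℤ) * g' ^ (p - 1) - s with hh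
  -- p (1 - g h) = Φ (s + h)
  have e3 : C (p : ℤ) * (g * h - 1) = geomPoly p * (-(s + h)) := by
    rw [hg] at key
    linear_combination -key
  have hprime : Prime (C (p : ℤ) : ℤ[X]) :=
    prime_C_iff.2 (Nat.prime_iff_prime_int.1 hp.out)
  have hnd : ¬ (C (p : ℤ) : ℤ[X]) ∣ geomPoly p := by
    intro hd
    rw [C_dvd_iff_dvd_coeff] at hd
    have := hd (geomPoly p).natDegree
    rw [(geomPoly_monic p hp.out.ne_zero).coeff_natDegree] at this
    exact (Nat.prime_iff_prime_int.1 hp.out).not_dvd_one this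
  have hd2 : (C (p : ℤ) : ℤ[X]) ∣ -(s + h) := by
    have : (C (p : ℤ) : ℤ[X]) ∣ geomPoly p * (-(s + h)) := ⟨_, e3.symm⟩
    exact (hprime.dvd_or_dvd this).resolve_left hnd
  obtain ⟨k, hk⟩ := hd2
  refine ⟨g, h, s, k, hg, ?_, key⟩
  rw [hk] at e3
  have e4 : C (p : ℤ) * (g * h - 1) = C (p : ℤ) * (geomPoly p * k) := by rw [e3]; ring
  have e5 := mul_left_cancel₀ (C_ne_zero.2 hp0) e4
  linear_combination e5

end P1a

section P1b
open Module

lemma card_ker_comp {A B C : Type*} [AddCommGroup A] [AddCommGroup B] [AddCommGroup C]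
    (f : B →+ C) (g : A →+ B) :
    Nat.card (f.comp g).ker = Nat.card g.ker * Nat.card (f.ker ⊓ g.range : AddSubgroup B) := by
  have h1 : (f.comp g).ker = f.ker.comap g := by ext; simp [AddMonoidHom.mem_ker]
  have hle : g.ker ≤ (f.comp g).ker := by
    intro x hx; rw [AddMonoidHom.mem_ker] at *; simp [hx]
  have h2 := AddSubgroup.relIndex_mul_relIndex (⊥ : AddSubgroup A) g.ker (f.comp g).ker bot_le hle
  rw [AddSubgroup.relIndex_bot_left, AddSubgroup.relIndex_bot_left, AddSubgroup.relIndex_ker, h1,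
    AddSubgroup.map_comap_eq, inf_comm] at h2
  rw [h1, ← h2]

lemma herbrand_mul {B : Type*} [AddCommGroup B] (f g : B →+ B) [Finite f.ker] :
    (f.comp g).range.index * (Nat.card f.ker * Nat.card g.ker) =
      f.range.index * g.range.index * Nat.card (f.comp g).ker := by
  have h1 : (f.comp g).range = g.range.map f := by
    rw [AddMonoidHom.range_comp]
  rw [h1, AddSubgroup.index_map, card_ker_comp]
  have h2 := AddSubgroup.relIndex_mul_index (H := g.range) (K := g.range ⊔ f.ker) le_sup_left
  rw [AddSubgroup.relIndex_sup_left] at h2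
  have h3 : Nat.card (f.ker ⊓ g.range : AddSubgroup B) * g.range.relIndex f.ker = Nat.card f.ker := by
    have := AddSubgroup.relIndex_mul_relIndex (⊥ : AddSubgroup B) (f.ker ⊓ g.range) f.ker bot_le inf_le_left
    rw [AddSubgroup.relIndex_bot_left, AddSubgroup.relIndex_bot_left,
      AddSubgroup.inf_relIndex_left] at this
    exact this
  rw [← h2, ← h3]
  ring

lemma index_range_nsmul_fg (B : Type*) [AddCommGroup B] [Module.Finite ℤ B] (n : ℕ) (hn : n ≠ 0) :
    (nsmulAddMonoidHom (α := B) n).range.index =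
      n ^ finrank ℤ B * Nat.card (nsmulAddMonoidHom (α := B) n).ker ∧
      Finite (nsmulAddMonoidHom (α := B) n).ker := by
  set T := Submodule.torsion ℤ B with hT
  have hfin : Finite T := Module.finite_of_fg_torsion T (Submodule.torsion_isTorsion)
  have hker : (nsmulAddMonoidHom (α := B) n).ker ≤ T.toAddSubgroup := by
    intro x hx
    rw [AddMonoidHom.mem_ker] at hx
    refine (Submodule.mem_torsion_iff x).2 ⟨⟨(n : ℤ), mem_nonZeroDivisors_of_ne_zero (by exact_mod_cast hn)⟩, ?_⟩
    simpa [Submonoid.smul_def] using hx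
  have hfk : Finite (nsmulAddMonoidHom (α := B) n).ker :=
    Finite.of_injective (fun x => (⟨x.1, hker x.2⟩ : T)) (fun x y h => by
      have := congrArg Subtype.val h
      exact Subtype.ext this)
  refine ⟨?_, hfk⟩
  have hrank : finrank ℤ (B ⧸ T) = finrank ℤ B := by
    rw [finrank, finrank, rank_quotient_eq_of_le_torsion le_rfl]
  have hfree : Module.Free ℤ (B ⧸ T) := inferInstance
  set μ := nsmulAddMonoidHom (α := B) n with hμ
  have h1 := AddSubgroup.index_range_nsmul (B ⧸ T) n
  rw [hrank] at h1
  have h2 : (nsmulAddMonoidHom (α := B ⧸ T) n).range = μ.range.map T.mkQ.toAddMonoidHom := by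
    ext x
    simp only [AddMonoidHom.mem_range, AddSubgroup.mem_map]
    constructor
    · rintro ⟨y, rfl⟩
      obtain ⟨y, rfl⟩ := T.mkQ_surjective y
      exact ⟨μ y, ⟨y, rfl⟩, by simp [hμ]⟩
    · rintro ⟨_, ⟨y, rfl⟩, rfl⟩
      exact ⟨T.mkQ y, by simp [hμ]⟩
  have hkerq : T.mkQ.toAddMonoidHom.ker = T.toAddSubgroup := by
    ext x; simp [AddMonoidHom.mem_ker]
  have hrq : T.mkQ.toAddMonoidHom.range = ⊤ := by
    rw [AddMonoidHom.range_eq_top]; exact T.mkQ_surjective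
  rw [h2, AddSubgroup.index_map, hkerq, hrq, AddSubgroup.index_top, mul_one] at h1
  have h3 := AddSubgroup.relIndex_mul_index (H := μ.range) (K := μ.range ⊔ T.toAddSubgroup) le_sup_left
  rw [AddSubgroup.relIndex_sup_left, h1] at h3
  rw [← h3, mul_comm]
  congr 1
  have h4 : μ.range ⊓ T.toAddSubgroup = T.toAddSubgroup.map μ := by
    ext x
    simp only [AddSubgroup.mem_inf, AddMonoidHom.mem_range, AddSubgroup.mem_map]
    constructor
    · rintro ⟨⟨y, rfl⟩, hx⟩
      refine ⟨y, ?_, rfl⟩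
      obtain ⟨a, ha⟩ := (Submodule.mem_torsion_iff (R := ℤ) _).1 hx
      refine (Submodule.mem_torsion_iff (R := ℤ) y).2 ⟨a * ⟨(n : ℤ), mem_nonZeroDivisors_of_ne_zero (by exact_mod_cast hn)⟩, ?_⟩
      rw [mul_smul]
      simpa [Submonoid.smul_def, hμ] using ha
    · rintro ⟨y, hy, rfl⟩
      exact ⟨⟨y, rfl⟩, by simpa [hμ] using T.smul_mem (n : ℤ) hy⟩
  rw [← AddSubgroup.inf_relIndex_right, h4]
  have h5 := AddSubgroup.relIndex_mul_relIndex (⊥ : AddSubgroup B) (T.toAddSubgroup.map μ) T.toAddSubgroup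
    bot_le (h4 ▸ inf_le_right)
  have h6 := AddSubgroup.relIndex_mul_relIndex (⊥ : AddSubgroup B) μ.ker T.toAddSubgroup
    bot_le hker
  simp only [AddSubgroup.relIndex_bot_left, AddSubgroup.relIndex_ker] at h5 h6
  have h7 : Nat.card (T.toAddSubgroup.map μ) ≠ 0 := by
    have : Finite (T.toAddSubgroup.map μ) := by
      have : Finite T.toAddSubgroup := hfin
      exact Set.Finite.image μ (Set.toFinite (T.toAddSubgroup : Set B))
    exact Nat.card_pos.ne'
  rw [← h6, mul_comm] at h5
  exact Nat.eq_of_mul_eq_mul_right (Nat.pos_of_ne_zero h7) h5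

open Polynomial in
/-- the restriction of a polynomial in `σ` to the kernel of another one -/
noncomputable def polyRestrict {A : Type*} [AddCommGroup A] (σ : AddMonoid.End A) (n q : ℤ[X]) :
    (aeval σ n : AddMonoid.End A).ker →+ (aeval σ n : AddMonoid.End A).ker :=
  ((aeval σ q : AddMonoid.End A).comp (aeval σ n : AddMonoid.End A).ker.subtype).codRestrict _
    (by
      intro x
      change ((aeval σ n) * (aeval σ q)) x.1 = 0
      rw [← map_mul, mul_comm, map_mul]
      change (aeval σ q) ((aeval σ n) x.1) = 0
      have h : (aeval σ n) x.1 = 0 := x.2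
      rw [h, map_zero])

open Polynomial in
lemma polyRestrict_coe {A : Type*} [AddCommGroup A] (σ : AddMonoid.End A) (n q : ℤ[X])
    (x : (aeval σ n : AddMonoid.End A).ker) :
    (polyRestrict σ n q x : A) = aeval σ q x.1 := rfl

open Polynomial in
lemma polyRestrict_mul {A : Type*} [AddCommGroup A] (σ : AddMonoid.End A) (n q r : ℤ[X]) :
    polyRestrict σ n (q * r) = (polyRestrict σ n q).comp (polyRestrict σ n r) := by
  ext x
  simp only [polyRestrict_coe, AddMonoidHom.comp_apply, map_mul]
  rfl

lemma relIndex_map_range {A : Type*} [AddCommGroup A] (N : A →+ A) (A0 : AddSubgroup A) :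
    (A0.map N).relIndex N.range = (A0 ⊔ N.ker).index := by
  have := AddSubgroup.relIndex_map_map N A0 ⊤
  rw [← AddMonoidHom.range_eq_map] at this
  rw [this]; simp

lemma addEnd_sum_apply {A ι : Type*} [AddCommGroup A] (s : Finset ι) (f : ι → AddMonoid.End A)
    (x : A) : (∑ i ∈ s, f i) x = ∑ i ∈ s, f i x := by
  classical
  induction s using Finset.induction_on with
  | empty => simp
  | insert a s ha ih => rw [Finset.sum_insert ha, Finset.sum_insert ha, ← ih]; rfl

open Polynomial in
lemma herbrand_index {A : Type*} [AddCommGroup A] [Module.Finite ℤ A] (p : ℕ) [hp : Fact p.Prime]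
    (σ : AddMonoid.End A) (hσ : σ ^ p = 1)
    (hker : ∀ x, (aeval σ (geomPoly p) : AddMonoid.End A) x = 0 → ∃ y, x = σ y - y) :
    ((aeval σ (geomPoly p) : AddMonoid.End A).range.relIndex (σ - 1 : AddMonoid.End A).ker) ^ (p - 1)
      * p ^ finrank ℤ A = p ^ (p * finrank ℤ (σ - 1 : AddMonoid.End A).ker) := by
  obtain ⟨g, h, h1, k, hg, hgh, hph⟩ := geomPoly_key p
  set N : AddMonoid.End A := aeval σ (geomPoly p) with hN
  set A0 := (σ - 1 : AddMonoid.End A).ker with hA0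
  set B := N.ker with hB
  set n := geomPoly p with hn
  have hσX : (aeval σ (X - 1 : ℤ[X])) = σ - 1 := by simp
  have hN1 : (σ - 1) * N = 0 := by
    rw [hN, ← hσX, ← map_mul, mul_comm, geomPoly_mul]; simp [hσ]
  have hN2 : N * (σ - 1) = 0 := by
    rw [hN, ← hσX, ← map_mul, geomPoly_mul]; simp [hσ]
  have hBr : B = (σ - 1 : AddMonoid.End A).range := by
    ext x
    constructor
    · intro hx
      obtain ⟨y, hy⟩ := hker x hx
      exact ⟨y, hy.symm⟩
    · rintro ⟨y, rfl⟩
      exact DFunLike.congr_fun hN2 y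
  have hA0fix : ∀ x ∈ A0, σ x = x := fun x hx => sub_eq_zero.1 hx
  have hA0N : ∀ x ∈ A0, N x = p • x := by
    intro x hx
    have hpow : ∀ i : ℕ, (σ ^ i) x = x := by
      intro i
      induction i with
      | zero => rfl
      | succ i ih =>
        rw [pow_succ]
        change (σ ^ i) (σ x) = x
        rw [hA0fix x hx, ih]
    rw [hN, hn, geomPoly, map_sum]
    have : (∑ i ∈ Finset.range p, (aeval σ) (X ^ i : ℤ[X]) : AddMonoid.End A) x
        = ∑ i ∈ Finset.range p, (σ ^ i) x := by
      rw [addEnd_sum_apply]; simp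
    rw [this, Finset.sum_congr rfl (fun i _ => hpow i)]
    simp
  -- rank
  have hrank : finrank ℤ A = finrank ℤ A0 + finrank ℤ B := by
    have h2 := Submodule.finrank_quotient_add_finrank
      (LinearMap.ker (AddMonoidHom.toIntLinearMap (σ - 1 : AddMonoid.End A)))
    rw [(LinearMap.quotKerEquivRange _).finrank_eq] at h2
    rw [← h2, add_comm]
    congr 1
    rw [hBr]
    rfl
  have hfinB : Module.Finite ℤ B := inferInstanceAs (Module.Finite ℤ B.toIntSubmodule)
  have hfinA0 : Module.Finite ℤ A0 := inferInstanceAs (Module.Finite ℤ A0.toIntSubmodule)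
  -- part on B
  set f : B →+ B := polyRestrict σ n (X - 1) with hf
  have hfcoe : ∀ x : B, (f x : A) = (σ - 1 : AddMonoid.End A) x.1 := by
    intro x; rw [hf, polyRestrict_coe, hσX]
  obtain ⟨hcB, hkB⟩ := index_range_nsmul_fg B p hp.out.ne_zero
  have hnB : ∀ (q : ℤ[X]) (x : B), (aeval σ (n * q)) x.1 = 0 := by
    intro q x
    rw [mul_comm, map_mul]
    change (aeval σ q) (N x.1) = 0
    have : N x.1 = 0 := x.2
    rw [this, map_zero]
  have hgh' : (polyRestrict σ n g).comp (polyRestrict σ n h) = AddMonoidHom.id B := by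
    rw [← polyRestrict_mul, hgh]
    ext x
    rw [polyRestrict_coe, map_add, map_one]
    change x.1 + (aeval σ (n * k)) x.1 = x.1
    rw [hnB, add_zero]
  have hhg' : (polyRestrict σ n h).comp (polyRestrict σ n g) = AddMonoidHom.id B := by
    rw [← polyRestrict_mul, mul_comm, polyRestrict_mul, hgh']
  have hgbij : Function.Bijective (polyRestrict σ n g) :=
    ⟨Function.LeftInverse.injective (g := polyRestrict σ n h) (DFunLike.congr_fun hhg'),
      Function.RightInverse.surjective (g := polyRestrict σ n h) (DFunLike.congr_fun hgh')⟩
  set fp : B →+ B := polyRestrict σ n ((X - 1) ^ (p - 1)) with hfp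
  have hfp1 : fp = (nsmulAddMonoidHom (α := B) p).comp (polyRestrict σ n g) := by
    ext x
    rw [hfp, hg, polyRestrict_coe, AddMonoidHom.comp_apply, nsmulAddMonoidHom_apply, map_add]
    change (aeval σ n) x.1 + (aeval σ (C (p : ℤ) * g)) x.1 = p • (aeval σ g) x.1
    have : N x.1 = 0 := x.2
    rw [map_mul]
    simp only [aeval_C]
    change N x.1 + _ = _
    rw [this, zero_add]
    change ((algebraMap ℤ (AddMonoid.End A)) p) ((aeval σ g) x.1) = _
    simp
  have hgr : (polyRestrict σ n g).range = ⊤ := AddMonoidHom.range_eq_top.2 hgbij.2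
  have hgk : (polyRestrict σ n g).ker = ⊥ := (AddMonoidHom.ker_eq_bot_iff _).2 hgbij.1
  have hmul := herbrand_mul (nsmulAddMonoidHom (α := B) p) (polyRestrict σ n g)
  rw [← hfp1, hgr, hgk, AddSubgroup.index_top, hcB] at hmul
  have hcfp : fp.range.index = p ^ finrank ℤ B * Nat.card fp.ker := by
    have h0 : 0 < Nat.card (nsmulAddMonoidHom (α := B) p).ker := Nat.card_pos
    simp only [AddSubgroup.card_bot, mul_one] at hmul
    apply Nat.eq_of_mul_eq_mul_right h0
    rw [hmul]; ring
  -- ker of f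
  obtain ⟨hcA, hkA⟩ := index_range_nsmul_fg A0 p hp.out.ne_zero
  let e : f.ker ≃ (nsmulAddMonoidHom (α := A0) p).ker :=
    { toFun := fun x => ⟨⟨x.1.1, by
          have : f x.1 = 0 := x.2
          have := congrArg Subtype.val this
          rw [hfcoe] at this
          exact this⟩, by
          rw [AddMonoidHom.mem_ker]
          apply Subtype.ext
          change p • x.1.1 = 0
          have h0 : f x.1 = 0 := x.2
          have := congrArg Subtype.val h0
          rw [hfcoe] at this
          rw [← hA0N _ this]
          exact x.1.2⟩
      invFun := fun x => ⟨⟨x.1.1, by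
          change N x.1.1 = 0
          rw [hA0N _ x.1.2]
          exact congrArg Subtype.val (show p • x.1 = 0 from x.2)⟩, by
          rw [AddMonoidHom.mem_ker]
          apply Subtype.ext
          rw [hfcoe]
          exact x.1.2⟩
      left_inv := fun x => rfl
      right_inv := fun x => rfl }
  have hkf : Nat.card f.ker = Nat.card (nsmulAddMonoidHom (α := A0) p).ker := Nat.card_congr e
  have hkfin : Finite f.ker := Finite.of_equiv _ e.symm
  have hpow : ∀ m : ℕ, Nat.card (polyRestrict σ n ((X - 1) ^ m)).ker ≠ 0 ∧
      (polyRestrict σ n ((X - 1) ^ m)).range.index * Nat.card f.ker ^ m =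
      f.range.index ^ m * Nat.card (polyRestrict σ n ((X - 1) ^ m)).ker := by
    intro m
    induction m with
    | zero =>
      have : polyRestrict σ n ((X - 1) ^ 0) = AddMonoidHom.id B := by
        ext x; rw [polyRestrict_coe, pow_zero, map_one]; rfl
      rw [this]
      have h1 : (AddMonoidHom.id B).range = ⊤ := AddMonoidHom.range_eq_top.2 Function.surjective_id
      have h2 : (AddMonoidHom.id B).ker = ⊥ := (AddMonoidHom.ker_eq_bot_iff _).2 Function.injective_id
      rw [h1, h2]; simp
    | succ m ih =>
      have hm := herbrand_mul f (polyRestrict σ n ((X - 1) ^ m))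
      have hc := card_ker_comp f (polyRestrict σ n ((X - 1) ^ m))
      rw [hf, ← polyRestrict_mul, ← pow_succ', ← hf] at hm hc
      obtain ⟨ih0, ih⟩ := ih
      constructor
      · rw [hc]
        refine mul_ne_zero ih0 ?_
        have : Finite (f.ker ⊓ (polyRestrict σ n ((X - 1) ^ m)).range : AddSubgroup B) :=
          Set.Finite.subset (Set.toFinite (f.ker : Set B)) (fun x hx => hx.1)
        exact Nat.card_pos.ne'
      · apply Nat.eq_of_mul_eq_mul_right (Nat.pos_of_ne_zero ih0)
        calc _ = ((polyRestrict σ n ((X - 1) ^ (m + 1))).range.index * (Nat.card f.ker *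
                  Nat.card (polyRestrict σ n ((X - 1) ^ m)).ker)) * Nat.card f.ker ^ m := by ring
          _ = _ := by
            rw [hm]
            calc _ = f.range.index * Nat.card (polyRestrict σ n ((X - 1) ^ (m + 1))).ker *
                ((polyRestrict σ n ((X - 1) ^ m)).range.index * Nat.card f.ker ^ m) := by ring
              _ = _ := by rw [ih]; ring
  obtain ⟨hp0, hp1⟩ := hpow (p - 1)
  rw [← hfp, hcfp] at hp1
  rw [← hfp] at hp0
  have hB1 : p ^ finrank ℤ B * Nat.card f.ker ^ (p - 1) = f.range.index ^ (p - 1) := by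
    apply Nat.eq_of_mul_eq_mul_right (Nat.pos_of_ne_zero hp0)
    rw [← hp1]; ring
  -- main index computation
  have hpA0 : (nsmulAddMonoidHom (α := A0) p).range.index = (A0.map N).relIndex A0 := by
    rw [AddSubgroup.relIndex]
    congr 1
    ext x
    rw [AddSubgroup.mem_addSubgroupOf,AddMonoidHom.mem_range]
    constructor
    · rintro ⟨y, rfl⟩
      exact ⟨y.1, y.2, hA0N _ y.2⟩
    · rintro ⟨y, hy, hyx⟩
      refine ⟨⟨y, hy⟩, Subtype.ext ?_⟩
      exact (hA0N _ hy).symm.trans hyx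
  have hle1 : A0.map N ≤ N.range := by
    rintro _ ⟨y, _, rfl⟩; exact ⟨y, rfl⟩
  have hle2 : N.range ≤ A0 := by
    rintro _ ⟨y, rfl⟩; exact DFunLike.congr_fun hN1 y
  have hI := AddSubgroup.relIndex_mul_relIndex _ _ _ hle1 hle2
  have hfr : (A0.map N).relIndex N.range = f.range.index := by
    have e1 : (A0.map N).relIndex N.range = (A0 ⊔ B).index := by
      exact relIndex_map_range N A0
    have e2 : f.range.index = (A0 ⊔ B).index := by
      have : f.range = (B.map (σ - 1 : AddMonoid.End A)).addSubgroupOf B := by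
        ext x
        rw [AddSubgroup.mem_addSubgroupOf,AddMonoidHom.mem_range]
        constructor
        · rintro ⟨y, rfl⟩
          exact ⟨y.1, y.2, (hfcoe y).symm⟩
        · rintro ⟨y, hy, hyx⟩
          refine ⟨⟨y, hy⟩, Subtype.ext ?_⟩
          exact (hfcoe _).trans hyx
      rw [this]
      change (B.map (σ - 1 : AddMonoid.End A)).relIndex B = _
      rw [sup_comm]
      have e3 := relIndex_map_range (σ - 1 : AddMonoid.End A) B
      exact (congrArg (fun H => (B.map (σ - 1 : AddMonoid.End A)).relIndex H) hBr).trans e3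
    rw [e1, e2]
  rw [hfr, ← hpA0, hcA, ← hkf] at hI
  have hkpos : 0 < Nat.card f.ker ^ (p - 1) := pow_pos Nat.card_pos _
  apply Nat.eq_of_mul_eq_mul_right hkpos
  have hpp : p = (p - 1) + 1 := (Nat.sub_add_cancel hp.out.one_le).symm
  calc N.range.relIndex A0 ^ (p - 1) * p ^ finrank ℤ A * Nat.card f.ker ^ (p - 1)
      = N.range.relIndex A0 ^ (p - 1) * p ^ finrank ℤ A0 *
        (p ^ finrank ℤ B * Nat.card f.ker ^ (p - 1)) := by rw [hrank, pow_add]; ring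
    _ = (f.range.index * N.range.relIndex A0) ^ (p - 1) * p ^ finrank ℤ A0 := by
        rw [hB1, mul_pow]; ring
    _ = (p ^ finrank ℤ A0) ^ ((p - 1) + 1) * Nat.card f.ker ^ (p - 1) := by
        rw [hI, mul_pow]; ring
    _ = _ := by rw [← hpp, ← pow_mul, mul_comm (finrank ℤ A0) p]

end P1b

/-- Finite places of a number field. -/
abbrev Pl (K : Type*) [Field K] [NumberField K] := IsDedekindDomain.HeightOneSpectrum (𝓞 K)

section V1
variable {K : Type*} [Field K] [NumberField K] (v : Pl K)

/-- normalized additive valuation (junk value `0` at `0`). -/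
noncomputable def ordd (x : K) : ℤ := - WithZero.log (v.valuation K x)

/-- `og v k x` : the order of `x` at `v` is at least `k`. -/
def og (k : ℤ) (x : K) : Prop := v.valuation K x ≤ WithZero.exp (-k)

variable {v}

theorem val_ne {x : K} (hx : x ≠ 0) : v.valuation K x ≠ 0 := by simpa using hx

theorem og_iff {k : ℤ} {x : K} (hx : x ≠ 0) : og v k x ↔ k ≤ ordd v x := by
  unfold og ordd
  rw [← WithZero.log_le_iff_le_exp (val_ne hx)]
  constructor <;> intro h <;> linarith

theorem og_zero (k : ℤ) : og v k (0 : K) := by simp [og]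

theorem og_ordd (x : K) : og v (ordd v x) x := by
  by_cases hx : x = 0
  · subst hx; exact og_zero _
  · exact (og_iff hx).2 le_rfl

theorem og_mono {k l : ℤ} {x : K} (h : og v k x) (hl : l ≤ k) : og v l x :=
  le_trans h (WithZero.exp_le_exp.2 (by omega))

theorem og_add {k : ℤ} {x y : K} (hx : og v k x) (hy : og v k y) : og v k (x + y) :=
  (Valuation.map_add _ _ _).trans (max_le hx hy)

theorem og_neg {k : ℤ} {x : K} (hx : og v k x) : og v k (-x) := by
  unfold og; rw [Valuation.map_neg]; exact hx

theorem og_sub {k : ℤ} {x y : K} (hx : og v k x) (hy : og v k y) : og v k (x - y) := by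
  rw [sub_eq_add_neg]; exact og_add hx (og_neg hy)

theorem og_sub_comm {k : ℤ} {x y : K} (h : og v k (x - y)) : og v k (y - x) := by
  have := og_neg h; rwa [neg_sub] at this

theorem og_mul {k l : ℤ} {x y : K} (hx : og v k x) (hy : og v l y) : og v (k + l) (x * y) := by
  unfold og at *
  rw [map_mul, neg_add, WithZero.exp_add]
  exact mul_le_mul' hx hy

theorem og_sum {ι : Type*} (s : Finset ι) (f : ι → K) {k : ℤ} (h : ∀ i ∈ s, og v k (f i)) :
    og v k (∑ i ∈ s, f i) := by
  classical
  induction s using Finset.induction_on with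
  | empty => simpa using og_zero k
  | insert a s ha ih =>
    rw [Finset.sum_insert ha]
    exact og_add (h _ (by simp)) (ih fun i hi => h i (by simp [hi]))

theorem ordd_mul {x y : K} (hx : x ≠ 0) (hy : y ≠ 0) : ordd v (x * y) = ordd v x + ordd v y := by
  unfold ordd; rw [map_mul, WithZero.log_mul (val_ne hx) (val_ne hy)]; ring

@[simp] theorem ordd_one : ordd v (1 : K) = 0 := by simp [ordd]
@[simp] theorem ordd_neg (x : K) : ordd v (-x) = ordd v x := by
  unfold ordd; rw [Valuation.map_neg]
@[simp] theorem ordd_inv (x : K) : ordd v (x⁻¹) = - ordd v x := by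
  unfold ordd; rw [map_inv₀, WithZero.log_inv]
@[simp] theorem ordd_pow (x : K) (n : ℕ) : ordd v (x ^ n) = n * ordd v x := by
  unfold ordd; rw [map_pow, WithZero.log_pow]; simp
@[simp] theorem ordd_zpow (x : K) (n : ℤ) : ordd v (x ^ n) = n * ordd v x := by
  unfold ordd; rw [map_zpow₀, WithZero.log_zpow]; simp
theorem ordd_div {x y : K} (hx : x ≠ 0) (hy : y ≠ 0) : ordd v (x / y) = ordd v x - ordd v y := by
  rw [div_eq_mul_inv, ordd_mul hx (inv_ne_zero hy), ordd_inv]; ring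

theorem ordd_prod {ι : Type*} (s : Finset ι) (f : ι → K) (h : ∀ i ∈ s, f i ≠ 0) :
    ordd v (∏ i ∈ s, f i) = ∑ i ∈ s, ordd v (f i) := by
  classical
  induction s using Finset.induction_on with
  | empty => simp
  | insert a s ha ih =>
    rw [Finset.prod_insert ha, Finset.sum_insert ha, ordd_mul (h _ (by simp)), ih]
    · exact fun i hi => h i (by simp [hi])
    · exact Finset.prod_ne_zero_iff.2 fun i hi => h i (by simp [hi])

theorem ordd_sub_comm (x y : K) : ordd v (x - y) = ordd v (y - x) := by
  rw [← neg_sub, ordd_neg]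

theorem ordd_add_eq {x y : K} (hx : x ≠ 0) (h : og v (ordd v x + 1) y) :
    x + y ≠ 0 ∧ ordd v (x + y) = ordd v x := by
  have hlt : v.valuation K y < v.valuation K x := by
    by_cases hy : y = 0
    · subst hy; rw [map_zero]; exact zero_lt_iff.2 (val_ne hx)
    · rw [← WithZero.log_lt_log (val_ne hy) (val_ne hx)]
      have := (og_iff hy).1 h
      unfold ordd at this; omega
  have := Valuation.map_add_eq_of_lt_right _ hlt
  rw [add_comm] at this
  refine ⟨fun h0 => ?_, ?_⟩
  · rw [h0, map_zero] at this; exact val_ne hx this.symm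
  · unfold ordd; rw [this]

theorem ordd_of_og_one {x : K} (h : og v 1 (x - 1)) : x ≠ 0 ∧ ordd v x = 0 := by
  have := ordd_add_eq (v := v) (x := (1 : K)) (y := x - 1) one_ne_zero (by simpa using h)
  simpa using this

theorem og_int (x : 𝓞 K) : og v 0 (x : K) := by
  unfold og; simpa using v.valuation_le_one (K := K) x

theorem og_int_iff (x : 𝓞 K) (n : ℕ) : og v n (x : K) ↔ x ∈ v.asIdeal ^ n := by
  unfold og
  rw [← v.intValuation_le_pow_iff_mem, ← v.valuation_of_algebraMap (K := K)]

theorem og_int_one_iff (x : 𝓞 K) : og v 1 (x : K) ↔ x ∈ v.asIdeal := by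
  simpa using og_int_iff (v := v) x 1

theorem og_nat (n : ℕ) : og v 0 (n : K) := by simpa using og_int (v := v) (n : 𝓞 K)

theorem og_isIntegral {x : K} (hx : IsIntegral ℤ x) : og v 0 x := og_int (v := v) ⟨x, hx⟩

theorem og_one : og v 0 (1 : K) := by simp [og]

theorem ordd_int_nonneg (x : 𝓞 K) : 0 ≤ ordd v (x : K) := by
  by_cases hx : x = 0
  · subst hx; simp [ordd]
  · exact (og_iff (by simpa using hx)).1 (og_int x)

theorem integral_of_og {x : K} (h : ∀ v : Pl K, og v 0 x) : ∃ y : 𝓞 K, (y : K) = x :=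
  IsDedekindDomain.HeightOneSpectrum.mem_integers_of_valuation_le_one (R := 𝓞 K) K x
    (fun v => by simpa [og] using h v)

theorem og_pow {k : ℤ} {x : K} (h : og v k x) (n : ℕ) : og v (n * k) (x ^ n) := by
  induction n with
  | zero => simpa using og_one
  | succ n ih => rw [pow_succ]; convert og_mul ih h using 1; push_cast; ring

theorem og_mul_unit {k : ℤ} {x y : K} (hx : og v k x) (hy : og v 0 y) : og v k (x * y) := by
  simpa using og_mul hx hy

theorem ordd_exists (v : Pl K) : ∃ x : 𝓞 K, (x : K) ≠ 0 ∧ ordd v (x : K) = 1 := by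
  obtain ⟨π, hπ⟩ := v.intValuation_exists_uniformizer
  rw [← v.valuation_of_algebraMap (K := K)] at hπ
  replace hπ : v.valuation K (π : K) = WithZero.exp (-1) := hπ
  have h0 : (π : K) ≠ 0 := by
    intro h
    rw [h, map_zero] at hπ
    exact absurd hπ.symm (by simp)
  refine ⟨π, h0, ?_⟩
  unfold ordd
  rw [hπ]; rfl

theorem ordd_support (x : K) : {v : Pl K | ordd v x ≠ 0}.Finite := by
  by_cases hx : x = 0
  · subst hx; simp [ordd]
  obtain ⟨a, b, hb, rfl⟩ := IsFractionRing.div_surjective (A := 𝓞 K) x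
  have key : ∀ a : 𝓞 K, a ≠ 0 → {v : Pl K | ordd v (algebraMap (𝓞 K) K a) ≠ 0}.Finite := by
    intro a ha
    have := Ideal.finite_factors (I := Ideal.span {a}) (by simpa using ha)
    refine this.subset fun v hv => ?_
    simp only [Set.mem_ofPred_eq] at hv ⊢
    rw [Ideal.dvd_span_singleton]
    by_contra h
    rw [← IsDedekindDomain.HeightOneSpectrum.valuation_eq_one_iff_notMem (K := K)] at h
    apply hv; unfold ordd; rw [h]; simp
  have ha : a ≠ 0 := by rintro rfl; simp at hx
  have hb' : b ≠ 0 := nonZeroDivisors.ne_zero hb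
  refine ((key a ha).union (key b hb')).subset fun v hv => ?_
  simp only [Set.mem_ofPred_eq, Set.mem_union] at hv ⊢
  rw [ordd_div (by simpa using ha) (by simpa using hb')] at hv
  by_contra! h; apply hv; rw [h.1, h.2]; rfl

theorem eq_zero_of_og {x : K} (h : ∀ k, og v k x) : x = 0 := by
  by_contra hx
  have := (og_iff hx).1 (h (ordd v x + 1)); omega

/-- residual approximation -/
theorem og_approx {x : K} (h : og v 0 x) (n : ℕ) : ∃ y : 𝓞 K, og v n (x - y) := by
  obtain ⟨a, ha⟩ := v.exists_valuation_sub_lt_of_integer (K := K) (x := x) (by simpa [og] using h)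
    (Units.mk0 (WithZero.exp (-(n : ℤ))) (by simp))
  refine ⟨a, le_of_lt ?_⟩
  first
  | exact ha
  | (rw [Valuation.map_sub_swap]; exact ha)

end V1

section V2
variable {K : Type*} [Field K] [NumberField K] 
variable {L : Type*} [Field L] [NumberField L] [Algebra K L]

/-- place below -/
noncomputable abbrev dn (K : Type*) [Field K] [NumberField K] {L : Type*} [Field L] [NumberField L]
    [Algebra K L] (w : Pl L) : Pl K := w.under (𝓞 K)

/-- ramification index -/
noncomputable def eI (K : Type*) [Field K] [NumberField K] {L : Type*} [Field L] [NumberField L]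
    [Algebra K L] (w : Pl L) : ℕ := (dn K w).asIdeal.ramificationIdx' w.asIdeal

instance dn_liesOver (w : Pl L) : w.asIdeal.LiesOver (dn K w).asIdeal := ⟨rfl⟩

theorem eI_pos (w : Pl L) : 0 < eI K w :=
  Nat.pos_of_ne_zero (Ideal.IsDedekindDomain.ramificationIdx'_ne_zero_of_liesOver w.asIdeal
    (dn K w).ne_bot)

theorem val_dn (w : Pl L) (x : K) :
    (dn K w).valuation K x ^ eI K w = w.valuation L (algebraMap K L x) :=
  IsDedekindDomain.HeightOneSpectrum.valuation_liesOver L (dn K w) w x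

theorem ordd_dn (w : Pl L) (x : K) :
    ordd w (algebraMap K L x) = eI K w * ordd (dn K w) x := by
  unfold ordd; rw [← val_dn, WithZero.log_pow]; simp

theorem og_dn {w : Pl L} {x : K} {k : ℤ} (h : og (dn K w) k x) :
    og w (eI K w * k) (algebraMap K L x) := by
  by_cases hx : x = 0
  · subst hx; rw [map_zero]; exact og_zero _
  · rw [og_iff (by simpa using hx), ordd_dn]
    exact mul_le_mul_of_nonneg_left ((og_iff hx).1 h) (by positivity)

theorem og_dn_iff {w : Pl L} {x : K} {k : ℤ} :
    og w (eI K w * k) (algebraMap K L x) ↔ og (dn K w) k x := by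
  refine ⟨fun h => ?_, og_dn⟩
  by_cases hx : x = 0
  · subst hx; exact og_zero _
  · rw [og_iff (by simpa using hx), ordd_dn] at h
    rw [og_iff hx]
    exact le_of_mul_le_mul_left h (by exact_mod_cast eI_pos w)

theorem og_dn_one {w : Pl L} {x : K} :
    og w 1 (algebraMap K L x) ↔ og (dn K w) 1 x := by
  constructor
  · intro h
    by_cases hx : x = 0
    · subst hx; exact og_zero _
    rw [og_iff (by simpa using hx), ordd_dn] at h
    rw [og_iff hx]
    have := eI_pos (K := K) w
    by_contra! h'
    nlinarith
  · intro h
    refine og_mono (og_dn h) ?_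
    have := eI_pos (K := K) w
    omega

theorem exists_up (v : Pl K) : ∃ w : Pl L, dn K w = v := by
  obtain ⟨P, hP, hv⟩ := Ideal.exists_maximal_ideal_liesOver_of_isIntegral (S := 𝓞 L) v.asIdeal
  refine ⟨⟨P, hP.isPrime, ?_⟩, ?_⟩
  · rintro rfl
    apply v.ne_bot
    rw [hv.over]; ext; simp [Ideal.under]
  · ext1; exact hv.over.symm

theorem finite_up (v : Pl K) : {w : Pl L | dn K w = v}.Finite := by
  have := IsDedekindDomain.primesOver_finite v.asIdeal (𝓞 L)
  refine Set.Finite.of_finite_image (f := IsDedekindDomain.HeightOneSpectrum.asIdeal) (this.subset ?_) ?_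
  · rintro _ ⟨w, rfl, rfl⟩
    exact ⟨w.isPrime, inferInstance⟩
  · intro a _ b _ h; exact IsDedekindDomain.HeightOneSpectrum.ext h

theorem dn_dn {M : Type*} [Field M] [NumberField M] [Algebra K M] [Algebra L M]
    [IsScalarTower K L M] (w : Pl M) : dn K (dn L w) = dn K w := by
  ext1
  simp [Ideal.under_under]

theorem eI_eI {M : Type*} [Field M] [NumberField M] [Algebra K M] [Algebra L M]
    [IsScalarTower K L M] (w : Pl M) : eI K w = eI L w * eI K (dn L w) := by
  obtain ⟨x, hx, h1⟩ := ordd_exists (dn K w)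
  have h2 := ordd_dn w (x : K)
  have h3 := ordd_dn w (algebraMap K L (x : K))
  rw [← IsScalarTower.algebraMap_apply K L M, h2, ordd_dn, dn_dn (K := K) (L := L), h1] at h3
  exact_mod_cast (by simpa using h3 : (eI K w : ℤ) = eI L w * eI K (dn L w))

/-- transport of places along ring isomorphisms -/
noncomputable def gact {L' : Type*} [Field L'] [NumberField L'] (e : L ≃+* L') (w : Pl L) : Pl L' :=
  w.comap ((RingOfIntegers.mapRingEquiv e).symm : 𝓞 L' →+* 𝓞 L)
    (RingOfIntegers.mapRingEquiv e).symm.surjective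

section gactsec
variable {L' : Type*} [Field L'] [NumberField L'] (e : L ≃+* L') (w : Pl L)

theorem gact_asIdeal : (gact e w).asIdeal = w.asIdeal.map (RingOfIntegers.mapRingEquiv e) := by
  rw [← Ideal.comap_symm]; rfl

theorem og_gact_int (n : ℕ) (x : 𝓞 L) :
    og (gact e w) n (e (x : L)) ↔ og w n (x : L) := by
  have h1 : e (x : L) = ((RingOfIntegers.mapRingEquiv e x : 𝓞 L') : L') := rfl
  rw [h1, og_int_iff, og_int_iff, gact_asIdeal, ← Ideal.map_pow]
  exact Ideal.apply_mem_of_equiv_iff (I := w.asIdeal ^ n) (f := RingOfIntegers.mapRingEquiv e)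

theorem ordd_gact_int (x : 𝓞 L) : ordd (gact e w) (e (x : L)) = ordd w (x : L) := by
  by_cases hx : (x : L) = 0
  · rw [hx, map_zero]; simp [ordd]
  have hx' : e (x : L) ≠ 0 := by simpa using hx
  have h1 := ordd_int_nonneg (v := w) x
  have h2 : 0 ≤ ordd (gact e w) (e (x : L)) :=
    ordd_int_nonneg (v := gact e w) (RingOfIntegers.mapRingEquiv e x)
  have key := fun n => og_gact_int e w n x
  simp only [og_iff hx, og_iff hx'] at key
  have a := (key (ordd w (x : L)).toNat).2 (by omega)
  have b := (key (ordd (gact e w) (e (x : L))).toNat).1 (by omega)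
  omega

theorem ordd_gact (x : L) : ordd (gact e w) (e x) = ordd w x := by
  by_cases hx : x = 0
  · rw [hx, map_zero]; simp [ordd]
  obtain ⟨a, b, hb, rfl⟩ := IsFractionRing.div_surjective (A := 𝓞 L) x
  have hb' : algebraMap (𝓞 L) L b ≠ 0 := by simpa using nonZeroDivisors.ne_zero hb
  have ha : algebraMap (𝓞 L) L a ≠ 0 := by rintro h; simp [h] at hx
  rw [map_div₀, ordd_div (by simpa using ha) (by simpa using hb'), ordd_div ha hb']
  have h1 := ordd_gact_int e w a
  have h2 := ordd_gact_int e w b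
  rw [show algebraMap (𝓞 L) L a = (a : L) from rfl, show algebraMap (𝓞 L) L b = (b : L) from rfl,
    h1, h2]

theorem og_gact (k : ℤ) (x : L) : og (gact e w) k (e x) ↔ og w k x := by
  by_cases hx : x = 0
  · rw [hx, map_zero]; exact ⟨fun _ => og_zero _, fun _ => og_zero _⟩
  · rw [og_iff hx, og_iff (by simpa using hx), ordd_gact]

theorem gact_gact {L'' : Type*} [Field L''] [NumberField L''] (e' : L' ≃+* L'') :
    gact e' (gact e w) = gact (e.trans e') w := by
  ext1; rfl

theorem gact_refl : gact (RingEquiv.refl L) w = w := by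
  ext1; ext x; rfl

theorem gact_symm (e : L ≃+* L') (w' : Pl L') (x : L) : ordd (gact e.symm w') x = ordd w' (e x) := by
  have := ordd_gact e.symm w' (e x); simpa using this

theorem gact_injective : Function.Injective (gact e) := by
  intro a b h
  have : gact e.symm (gact e a) = gact e.symm (gact e b) := by rw [h]
  rw [gact_gact, gact_gact] at this
  simpa [gact_refl] using this

theorem dn_gact {L' : Type*} [Field L'] [NumberField L'] [Algebra K L'] (e : L ≃ₐ[K] L') (w : Pl L) :
    dn K (gact (e : L ≃+* L') w) = dn K w := by
  ext1; ext x
  simp only [dn, IsDedekindDomain.HeightOneSpectrum.under_asIdeal, Ideal.under, Ideal.mem_comap]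
  rw [gact_asIdeal]
  have : algebraMap (𝓞 K) (𝓞 L') x = RingOfIntegers.mapRingEquiv (e : L ≃+* L') (algebraMap (𝓞 K) (𝓞 L) x) := by
    ext
    change algebraMap K L' (x : K) = e (algebraMap K L (x : K))
    simp
  rw [this]
  exact Ideal.apply_mem_of_equiv_iff (I := w.asIdeal) (f := RingOfIntegers.mapRingEquiv (e : L ≃+* L'))

theorem gact_trans_exists [IsGalois K L] (w w' : Pl L) (h : dn K w = dn K w') :
    ∃ g : L ≃ₐ[K] L, gact (g : L ≃+* L) w = w' := by
  have : w'.asIdeal.LiesOver (dn K w).asIdeal := by rw [h]; infer_instance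
  obtain ⟨g, hg⟩ := Ideal.exists_smul_eq_of_isGaloisGroup (dn K w).asIdeal w.asIdeal w'.asIdeal
    (L ≃ₐ[K] L)
  refine ⟨g, ?_⟩
  ext1
  rw [gact_asIdeal, ← hg]
  rfl

theorem eI_gact (e : L ≃ₐ[K] L) (w : Pl L) : eI K (gact (e : L ≃+* L) w) = eI K w := by
  obtain ⟨x, hx, h1⟩ := ordd_exists (dn K w)
  have h2 := ordd_dn w (x : K)
  have h3 := ordd_dn (gact (e : L ≃+* L) w) (x : K)
  have h4 := ordd_gact (e : L ≃+* L) w (algebraMap K L (x : K))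
  rw [show (e : L ≃+* L) (algebraMap K L (x : K)) = algebraMap K L (x : K) from e.commutes _,
    h2, h3, dn_gact, h1] at h4
  simpa using h4
end gactsec

theorem ordd_norm [IsGalois K L] (w : Pl L) {y : L} (hy : y ≠ 0) :
    eI K w * ordd (dn K w) (Algebra.norm K y) =
      ∑ g : L ≃ₐ[K] L, ordd (gact (g : L ≃+* L) w) y := by
  rw [← ordd_dn, Algebra.norm_eq_prod_automorphisms, ordd_prod _ _ (fun g _ => by simpa using hy)]
  refine Fintype.sum_equiv (Equiv.inv _) _ _ fun g => ?_
  have := ordd_gact ((g⁻¹ : L ≃ₐ[K] L) : L ≃+* L) w (g y)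
  rw [← this]
  congr 1
  exact (g.symm_apply_apply y)

end V2

section V3
variable {K : Type*} [Field K] [NumberField K] 
variable {L : Type*} [Field L] [NumberField L] [Algebra K L]

/-- inertia degree -/
noncomputable def fI (K : Type*) [Field K] [NumberField K] {L : Type*} [Field L] [NumberField L]
    [Algebra K L] (w : Pl L) : ℕ := w.asIdeal.inertiaDeg (𝓞 K)

theorem ncard_up (v : Pl K) : {w : Pl L | dn K w = v}.ncard = (v.asIdeal.primesOver (𝓞 L)).ncard := by
  have : v.asIdeal.primesOver (𝓞 L) =
      Set.image IsDedekindDomain.HeightOneSpectrum.asIdeal {w : Pl L | dn K w = v} := by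
    ext P
    constructor
    · rintro ⟨h1, h2⟩
      refine ⟨⟨P, h1, ?_⟩, ?_, rfl⟩
      · rintro rfl
        apply v.ne_bot
        rw [h2.over]; ext; simp [Ideal.under]
      · ext1; exact h2.over.symm
    · rintro ⟨w, rfl, rfl⟩
      exact ⟨w.isPrime, inferInstance⟩
  rw [this, Set.ncard_image_of_injective]
  intro a b h; exact IsDedekindDomain.HeightOneSpectrum.ext h

theorem efg [IsGalois K L] (w : Pl L) :
    {w' : Pl L | dn K w' = dn K w}.ncard * (eI K w * fI K w) = Module.finrank K L := by
  rw [ncard_up, eI, fI, Ideal.ramificationIdx'_eq_ramificationIdx _ _ (dn K w).ne_bot,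
    ← Ideal.ramificationIdxIn_eq_ramificationIdx (dn K w).asIdeal w.asIdeal (L ≃ₐ[K] L),
    ← Ideal.inertiaDegIn_eq_inertiaDeg (dn K w).asIdeal w.asIdeal (L ≃ₐ[K] L),
    Ideal.ncard_primesOver_mul_ramificationIdxIn_mul_inertiaDegIn (dn K w).asIdeal (𝓞 L) (L ≃ₐ[K] L),
    IsGalois.card_aut_eq_finrank]

theorem residue_surj {w : Pl L} (h : fI K w = 1) {x : L} (hx : og w 0 x) :
    ∃ b : 𝓞 K, og w 1 (x - algebraMap K L b) := by
  obtain ⟨y, hy⟩ := og_approx hx 1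
  have hf : Module.finrank (𝓞 K ⧸ (dn K w).asIdeal) (𝓞 L ⧸ w.asIdeal) = 1 := by
    rw [← h, fI, ← Ideal.inertiaDeg'_eq_inertiaDeg (dn K w).asIdeal w.asIdeal,
      Ideal.inertiaDeg'_algebraMap]
  obtain ⟨b, hb⟩ : ∃ b : 𝓞 K, algebraMap (𝓞 K) (𝓞 L) b - y ∈ w.asIdeal := by
    have : (dn K w).asIdeal.IsMaximal := (dn K w).isMaximal
    let _ := Ideal.Quotient.field (dn K w).asIdeal
    have : Module.Free (𝓞 K ⧸ (dn K w).asIdeal) (𝓞 L ⧸ w.asIdeal) := Module.Free.of_divisionRing _ _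
    have := (Subalgebra.bot_eq_top_iff_finrank_eq_one).2 hf
    have h2 : (Ideal.Quotient.mk w.asIdeal y) ∈ (⊤ : Subalgebra (𝓞 K ⧸ (dn K w).asIdeal) (𝓞 L ⧸ w.asIdeal)) := trivial
    rw [← this, Algebra.mem_bot] at h2
    obtain ⟨b, hb⟩ := h2
    obtain ⟨b, rfl⟩ := Ideal.Quotient.mk_surjective b
    refine ⟨b, ?_⟩
    rw [← Ideal.Quotient.eq]
    exact hb
  refine ⟨b, ?_⟩
  rw [← og_int_one_iff] at hb
  have : x - algebraMap K L b = (x - y) - ((algebraMap (𝓞 K) (𝓞 L) b - y : 𝓞 L) : L) := by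
    push_cast
    change _ = (x - y) - (algebraMap K L (b : K) - y)
    ring
  rw [this]
  exact og_sub (by simpa using hy) hb

variable (K) in
/-- `w` is the only place above its restriction. -/
def NS (w : Pl L) : Prop := ∀ w' : Pl L, dn K w' = dn K w → w' = w

theorem ns_or_split [IsGalois K L] {p : ℕ} (hp : p.Prime) (h : Module.finrank K L = p) (w : Pl L) :
    (NS K w ∧ eI K w * fI K w = p ∧ {w' : Pl L | dn K w' = dn K w}.ncard = 1) ∨
    (¬ NS K w ∧ eI K w = 1 ∧ fI K w = 1 ∧ {w' : Pl L | dn K w' = dn K w}.ncard = p) := by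
  have h1 := efg (K := K) w
  rw [h] at h1
  have hfin := finite_up (K := K) (L := L) (dn K w)
  have hns : NS K w ↔ {w' : Pl L | dn K w' = dn K w}.ncard = 1 := by
    rw [Set.ncard_eq_one]
    constructor
    · intro hw
      refine ⟨w, ?_⟩
      ext w'
      exact ⟨fun h => hw w' h, fun h => by rw [h]; rfl⟩
    · rintro ⟨a, ha⟩ w' hw'
      have h2 : w ∈ {w' : Pl L | dn K w' = dn K w} := rfl
      have h3 : w' ∈ {w' : Pl L | dn K w' = dn K w} := hw'
      rw [ha] at h2 h3
      rw [h2, h3]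
  rcases (Nat.dvd_prime hp).1 (Dvd.intro _ h1) with h2 | h2
  · left
    refine ⟨hns.2 h2, ?_, h2⟩
    rw [h2, one_mul] at h1; exact h1
  · right
    refine ⟨fun h3 => ?_, ?_⟩
    · rw [hns.1 h3] at h2; exact hp.one_lt.ne h2
    · rw [h2] at h1
      have : eI K w * fI K w = 1 := by
        apply Nat.eq_of_mul_eq_mul_left hp.pos; rw [h1, mul_one]
      exact ⟨Nat.eq_one_of_mul_eq_one_right this, Nat.eq_one_of_mul_eq_one_left this, h2⟩

theorem NS.gact {w : Pl L} (h : NS K w) (g : L ≃ₐ[K] L) : gact (g : L ≃+* L) w = w :=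
  h _ (dn_gact g w)

theorem NS.og {w : Pl L} (h : NS K w) (g : L ≃ₐ[K] L) {k : ℤ} {x : L} : og w k (g x) ↔ og w k x := by
  conv_lhs => rw [← h.gact g]
  exact og_gact _ _ _ _

theorem NS.ordd {w : Pl L} (h : NS K w) (g : L ≃ₐ[K] L) (x : L) : ordd w (g x) = ordd w x := by
  conv_lhs => rw [← h.gact g]
  exact ordd_gact _ _ _

/-- a single nontrivial fixing automorphism in prime degree implies nonsplit -/
theorem ns_of_fix [IsGalois K L] {p : ℕ} (hp : p.Prime) (h : Module.finrank K L = p) (w : Pl L)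
    (g : L ≃ₐ[K] L) (hg : g ≠ 1) (hw : gact (g : L ≃+* L) w = w) : NS K w := by
  intro w' hw'
  obtain ⟨g', rfl⟩ := gact_trans_exists (K := K) w w' hw'.symm
  have hc : Nat.card (L ≃ₐ[K] L) = p := by rw [IsGalois.card_aut_eq_finrank, h]
  have : Fact p.Prime := ⟨hp⟩
  have hz := mem_zpowers_of_prime_card (g := g) (g' := g') hc hg
  rw [← mem_powers_iff_mem_zpowers] at hz
  obtain ⟨n, rfl⟩ := hz
  change gact ((g ^ n : L ≃ₐ[K] L) : L ≃+* L) w = w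
  induction n with
  | zero => rw [pow_zero]; exact gact_refl w
  | succ n ih =>
    have := gact_gact (g : L ≃+* L) w ((g ^ n : L ≃ₐ[K] L) : L ≃+* L)
    rw [hw, ih (by rw [dn_gact])] at this
    rw [pow_succ]
    exact this.symm

theorem relNorm_place (P : Pl L) :
    Ideal.relNorm (𝓞 K) P.asIdeal = (dn K P).asIdeal ^ fI K P := by
  have : P.asIdeal.IsMaximal := P.isMaximal
  have : (dn K P).asIdeal.IsMaximal := (dn K P).isMaximal
  exact Ideal.relNorm_eq_pow_of_isMaximal P.asIdeal (dn K P).asIdeal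

theorem fI_fI {M : Type*} [Field M] [NumberField M] [Algebra K M] [Algebra L M]
    [IsScalarTower K L M] (w : Pl M) : fI K w = fI K (dn L w) * fI L w := by
  unfold fI
  exact Ideal.inertiaDeg_tower (dn L w).asIdeal w.asIdeal

end V3

section V4
variable {K : Type*} [Field K] [NumberField K] 

theorem weak_approx_int (S : Finset (Pl K)) (x : Pl K → 𝓞 K) (n : ℕ) :
    ∃ y : 𝓞 K, ∀ v ∈ S, og v n ((y : K) - (x v : K)) := by
  obtain ⟨y, hy⟩ := IsDedekindDomain.exists_forall_sub_mem_ideal (s := S)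
    (fun v : Pl K => v.asIdeal) (fun _ => n) (fun v _ => v.prime)
    (fun i _ j _ hij h => hij (IsDedekindDomain.HeightOneSpectrum.ext h))
    (fun v => x v)
  refine ⟨y, fun v hv => ?_⟩
  have := hy v hv
  rw [← og_int_iff] at this
  simpa using this

theorem exists_den (S : Finset (Pl K)) (x : Pl K → K) :
    ∃ d : 𝓞 K, d ≠ 0 ∧ ∀ v ∈ S, ∃ y : 𝓞 K, (y : K) = d * x v := by
  obtain ⟨b, hb⟩ := IsLocalization.exist_integer_multiples (𝓞 K)⁰ S x
  refine ⟨b, nonZeroDivisors.ne_zero b.2, fun v hv => ?_⟩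
  obtain ⟨y, hy⟩ := hb v hv
  refine ⟨y, ?_⟩
  rw [show (y : K) = _ from hy, Algebra.smul_def]

theorem weak_approx (S : Finset (Pl K)) (x : Pl K → K) (n : ℤ) :
    ∃ y : K, ∀ v ∈ S, og v n (y - x v) := by
  classical
  obtain ⟨d, hd, hx⟩ := exists_den S x
  have hx' : ∀ v, ∃ y : 𝓞 K, v ∈ S → (y : K) = d * x v := fun v => by
    by_cases h : v ∈ S
    · obtain ⟨y, hy⟩ := hx v h; exact ⟨y, fun _ => hy⟩
    · exact ⟨0, fun h' => absurd h' h⟩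
  choose z hz using hx'
  obtain ⟨N, hN⟩ : ∃ N : ℕ, ∀ v ∈ S, n + ordd v (d : K) ≤ N := by
    refine ⟨S.sup fun v => (n + ordd v (d : K)).toNat, fun v hv => ?_⟩
    have := Finset.le_sup (f := fun v => (n + ordd v (d : K)).toNat) hv
    omega
  obtain ⟨y, hy⟩ := weak_approx_int S z N
  have hd' : (d : K) ≠ 0 := by simpa using hd
  refine ⟨y / d, fun v hv => ?_⟩
  have h1 := hy v hv
  rw [hz v hv] at h1
  have h2 := og_mul (og_mono h1 (hN v hv)) (og_ordd (v := v) ((d : K)⁻¹))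
  rw [ordd_inv] at h2
  convert h2 using 1
  · ring
  · field_simp

/-- `1`-units of level `k` (units at `v` for `k = 0`). -/
def Wv (v : Pl K) (k : ℕ) : Subgroup Kˣ where
  carrier := {x | ordd v (x : K) = 0 ∧ og v k ((x : K) - 1)}
  one_mem' := ⟨by simp, by simpa using og_zero _⟩
  mul_mem' := by
    rintro a b ⟨ha, ha'⟩ ⟨hb, hb'⟩
    refine ⟨by rw [Units.val_mul, ordd_mul a.ne_zero b.ne_zero, ha, hb]; rfl, ?_⟩
    have : ((a * b : Kˣ) : K) - 1 = ((a : K) - 1) * b + (b - 1) := by push_cast; ring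
    rw [this]
    exact og_add (og_mul_unit ha' ((og_iff b.ne_zero).2 hb.ge)) hb'
  inv_mem' := by
    rintro a ⟨ha, ha'⟩
    refine ⟨by simpa using ha, ?_⟩
    have : ((a⁻¹ : Kˣ) : K) - 1 = -(((a : K) - 1) * (a : K)⁻¹) := by
      rw [sub_mul, mul_inv_cancel₀ a.ne_zero]; push_cast; ring
    rw [this]
    exact og_neg (og_mul_unit ha' ((og_iff (inv_ne_zero a.ne_zero)).2 (by simp [ha])))

theorem mem_Wv {v : Pl K} {k : ℕ} {x : Kˣ} :
    x ∈ Wv v k ↔ ordd v (x : K) = 0 ∧ og v k ((x : K) - 1) := Iff.rfl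

theorem mem_Wv_pos {v : Pl K} {k : ℕ} (hk : 0 < k) {x : Kˣ} :
    x ∈ Wv v k ↔ og v k ((x : K) - 1) :=
  ⟨fun h => h.2, fun h => ⟨(ordd_of_og_one (og_mono h (by omega))).2, h⟩⟩

theorem mem_Wv_zero {v : Pl K} {x : Kˣ} : x ∈ Wv v 0 ↔ ordd v (x : K) = 0 :=
  ⟨fun h => h.1, fun h => ⟨h, og_sub ((og_iff x.ne_zero).2 h.ge) og_one⟩⟩

theorem Wv_anti {v : Pl K} {k l : ℕ} (h : k ≤ l) : Wv v l ≤ Wv v k :=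
  fun _ hx => ⟨hx.1, og_mono hx.2 (by exact_mod_cast h)⟩

theorem mem_Wv_div {v : Pl K} {k : ℕ} (hk : 0 < k) {x y : Kˣ} :
    x / y ∈ Wv v k ↔ og v (k + ordd v (y : K)) ((x : K) - y) := by
  rw [mem_Wv_pos hk]
  have h1 : ((x / y : Kˣ) : K) - 1 = ((x : K) - y) * (y : K)⁻¹ := by
    rw [sub_mul, mul_inv_cancel₀ y.ne_zero]; simp [div_eq_mul_inv]
  have h2 : ((x : K) - y) = (((x / y : Kˣ) : K) - 1) * y := by
    rw [h1, mul_assoc, inv_mul_cancel₀ y.ne_zero, mul_one]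
  constructor
  · intro h
    rw [h2]
    exact og_mul h (og_ordd _)
  · intro h
    rw [h1]
    have := og_mul h (og_ordd (v := v) ((y : K)⁻¹))
    rw [ordd_inv] at this
    convert this using 1; ring

theorem weak_approx_units (S : Finset (Pl K)) (x : Pl K → Kˣ) (m : Pl K → ℕ) :
    ∃ y : Kˣ, ∀ v ∈ S, y / x v ∈ Wv v (m v) := by
  classical
  obtain ⟨N, hN⟩ : ∃ N : ℕ, ∀ v ∈ S, (m v + 1 : ℕ) + ordd v (x v : K) ≤ N := by
    refine ⟨S.sup fun v => ((m v + 1 : ℕ) + ordd v (x v : K)).toNat, fun v hv => ?_⟩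
    have := Finset.le_sup (f := fun v => ((m v + 1 : ℕ) + ordd v (x v : K)).toNat) hv
    omega
  obtain ⟨y, hy⟩ := weak_approx S (fun v => (x v : K)) N
  by_cases hS : S = ∅
  · subst hS; exact ⟨1, by simp⟩
  obtain ⟨v0, hv0⟩ := Finset.nonempty_of_ne_empty hS
  have hy0 : y ≠ 0 := by
    rintro rfl
    have h1 := hy v0 hv0
    rw [zero_sub] at h1
    have h2 := (og_iff (by simp)).1 h1
    rw [ordd_neg] at h2
    have := hN v0 hv0
    omega
  refine ⟨Units.mk0 y hy0, fun v hv => Wv_anti (Nat.le_succ _) ?_⟩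
  rw [mem_Wv_div (by omega)]
  exact og_mono (hy v hv) (hN v hv)

/-- the index of an intersection of subgroups that are open for distinct places -/
theorem index_inf_open (S : Finset (Pl K)) (H : Pl K → Subgroup Kˣ) (m : Pl K → ℕ)
    (hH : ∀ v ∈ S, Wv v (m v) ≤ H v) :
    (⨅ v ∈ S, H v).index = ∏ v ∈ S, (H v).index := by
  classical
  induction S using Finset.induction_on with
  | empty => simp
  | insert a s ha ih =>
    rw [Finset.prod_insert ha, Finset.iInf_insert, ← ih fun v hv => hH v (by simp [hv])]
    have h1 : (H a ⊔ ⨅ v ∈ s, H v) = ⊤ := by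
      rw [eq_top_iff]
      rintro x -
      obtain ⟨y, hy⟩ := weak_approx_units (insert a s) (fun v => if v = a then x else 1) m
      have h1 := hH a (by simp) (hy a (by simp))
      have h2 : y ∈ ⨅ v ∈ s, H v := by
        simp only [Subgroup.mem_iInf]
        intro v hv
        have := hH v (by simp [hv]) (hy v (by simp [hv]))
        have hva : v ≠ a := by rintro rfl; exact ha hv
        simpa [hva] using this
      rw [if_pos rfl] at h1
      have : x = (y / x)⁻¹ * y := by simp
      rw [this]
      exact Subgroup.mul_mem_sup (inv_mem h1) h2
    have h2 : (H a).relIndex (⨅ v ∈ s, H v) = (H a).index := by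
      rw [← Subgroup.relIndex_sup_right, sup_comm, h1, Subgroup.relIndex_top_right]
    rw [← h2, ← Subgroup.inf_relIndex_right, Subgroup.relIndex_mul_index inf_le_right]

section residue
variable (v : Pl K)

open Classical in
/-- residue map, junk on non-integral elements -/
noncomputable def rmap (x : K) : 𝓞 K ⧸ v.asIdeal :=
  if h : og v 0 x then Ideal.Quotient.mk _ (og_approx h 1).choose else 0

variable {v}

theorem rmap_eq_iff {x : K} (hx : og v 0 x) (y : 𝓞 K) :
    rmap v x = Ideal.Quotient.mk _ y ↔ og v 1 (x - y) := by
  have h := (og_approx hx 1).choose_spec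
  rw [rmap, dif_pos hx, Ideal.Quotient.eq, ← og_int_one_iff]
  set z := (og_approx hx 1).choose
  push_cast at h ⊢
  constructor
  · intro h'
    convert og_add h h' using 1; ring
  · intro h'
    convert og_sub h' h using 1; ring

theorem rmap_rep {x : K} (hx : og v 0 x) :
    ∃ y : 𝓞 K, og v 1 (x - y) ∧ rmap v x = Ideal.Quotient.mk _ y := by
  obtain ⟨y, hy⟩ := og_approx hx 1
  exact ⟨y, hy, (rmap_eq_iff hx y).2 hy⟩

theorem rmap_int (x : 𝓞 K) : rmap v (x : K) = Ideal.Quotient.mk _ x :=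
  (rmap_eq_iff (og_int x) x).2 (by rw [sub_self]; exact og_zero _)

theorem rmap_mul {x y : K} (hx : og v 0 x) (hy : og v 0 y) :
    rmap v (x * y) = rmap v x * rmap v y := by
  obtain ⟨a, ha, ha'⟩ := rmap_rep hx
  obtain ⟨b, hb, hb'⟩ := rmap_rep hy
  rw [ha', hb', ← map_mul, rmap_eq_iff (by simpa using og_mul hx hy)]
  have : x * y - ((a * b : 𝓞 K) : K) = (x - a) * y + (y - b) * a := by push_cast; ring
  rw [this]
  exact og_add (og_mul_unit ha hy) (og_mul_unit hb (og_int a))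

theorem rmap_add {x y : K} (hx : og v 0 x) (hy : og v 0 y) :
    rmap v (x + y) = rmap v x + rmap v y := by
  obtain ⟨a, ha, ha'⟩ := rmap_rep hx
  obtain ⟨b, hb, hb'⟩ := rmap_rep hy
  rw [ha', hb', ← map_add, rmap_eq_iff (by simpa using og_add hx hy)]
  have : x + y - ((a + b : 𝓞 K) : K) = (x - a) + (y - b) := by push_cast; ring
  rw [this]
  exact og_add ha hb

theorem rmap_one : rmap v (1 : K) = 1 := by
  have := rmap_int (v := v) (1 : 𝓞 K)
  simpa using this

theorem rmap_eq_zero {x : K} (hx : og v 0 x) : rmap v x = 0 ↔ og v 1 x := by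
  have := rmap_eq_iff hx 0
  simpa using this

theorem rmap_eq {x y : K} (hx : og v 0 x) (hy : og v 0 y) : rmap v x = rmap v y ↔ og v 1 (x - y) := by
  obtain ⟨b, hb, hb'⟩ := rmap_rep hy
  rw [hb', rmap_eq_iff hx]
  constructor
  · intro h; convert og_sub h hb using 1; ring
  · intro h; convert og_add h hb using 1; ring

theorem og_of_W {k : ℕ} (x : Wv v k) : og v 0 ((x : Kˣ) : K) :=
  (og_iff (x : Kˣ).ne_zero).2 x.2.1.ge

variable (v) in
/-- residue map on units -/
noncomputable def ures : Wv v 0 →* (𝓞 K ⧸ v.asIdeal)ˣ :=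
  MonoidHom.toHomUnits
    { toFun := fun x => rmap v ((x : Kˣ) : K)
      map_one' := rmap_one
      map_mul' := fun x y => rmap_mul (og_of_W x) (og_of_W y) }

theorem ures_apply (x : Wv v 0) : ((ures v x : (𝓞 K ⧸ v.asIdeal)ˣ) : 𝓞 K ⧸ v.asIdeal) = rmap v ((x : Kˣ) : K) := rfl

theorem ures_ker : (ures v).ker = (Wv v 1).subgroupOf (Wv v 0) := by
  ext x
  rw [MonoidHom.mem_ker, Units.ext_iff, ures_apply, Subgroup.mem_subgroupOf, mem_Wv_pos one_pos,
    Units.val_one, ← rmap_one (v := v), rmap_eq (og_of_W x) og_one]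
  simp

theorem ures_surj : Function.Surjective (ures v) := by
  intro y
  obtain ⟨a, ha⟩ := Ideal.Quotient.mk_surjective (y : 𝓞 K ⧸ v.asIdeal)
  have h1 : a ∉ v.asIdeal := by
    intro h
    rw [← Ideal.Quotient.eq_zero_iff_mem, ha] at h
    have : Nontrivial (𝓞 K ⧸ v.asIdeal) := Ideal.Quotient.nontrivial_iff.2 v.isPrime.ne_top
    exact y.ne_zero h
  have h0 : (a : K) ≠ 0 := by
    intro h; apply h1
    have : a = 0 := by simpa using h
    rw [this]; exact zero_mem _
  have h2 : ordd v (a : K) = 0 := by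
    have h3 := ordd_int_nonneg (v := v) a
    rw [← og_int_one_iff, og_iff h0] at h1
    omega
  refine ⟨⟨Units.mk0 (a : K) h0, mem_Wv_zero.2 h2⟩, ?_⟩
  rw [Units.ext_iff, ures_apply, ← ha]
  exact rmap_int a

variable (v) in
/-- residue cardinality -/
noncomputable def qI : ℕ := Nat.card (𝓞 K ⧸ v.asIdeal)

instance finite_residue : Finite (𝓞 K ⧸ v.asIdeal) := Ideal.finiteQuotientOfFreeOfNeBot _ v.ne_bot

theorem relIndex_W01 : (Wv v 1).relIndex (Wv v 0) = Nat.card (𝓞 K ⧸ v.asIdeal)ˣ := by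
  rw [Subgroup.relIndex, ← ures_ker, Subgroup.index_ker, MonoidHom.range_eq_top.2 ures_surj]
  exact Subgroup.card_top

theorem card_units_residue : Nat.card (𝓞 K ⧸ v.asIdeal)ˣ = qI v - 1 := by
  have : v.asIdeal.IsMaximal := v.isMaximal
  let _ := Ideal.Quotient.field v.asIdeal
  exact Nat.card_units (𝓞 K ⧸ v.asIdeal)

theorem relIndex_Wk {k : ℕ} (hk : 0 < k) : (Wv v (k + 1)).relIndex (Wv v k) = qI v := by
  obtain ⟨π, hπ0, hπ⟩ := ordd_exists v
  have hdiv : ∀ x : K, ∀ l : ℤ, og v (l + k) x → og v l (x / (π : K) ^ k) := by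
    intro x l hx
    have := og_mul hx (og_ordd (v := v) (((π : K) ^ k)⁻¹))
    rw [ordd_inv, ordd_pow, hπ] at this
    rw [div_eq_mul_inv]
    convert this using 1; ring
  have hdiv' : ∀ x : K, ∀ l : ℤ, og v l (x / (π : K) ^ k) → og v (l + k) x := by
    intro x l hx
    have := og_mul hx (og_ordd (v := v) (((π : K) ^ k)))
    rw [ordd_pow, hπ, div_mul_cancel₀ _ (pow_ne_zero _ hπ0)] at this
    convert this using 1; ring
  have h0 : ∀ x : Wv v k, og v 0 ((((x : Kˣ) : K) - 1) / (π : K) ^ k) := fun x =>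
    hdiv _ _ (by simpa using x.2.2)
  let f : Wv v k →* Multiplicative (𝓞 K ⧸ v.asIdeal) :=
    { toFun := fun x => Multiplicative.ofAdd (rmap v ((((x : Kˣ) : K) - 1) / (π : K) ^ k))
      map_one' := by
        simp only [Subgroup.coe_one, Units.val_one, sub_self, zero_div]
        rw [(rmap_eq_zero (og_zero 0)).2 (og_zero 1)]; rfl
      map_mul' := fun x y => by
        rw [← ofAdd_add, ← rmap_add (h0 x) (h0 y)]
        congr 1
        rw [rmap_eq (h0 (x * y)) (og_add (h0 x) (h0 y))]
        have : (((x * y : Wv v k) : Kˣ) : K) - 1 = ((x : Kˣ) : K) * ((y : Kˣ) : K) - 1 := by simp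
        rw [this]
        have : (((x : Kˣ) : K) * ((y : Kˣ) : K) - 1) / (π : K) ^ k -
            ((((x : Kˣ) : K) - 1) / (π : K) ^ k + (((y : Kˣ) : K) - 1) / (π : K) ^ k) =
            ((((x : Kˣ) : K) - 1) * (((y : Kˣ) : K) - 1)) / (π : K) ^ k := by ring
        rw [this]
        apply hdiv
        exact og_mono (og_mul x.2.2 y.2.2) (by omega) }
  have hker : f.ker = (Wv v (k + 1)).subgroupOf (Wv v k) := by
    ext x
    rw [MonoidHom.mem_ker, Subgroup.mem_subgroupOf, mem_Wv_pos (by omega)]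
    change rmap v ((((x : Kˣ) : K) - 1) / (π : K) ^ k) = 0 ↔ _
    rw [rmap_eq_zero (h0 x)]
    push_cast
    rw [add_comm]
    exact ⟨fun h => hdiv' _ _ h, fun h => hdiv _ _ h⟩
  have hsurj : Function.Surjective f := by
    intro y
    obtain ⟨a, ha⟩ := Ideal.Quotient.mk_surjective y.toAdd
    have h1 : og v k (1 + (π : K) ^ k * a - 1) := by
      rw [add_sub_cancel_left]
      have := og_mul_unit (og_ordd (v := v) ((π : K) ^ k)) (og_int a)
      rw [ordd_pow, hπ, mul_one] at this; exact this
    have h2 := ordd_of_og_one (og_mono h1 (by omega : (1 : ℤ) ≤ k))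
    refine ⟨⟨Units.mk0 _ h2.1, h2.2, h1⟩, ?_⟩
    change Multiplicative.ofAdd (rmap v ((1 + (π : K) ^ k * a - 1) / (π : K) ^ k)) = y
    rw [add_sub_cancel_left, mul_div_cancel_left₀ _ (pow_ne_zero _ hπ0), rmap_int, ha]; rfl
  rw [Subgroup.relIndex, ← hker, Subgroup.index_ker, MonoidHom.range_eq_top.2 hsurj]
  exact Subgroup.card_top

theorem relIndex_W {k : ℕ} : (Wv v (k + 1)).relIndex (Wv v 0) = (qI v - 1) * qI v ^ k := by
  induction k with
  | zero => rw [relIndex_W01, card_units_residue]; simp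
  | succ k ih =>
    rw [← Subgroup.relIndex_mul_relIndex _ (Wv v (k+1)) _ (Wv_anti (by omega)) (Wv_anti (by omega)), ih,
      relIndex_Wk (by omega)]
    ring

theorem one_lt_qI : 1 < qI v := by
  have : Nontrivial (𝓞 K ⧸ v.asIdeal) := Ideal.Quotient.nontrivial_iff.2 v.isPrime.ne_top
  exact Finite.one_lt_card

theorem relIndex_W_ne_zero {k : ℕ} : (Wv v k).relIndex (Wv v 0) ≠ 0 := by
  have := one_lt_qI (v := v)
  rcases k with _ | k
  · simp
  · rw [relIndex_W]
    exact mul_ne_zero (by omega) (pow_ne_zero _ (by omega))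

theorem relIndex_W_sub {k j : ℕ} (hk : 0 < k) : (Wv v (k + j)).relIndex (Wv v k) = qI v ^ j := by
  induction j with
  | zero => simp
  | succ j ih =>
    rw [← Subgroup.relIndex_mul_relIndex _ (Wv v (k+j)) _ (Wv_anti (by omega)) (Wv_anti (by omega)), ih,
      ← add_assoc, relIndex_Wk (by omega)]
    ring

end residue

/-- the normalized valuation as a homomorphism -/
noncomputable def ordHom (v : Pl K) : Kˣ →* Multiplicative ℤ where
  toFun x := Multiplicative.ofAdd (ordd v (x : K))
  map_one' := by simp
  map_mul' x y := by rw [← ofAdd_add, Units.val_mul, ordd_mul x.ne_zero y.ne_zero]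

theorem qI_of_fI {L : Type*} [Field L] [NumberField L] [Algebra K L] {w : Pl L} (h : fI K w = 1) :
    qI w = qI (dn K w) := by
  symm
  refine Nat.card_eq_of_bijective (algebraMap (𝓞 K ⧸ (dn K w).asIdeal) (𝓞 L ⧸ w.asIdeal)) ⟨?_, ?_⟩
  · have : (dn K w).asIdeal.IsMaximal := (dn K w).isMaximal
    let _ := Ideal.Quotient.field (dn K w).asIdeal
    have : Nontrivial (𝓞 L ⧸ w.asIdeal) := Ideal.Quotient.nontrivial_iff.2 w.isPrime.ne_top
    exact (algebraMap (𝓞 K ⧸ (dn K w).asIdeal) (𝓞 L ⧸ w.asIdeal)).injective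
  · intro y
    obtain ⟨y, rfl⟩ := Ideal.Quotient.mk_surjective y
    obtain ⟨b, hb⟩ := residue_surj h (og_int (v := w) y)
    refine ⟨Ideal.Quotient.mk _ b, ?_⟩
    change Ideal.Quotient.mk _ (algebraMap (𝓞 K) (𝓞 L) b) = _
    rw [eq_comm, Ideal.Quotient.eq, ← og_int_one_iff]
    push_cast
    exact hb

end V4

section P2
variable {K : Type*} [Field K] [NumberField K] 

/-- S-units -/
def US (S : Finset (Pl K)) : Subgroup Kˣ where
  carrier := {x | ∀ v ∉ S, ordd v (x : K) = 0}
  one_mem' := by intro v _; simp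
  mul_mem' := by
    intro a b ha hb v hv
    rw [Units.val_mul, ordd_mul a.ne_zero b.ne_zero, ha v hv, hb v hv]; rfl
  inv_mem' := by
    intro a ha v hv
    simpa using ha v hv

theorem mem_US {S : Finset (Pl K)} {x : Kˣ} : x ∈ US S ↔ ∀ v ∉ S, ordd v (x : K) = 0 := Iff.rfl

theorem US_mono {S T : Finset (Pl K)} (h : S ⊆ T) : US S ≤ US T :=
  fun _ hx v hv => hx v (fun hv' => hv (h hv'))

theorem ordd_eq_zero_of_notMem {v : Pl K} {x : 𝓞 K} (h : x ∉ v.asIdeal) : ordd v (x : K) = 0 := by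
  have h0 : (x : K) ≠ 0 := by
    intro h'; apply h
    have : x = 0 := by simpa using h'
    rw [this]; exact zero_mem _
  have h3 := ordd_int_nonneg (v := v) x
  rw [← og_int_one_iff, og_iff h0] at h
  omega

theorem pl_eq_of_le {v v' : Pl K} (h : v.asIdeal ≤ v'.asIdeal) : v = v' := by
  have := v.isMaximal.eq_of_le v'.isPrime.ne_top h
  exact IsDedekindDomain.HeightOneSpectrum.ext this

theorem ordd_of_span_pow {v : Pl K} {n : ℕ} {x : 𝓞 K} (hx : Ideal.span {x} = v.asIdeal ^ n) :
    (x : K) ≠ 0 ∧ ordd v (x : K) = n ∧ ∀ v' : Pl K, v' ≠ v → ordd v' (x : K) = 0 := by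
  have h0 : x ≠ 0 := by
    rintro rfl
    rw [Ideal.span_singleton_eq_bot.2 rfl] at hx
    exact pow_ne_zero n v.ne_bot hx.symm
  have h0' : (x : K) ≠ 0 := by simpa using h0
  have hle : ∀ v' : Pl K, ∀ k : ℕ, og v' k (x : K) ↔ v.asIdeal ^ n ≤ v'.asIdeal ^ k := by
    intro v' k
    rw [og_int_iff, ← hx, Ideal.span_singleton_le_iff_mem]
  refine ⟨h0', ?_, ?_⟩
  · have h1 := (hle v n).2 le_rfl
    have h2 : ¬ og v (n + 1 : ℕ) (x : K) := by
      rw [hle]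
      intro h
      have h3 := Ideal.pow_right_strictAnti v.asIdeal v.ne_bot v.isPrime.ne_top (Nat.lt_succ_self n)
      exact absurd (lt_of_lt_of_le h3 h) (lt_irrefl _)
    rw [og_iff h0'] at h1 h2
    push_cast at h2; omega
  · intro v' hv'
    apply ordd_eq_zero_of_notMem
    intro h
    have h1 : v.asIdeal ^ n ≤ v'.asIdeal := by
      rw [← hx, Ideal.span_singleton_le_iff_mem]; exact h
    exact hv' (pl_eq_of_le (v'.isPrime.le_of_pow_le h1)).symm

theorem exists_hpow (v : Pl K) : ∃ x : Kˣ, ordd v (x : K) = classNumber K ∧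
    ∀ v' : Pl K, v' ≠ v → ordd v' (x : K) = 0 := by
  have h1 : (ClassGroup.mk0 (⟨v.asIdeal, mem_nonZeroDivisors_of_ne_zero v.ne_bot⟩ : (Ideal (𝓞 K))⁰)) ^
      (classNumber K) = 1 := by
    rw [classNumber]; exact pow_card_eq_one
  rw [← map_pow, ClassGroup.mk0_eq_one_iff] at h1
  obtain ⟨x, hx⟩ := h1
  have := ordd_of_span_pow (v := v) (n := classNumber K) (x := x) hx.symm
  exact ⟨Units.mk0 _ this.1, this.2⟩

theorem mem_units_of_ordd {x : Kˣ} (h : ∀ v : Pl K, ordd v (x : K) = 0) :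
    ∃ u : (𝓞 K)ˣ, ((u : 𝓞 K) : K) = x := by
  obtain ⟨a, ha⟩ := integral_of_og (x := (x : K)) (fun v => (og_iff x.ne_zero).2 (h v).ge)
  obtain ⟨b, hb⟩ := integral_of_og (x := (x : K)⁻¹)
    (fun v => (og_iff (inv_ne_zero x.ne_zero)).2 (by simp [h v]))
  have hab : a * b = 1 := by
    apply RingOfIntegers.ext
    change (a : K) * (b : K) = 1
    rw [ha, hb, mul_inv_cancel₀ x.ne_zero]
  exact ⟨Units.mkOfMulEqOne a b hab, ha⟩

theorem ordd_unit (u : (𝓞 K)ˣ) (v : Pl K) : ordd v ((u : 𝓞 K) : K) = 0 := by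
  apply ordd_eq_zero_of_notMem
  intro h
  exact v.isPrime.ne_top (Ideal.eq_top_of_isUnit_mem _ h u.isUnit)

/-- valuation map on S-units -/
noncomputable def usval (S : Finset (Pl K)) : Additive (US S) →ₗ[ℤ] (S → ℤ) :=
  AddMonoidHom.toIntLinearMap
    { toFun := fun x v => ordd v.1 ((x.toMul : Kˣ) : K)
      map_zero' := by ext v; simp
      map_add' := fun x y => by
        ext v
        simp [ordd_mul] }

theorem usval_apply (S : Finset (Pl K)) (x : Additive (US S)) (v : S) :
    usval S x v = ordd v.1 ((x.toMul : Kˣ) : K) := rfl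

/-- the kernel of the valuation map is the unit group -/
noncomputable def uker (S : Finset (Pl K)) : Additive (𝓞 K)ˣ →ₗ[ℤ] Additive (US S) :=
  AddMonoidHom.toIntLinearMap (MonoidHom.toAdditive
    (MonoidHom.codRestrict (Units.map (algebraMap (𝓞 K) K).toMonoidHom) (US S)
      (fun u v _ => ordd_unit u v)))

theorem uker_apply (S : Finset (Pl K)) (u : Additive (𝓞 K)ˣ) :
    (((uker S u).toMul : Kˣ) : K) = ((u.toMul : 𝓞 K) : K) := rfl

theorem uker_inj (S : Finset (Pl K)) : Function.Injective (uker S) := by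
  intro a b h
  have h1 := uker_apply S a
  rw [h, uker_apply] at h1
  have h2 : ((b.toMul : (𝓞 K)ˣ) : 𝓞 K) = ((a.toMul : (𝓞 K)ˣ) : 𝓞 K) := RingOfIntegers.ext h1
  have := Units.ext h2
  exact (Additive.toMul.injective this).symm

theorem uker_range (S : Finset (Pl K)) : LinearMap.range (uker S) = LinearMap.ker (usval S) := by
  ext x
  constructor
  · rintro ⟨u, rfl⟩
    rw [LinearMap.mem_ker]
    ext v
    rw [usval_apply, uker_apply]; exact ordd_unit _ _
  · intro hx
    rw [LinearMap.mem_ker] at hx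
    have h : ∀ v : Pl K, ordd v ((x.toMul : Kˣ) : K) = 0 := by
      intro v
      by_cases hv : v ∈ S
      · have := congrFun hx ⟨v, hv⟩; rwa [usval_apply] at this
      · exact x.toMul.2 v hv
    obtain ⟨u, hu⟩ := mem_units_of_ordd h
    refine ⟨Additive.ofMul u, ?_⟩
    apply Additive.toMul.injective
    apply Subtype.ext
    apply Units.ext
    rw [uker_apply]; exact hu

theorem US_finite_finrank (S : Finset (Pl K)) : Module.Finite ℤ (Additive (US S)) ∧
    Module.finrank ℤ (Additive (US S)) = Units.rank K + S.card := by
  classical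
  have hker : Module.Finite ℤ (LinearMap.ker (usval S)) := by
    rw [← uker_range]; infer_instance
  have hfin : Module.Finite ℤ (Additive (US S)) := by
    have : Module.Finite ℤ (Additive (US S) ⧸ LinearMap.ker (usval S)) :=
      Module.Finite.equiv (usval S).quotKerEquivRange.symm
    exact Module.Finite.of_submodule_quotient (LinearMap.ker (usval S))
  refine ⟨hfin, ?_⟩
  have h1 := Submodule.finrank_quotient_add_finrank (LinearMap.ker (usval S))
  rw [(usval S).quotKerEquivRange.finrank_eq] at h1
  have h2 : Module.finrank ℤ (LinearMap.ker (usval S)) = Units.rank K := by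
    rw [← uker_range, LinearMap.finrank_range_of_inj (uker_inj S)]
    exact Units.finrank_eq K
  have h3 : Module.finrank ℤ (LinearMap.range (usval S)) = S.card := by
    apply le_antisymm
    · have := Submodule.finrank_le (LinearMap.range (usval S))
      simpa using this
    · have hc : (classNumber K : ℤ) ≠ 0 := by
        exact_mod_cast (Fintype.card_ne_zero : Fintype.card (ClassGroup (𝓞 K)) ≠ 0)
      have hmem : ∀ f : S → ℤ, (classNumber K : ℤ) • f ∈ LinearMap.range (usval S) := by
        intro f
        have : (classNumber K : ℤ) • f = ∑ v : S, f v • ((classNumber K : ℤ) • Pi.single v (1 : ℤ)) := by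
          ext u
          simp only [Finset.sum_apply, Pi.smul_apply, smul_eq_mul, Pi.single_apply]
          simp [mul_comm]
        rw [this]
        refine Submodule.sum_mem _ fun v _ => Submodule.smul_mem _ _ ?_
        obtain ⟨x, hx, hx'⟩ := exists_hpow v.1
        refine ⟨Additive.ofMul ⟨x, fun v' hv' => hx' v' (fun h => hv' (h ▸ v.2))⟩, ?_⟩
        ext u
        rw [usval_apply]
        by_cases huv : u = v
        · subst huv; simpa using hx
        · have : (u : Pl K) ≠ v := fun h => huv (Subtype.ext h)
          simpa [Pi.single_apply, huv] using hx' u this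
      let g : (S → ℤ) →ₗ[ℤ] LinearMap.range (usval S) :=
        LinearMap.codRestrict _ ((classNumber K : ℤ) • LinearMap.id) (fun f => hmem f)
      have hg : Function.Injective g := by
        intro a b h
        have := congrArg Subtype.val h
        change (classNumber K : ℤ) • a = (classNumber K : ℤ) • b at this
        exact smul_right_injective _ hc this
      have := LinearMap.finrank_le_finrank_of_injective hg
      simpa using this
  rw [h2, h3] at h1
  omega

/-- the S-class group is trivial -/
def ClS (S : Finset (Pl K)) : Prop :=
  ∀ v ∉ S, ∃ x : Kˣ, ordd v (x : K) = 1 ∧ ∀ v' ∉ S, v' ≠ v → ordd v' (x : K) = 0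

theorem ClS_mono {S T : Finset (Pl K)} (h : S ⊆ T) (hS : ClS S) : ClS T := by
  intro v hv
  obtain ⟨x, hx, hx'⟩ := hS v (fun h' => hv (h h'))
  exact ⟨x, hx, fun v' hv' => hx' v' (fun h' => hv' (h h'))⟩

variable (K) in
theorem exists_ClS : ∃ S : Finset (Pl K), ClS S := by
  classical
  have hrep : ∀ c : ClassGroup (𝓞 K), ∃ I : (Ideal (𝓞 K))⁰, ClassGroup.mk0 I = c :=
    ClassGroup.mk0_surjective
  choose J hJ using hrep
  have hfin : ∀ c, {v : Pl K | v.asIdeal ∣ (J c : Ideal (𝓞 K))}.Finite := fun c =>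
    Ideal.finite_factors (nonZeroDivisors.ne_zero (J c).2)
  refine ⟨Finset.univ.biUnion fun c => (hfin c).toFinset, fun v hv => ?_⟩
  set vI : (Ideal (𝓞 K))⁰ := ⟨v.asIdeal, mem_nonZeroDivisors_of_ne_zero v.ne_bot⟩ with hvI
  set I := J (ClassGroup.mk0 vI)⁻¹ with hI
  have hprime : ∀ v' : Pl K, v'.asIdeal ∣ (I : Ideal (𝓞 K)) →
      v' ∈ Finset.univ.biUnion fun c => (hfin c).toFinset := by
    intro v' h
    simp only [Finset.mem_biUnion, Finset.mem_univ, true_and, Set.Finite.mem_toFinset]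
    exact ⟨_, h⟩
  have h1 : ClassGroup.mk0 (vI * I) = 1 := by
    rw [map_mul, hI, hJ, mul_inv_cancel]
  rw [ClassGroup.mk0_eq_one_iff] at h1
  obtain ⟨x, hx⟩ := h1
  replace hx : v.asIdeal * (I : Ideal (𝓞 K)) = Ideal.span {x} := hx
  have hx0 : x ≠ 0 := by
    rintro rfl
    rw [Ideal.span_singleton_eq_bot.2 rfl] at hx
    exact mul_ne_zero v.ne_bot (nonZeroDivisors.ne_zero I.2) hx
  have hx0' : (x : K) ≠ 0 := by simpa using hx0
  refine ⟨Units.mk0 (x : K) hx0', ?_, ?_⟩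
  · have h2 : og v 1 (x : K) := by
      rw [og_int_one_iff, ← Ideal.span_singleton_le_iff_mem, ← hx]
      exact Ideal.mul_le_left (I := v.asIdeal) (J := (I : Ideal (𝓞 K)))
    have h3 : ¬ og v (2 : ℕ) (x : K) := by
      rw [og_int_iff, ← Ideal.span_singleton_le_iff_mem, ← hx, ← Ideal.dvd_iff_le, pow_two]
      intro h
      exact hv (hprime v ((mul_dvd_mul_iff_left v.ne_bot).1 h))
    rw [og_iff hx0'] at h2 h3
    push_cast at h3
    rw [Units.val_mk0]; omega
  · intro v' hv' hne
    apply ordd_eq_zero_of_notMem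
    intro h
    rw [← Ideal.span_singleton_le_iff_mem, ← hx] at h
    rcases v'.isPrime.mul_le.1 h with h | h
    · exact hne (pl_eq_of_le h).symm
    · exact hv' (hprime v' (Ideal.dvd_iff_le.2 h))

theorem ClS.realize {S : Finset (Pl K)} (hS : ClS S) (n : Pl K → ℤ) (hn : {v | n v ≠ 0}.Finite) :
    ∃ k : Kˣ, ∀ v ∉ S, ordd v (k : K) = n v := by
  classical
  have hx : ∀ v : Pl K, ∃ x : Kˣ, v ∉ S → (ordd v (x : K) = 1 ∧ ∀ v' ∉ S, v' ≠ v → ordd v' (x : K) = 0) := by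
    intro v
    by_cases hv : v ∈ S
    · exact ⟨1, fun h => absurd hv h⟩
    · obtain ⟨x, hx⟩ := hS v hv
      exact ⟨x, fun _ => hx⟩
  choose x hx using hx
  refine ⟨∏ v ∈ hn.toFinset.filter (· ∉ S), x v ^ n v, fun v hv => ?_⟩
  rw [Units.coe_prod, ordd_prod _ _ (fun i _ => Units.ne_zero _)]
  have h1 : ∀ u ∈ hn.toFinset.filter (· ∉ S), ordd v ((x u ^ n u : Kˣ) : K) = if u = v then n v else 0 := by
    intro u hu
    have huS : u ∉ S := (Finset.mem_filter.1 hu).2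
    rw [Units.val_zpow_eq_zpow_val, ordd_zpow]
    split_ifs with h
    · subst h; rw [(hx u huS).1, mul_one]
    · rw [(hx u huS).2 v hv (Ne.symm h), mul_zero]
  rw [Finset.sum_congr rfl h1, Finset.sum_ite_eq']
  split_ifs with h
  · rfl
  · by_contra h2
    exact h (by simp [hv, Ne.symm h2])

end P2

set_option linter.unusedSectionVars false

section P3
variable {K : Type} [Field K] [NumberField K] 
variable {L : Type} [Field L] [NumberField L] [Algebra K L]

open Classical in
/-- the places above `S` -/
noncomputable def upS (L : Type) [Field L] [NumberField L] [Algebra K L] (S : Finset (Pl K)) :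
    Finset (Pl L) := S.biUnion fun v => (finite_up (K := K) (L := L) v).toFinset

theorem mem_upS {S : Finset (Pl K)} {w : Pl L} : w ∈ upS L S ↔ dn K w ∈ S := by
  simp [upS]

variable (K L) in
/-- norm on units -/
noncomputable def normU : Lˣ →* Kˣ := Units.map (Algebra.norm K)

@[simp] theorem normU_val (x : Lˣ) : (normU K L x : K) = Algebra.norm K (x : L) := rfl

/-- the inclusion on units -/
noncomputable def incU (K L : Type) [Field K] [Field L] [Algebra K L] : Kˣ →* Lˣ :=
  Units.map (algebraMap K L)

@[simp] theorem incU_val (x : Kˣ) : (incU K L x : L) = algebraMap K L (x : K) := rfl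

theorem incU_injective : Function.Injective (incU K L) :=
  Units.map_injective (FaithfulSMul.algebraMap_injective K L)

theorem incU_mem_US {S : Finset (Pl K)} {x : Kˣ} : incU K L x ∈ US (upS L S) ↔ x ∈ US S := by
  rw [mem_US, mem_US]
  constructor
  · intro h v hv
    obtain ⟨w, rfl⟩ := exists_up (L := L) v
    have := h w (by rwa [mem_upS])
    rw [incU_val, ordd_dn] at this
    have h2 := eI_pos (K := K) w
    rcases mul_eq_zero.1 this with h3 | h3
    · omega
    · exact h3
  · intro h w hw
    rw [mem_upS] at hw
    rw [incU_val, ordd_dn, h _ hw, mul_zero]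

variable (K) in
theorem normU_mem_US [IsGalois K L] {S : Finset (Pl K)} {x : Lˣ} (hx : x ∈ US (upS L S)) :
    normU K L x ∈ US S := by
  intro v hv
  obtain ⟨w, rfl⟩ := exists_up (L := L) v
  have h1 := ordd_norm (K := K) w x.ne_zero
  have h2 := eI_pos (K := K) w
  rw [Finset.sum_eq_zero] at h1
  · rcases mul_eq_zero.1 h1 with h3 | h3
    · omega
    · exact h3
  · intro g _
    apply hx
    rwa [mem_upS, dn_gact]

variable (L) in
/-- norms of S-units -/
noncomputable def NUS (S : Finset (Pl K)) : Subgroup Kˣ := (US (upS L S)).map (normU K L)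

theorem NUS_le [IsGalois K L] (S : Finset (Pl K)) : NUS L S ≤ US S := by
  rintro _ ⟨x, hx, rfl⟩
  exact normU_mem_US K hx

/-- Galois action on units -/
noncomputable def galU (g : L ≃ₐ[K] L) : Lˣ →* Lˣ := Units.map (g : L →* L)

@[simp] theorem galU_val (g : L ≃ₐ[K] L) (x : Lˣ) : (galU g x : L) = g (x : L) := rfl

theorem galU_mem_US (g : L ≃ₐ[K] L) {S : Finset (Pl K)} {x : Lˣ} (hx : x ∈ US (upS L S)) :
    galU g x ∈ US (upS L S) := by
  intro w hw
  have := hx (gact (g.symm : L ≃+* L) w) (by rw [mem_upS, dn_gact]; rwa [mem_upS] at hw)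
  have h2 := gact_symm (g : L ≃+* L) w (x : L)
  rw [galU_val]
  exact h2.symm.trans this

theorem prod_pow_gen [IsGalois K L] {p : ℕ} (h : Module.finrank K L = p) (σ : L ≃ₐ[K] L)
    (hσ : ∀ g, g ∈ Subgroup.zpowers σ) (x : L) :
    ∏ i ∈ Finset.range p, (σ ^ i) x = algebraMap K L (Algebra.norm K x) := by
  classical
  have ho : orderOf σ = p := by
    rw [orderOf_eq_card_of_forall_mem_zpowers hσ, IsGalois.card_aut_eq_finrank, h]
  rw [Algebra.norm_eq_prod_automorphisms, ← IsCyclic.image_range_orderOf hσ, Finset.prod_image, ho]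
  intro i hi j hj hij
  exact pow_injOn_Iio_orderOf (by simpa using hi) (by simpa using hj) hij

theorem FI_ker [IsGalois K L] (S : Finset (Pl K)) (hS : ClS S)
    (hram : ∀ w : Pl L, dn K w ∉ S → eI K w = 1) (σ : L ≃ₐ[K] L)
    (hσ : ∀ g, g ∈ Subgroup.zpowers σ) (x : Lˣ) (hx : x ∈ US (upS L S)) (hN : normU K L x = 1) :
    ∃ y ∈ US (upS L S), x = galU σ y / y := by
  have h1 : Algebra.norm K ((x⁻¹ : Lˣ) : L) = 1 := by
    have := congrArg Units.val (show normU K L x⁻¹ = 1 by rw [map_inv, hN, inv_one])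
    rwa [normU_val] at this
  have : IsCyclic (L ≃ₐ[K] L) := ⟨σ, hσ⟩
  obtain ⟨y, hy⟩ := groupCohomology.exists_div_of_norm_eq_one hσ h1
  have hσy : (σ (y : L)) = y * x := by
    have h0 : σ (y : L) ≠ 0 := by simp
    have : ((x⁻¹ : Lˣ) : L) = (x : L)⁻¹ := by simp
    rw [this] at hy
    field_simp at hy
    rw [← hy]
  -- orders are invariant
  have hinv : ∀ w : Pl L, dn K w ∉ S → ∀ g : L ≃ₐ[K] L, ordd (gact (g : L ≃+* L) w) (y : L) = ordd w (y : L) := by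
    intro w hw g
    have hs : ∀ w : Pl L, dn K w ∉ S → ordd (gact (σ : L ≃+* L) w) (y : L) = ordd w (y : L) := by
      intro w hw
      have h2 : ordd (gact (σ : L ≃+* L) w) (σ (y : L)) = ordd w (y : L) := ordd_gact _ w _
      rw [hσy, ordd_mul y.ne_zero x.ne_zero, hx _ (by rw [mem_upS, dn_gact]; exact hw)] at h2
      simpa using h2
    have hg := hσ g
    rw [← mem_powers_iff_mem_zpowers] at hg
    obtain ⟨n, rfl⟩ := hg
    simp only
    clear this hy
    induction n with
    | zero =>
      have : gact ((σ ^ 0 : L ≃ₐ[K] L) : L ≃+* L) w = w := gact_refl w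
      rw [this]
    | succ n ih =>
      have : gact ((σ ^ (n+1) : L ≃ₐ[K] L) : L ≃+* L) w =
          gact (σ : L ≃+* L) (gact ((σ ^ n : L ≃ₐ[K] L) : L ≃+* L) w) := by
        rw [gact_gact, pow_succ']; rfl
      rw [this, hs _ (by rwa [dn_gact]), ih]
  choose up hup using exists_up (K := K) (L := L)
  obtain ⟨k, hk⟩ := hS.realize (fun v => ordd (up v) (y : L)) (by
    have := (ordd_support (y : L)).image (dn K)
    refine this.subset ?_
    intro v hv
    exact ⟨up v, hv, hup v⟩)
  refine ⟨y / incU K L k, ?_, ?_⟩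
  · intro w hw
    rw [mem_upS] at hw
    rw [Units.val_div_eq_div_val, ordd_div y.ne_zero (Units.ne_zero _), incU_val, ordd_dn, hram w hw,
      hk _ hw]
    obtain ⟨g, hg⟩ := gact_trans_exists (K := K) w (up (dn K w)) (by rw [hup])
    rw [← hg, hinv w hw]; simp
  · ext
    have : algebraMap K L (k : K) ≠ 0 := by simp
    simp only [Units.val_div_eq_div_val, galU_val, incU_val, map_div₀, AlgEquiv.commutes, hσy]
    field_simp

theorem herbrand_index' {A : Type} [AddCommGroup A] [Module.Finite ℤ A] (p : ℕ) [Fact p.Prime]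
    (σ N : A →+ A) (hσ : ∀ a, σ^[p] a = a) (hN : ∀ a, N a = ∑ i ∈ Finset.range p, σ^[i] a)
    (hker : ∀ x, N x = 0 → ∃ y, x = σ y - y) (Z : AddSubgroup A) (hZ : ∀ a, a ∈ Z ↔ σ a = a) :
    (N.range.relIndex Z) ^ (p - 1) * p ^ Module.finrank ℤ A = p ^ (p * Module.finrank ℤ Z) := by
  let σ' : AddMonoid.End A := σ
  have hit : ∀ (i : ℕ) a, (σ' ^ i) a = σ^[i] a := by
    intro i
    induction i with
    | zero => intro a; rfl
    | succ n ih =>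
      intro a
      rw [pow_succ', Function.iterate_succ_apply', ← ih]
      rfl
  have h1 : σ' ^ p = 1 := by
    refine AddMonoidHom.ext fun a => ?_
    exact (hit p a).trans (hσ a)
  have h2 : ∀ a, (Polynomial.aeval σ' (geomPoly p) : AddMonoid.End A) a = N a := by
    intro a
    have : (Polynomial.aeval σ' (geomPoly p) : AddMonoid.End A) = ∑ i ∈ Finset.range p, σ' ^ i := by
      simp [geomPoly]
    rw [this, addEnd_sum_apply, hN]
    exact Finset.sum_congr rfl fun i _ => hit i a
  have h3 := herbrand_index p σ' h1 (by
    intro x hx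
    rw [h2] at hx
    exact hker x hx)
  have h4 : (Polynomial.aeval σ' (geomPoly p) : AddMonoid.End A).range = N.range := by
    ext a
    constructor
    · rintro ⟨b, rfl⟩
      exact ⟨b, (h2 b).symm⟩
    · rintro ⟨b, rfl⟩
      exact ⟨b, h2 b⟩
  have h5 : (σ' - 1 : AddMonoid.End A).ker = Z := by
    ext a
    rw [hZ]
    exact sub_eq_zero (a := σ a) (b := a)
  rw [h4, h5] at h3
  exact h3

theorem FI [IsGalois K L] {p : ℕ} [hp : Fact p.Prime] (h : Module.finrank K L = p)
    (S : Finset (Pl K)) (hS : ClS S) (hram : ∀ w : Pl L, dn K w ∉ S → eI K w = 1) :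
    ((NUS L S).relIndex (US S)) ^ (p - 1) * p ^ (Units.rank L + (upS L S).card) =
      p ^ (p * (Units.rank K + S.card)) := by
  have hcard : Nat.card (L ≃ₐ[K] L) = p := by rw [IsGalois.card_aut_eq_finrank, h]
  have : IsCyclic (L ≃ₐ[K] L) := isCyclic_of_prime_card hcard
  obtain ⟨σ, hσ⟩ := IsCyclic.exists_generator (α := L ≃ₐ[K] L)
  obtain ⟨hfin, hrk⟩ := US_finite_finrank (upS L S)
  obtain ⟨hfinK, hrkK⟩ := US_finite_finrank S
  let σU : US (upS L S) →* US (upS L S) :=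
    { toFun := fun x => ⟨galU σ x, galU_mem_US σ x.2⟩
      map_one' := by ext; simp
      map_mul' := by intro x y; ext; simp }
  let σA : (Additive (US (upS L S))) →+ (Additive (US (upS L S))) := MonoidHom.toAdditive σU
  let jU : US S →* US (upS L S) :=
    { toFun := fun x => ⟨incU K L x, incU_mem_US.2 x.2⟩
      map_one' := by ext; simp
      map_mul' := by intro x y; ext; simp }
  let jA : Additive (US S) →+ (Additive (US (upS L S))) := MonoidHom.toAdditive jU
  have hjA : Function.Injective jA := by
    intro x y hxy
    have h2 : incU K L (x.toMul : US S) = incU K L (y.toMul : US S) := congrArg Subtype.val hxy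
    exact Subtype.ext (incU_injective h2)
  let nU : US (upS L S) →* US S :=
    { toFun := fun x => ⟨normU K L x, normU_mem_US K x.2⟩
      map_one' := by ext; simp
      map_mul' := by intro x y; ext; simp }
  let nA : (Additive (US (upS L S))) →+ Additive (US S) := MonoidHom.toAdditive nU
  let κ : (Additive (US (upS L S))) → L := fun a => (((a.toMul : US (upS L S)) : Lˣ) : L)
  have κinj : Function.Injective κ := fun x y hxy => Subtype.ext (Units.ext hxy)
  have κadd : ∀ a b, κ (a + b) = κ a * κ b := fun a b => rfl
  have κσ : ∀ a, κ (σA a) = σ (κ a) := fun a => rfl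
  have κpow : ∀ (i : ℕ) a, κ (σA^[i] a) = (σ ^ i) (κ a) := by
    intro i
    induction i with
    | zero => intro a; rfl
    | succ n ih =>
      intro a
      rw [Function.iterate_succ_apply', pow_succ', κσ, ih]
      rfl
  have κsum : ∀ (s : Finset ℕ) (f : ℕ → (Additive (US (upS L S)))), κ (∑ i ∈ s, f i) = ∏ i ∈ s, κ (f i) := by
    intro s f
    classical
    induction s using Finset.induction_on with
    | empty => rfl
    | insert a s ha ih => rw [Finset.sum_insert ha, Finset.prod_insert ha, κadd, ih]
  have hpow : ∀ a, σA^[p] a = a := by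
    intro a
    apply κinj
    rw [κpow, ← hcard, pow_card_eq_one']; rfl
  have hgeom : ∀ a, (jA.comp nA) a = ∑ i ∈ Finset.range p, σA^[i] a := by
    intro a
    apply κinj
    rw [κsum, Finset.prod_congr rfl fun i _ => κpow i a, prod_pow_gen h σ hσ]
    rfl
  have hfin' : Module.Finite ℤ (Additive (US (upS L S))) := hfin
  have hkerA : ∀ a, a ∈ jA.range ↔ σA a = a := by
    intro a
    symm
    constructor
    · intro ha
      have hfix : σ (κ a) = κ a := by rw [← κσ, ha]
      have hfix' : ∀ g : L ≃ₐ[K] L, g (κ a) = κ a := by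
        intro g
        have hg := hσ g
        rw [← mem_powers_iff_mem_zpowers] at hg
        obtain ⟨n, rfl⟩ := hg
        simp only
        induction n with
        | zero => rfl
        | succ n ih => rw [pow_succ']; change σ ((σ ^ n) (κ a)) = κ a; rw [ih, hfix]
      obtain ⟨k, hk⟩ := (IsGalois.mem_range_algebraMap_iff_fixed (F := K) (κ a)).2 hfix'
      have hk0 : k ≠ 0 := by
        rintro rfl
        rw [map_zero] at hk
        exact Units.ne_zero _ hk.symm
      have hk1 : incU K L (Units.mk0 k hk0) = ((a.toMul : US (upS L S)) : Lˣ) := Units.ext hk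
      refine ⟨Additive.ofMul ⟨Units.mk0 k hk0, incU_mem_US (L := L).1 ?_⟩, κinj hk⟩
      rw [hk1]; exact Subtype.prop _
    · rintro ⟨b, rfl⟩
      apply κinj
      rw [κσ]
      exact σ.commutes _
  have hmain := herbrand_index' p σA (jA.comp nA) hpow hgeom (by
    intro a ha
    rw [AddMonoidHom.comp_apply, ← map_zero jA] at ha
    have hn : nA a = 0 := hjA ha
    have hn' : normU K L ((a.toMul : US (upS L S)) : Lˣ) = 1 := congrArg Subtype.val hn
    obtain ⟨y, hy, hxy⟩ := FI_ker S hS hram σ hσ _ (Subtype.prop (a.toMul : US (upS L S))) hn'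
    refine ⟨Additive.ofMul ⟨y, hy⟩, ?_⟩
    apply Subtype.ext
    exact hxy) jA.range hkerA
  rw [AddMonoidHom.range_comp] at hmain
  have hidx : (nA.range.map jA).relIndex jA.range = (NUS L S).relIndex (US S) := by
    rw [AddMonoidHom.range_eq_map jA, AddSubgroup.relIndex_map_map_of_injective _ _ hjA,
      AddSubgroup.relIndex_top_right]
    have h1 : nA.range = Subgroup.toAddSubgroup nU.range := rfl
    rw [h1, Subgroup.index_toAddSubgroup]
    rw [Subgroup.relIndex]
    congr 1
    ext x
    constructor
    · rintro ⟨y, rfl⟩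
      exact ⟨y, y.2, rfl⟩
    · rintro ⟨y, hy, hxy⟩
      exact ⟨⟨y, hy⟩, Subtype.ext hxy⟩
  have hrkj : Module.finrank ℤ jA.range = Units.rank K + S.card := by
    rw [← hrkK]
    exact (AddMonoidHom.ofInjective hjA).toIntLinearEquiv.finrank_eq.symm
  rw [hidx, hrkj, hrk] at hmain
  exact hmain
end P3

section P4alg
open Polynomial
variable {A : Type} [AddCommGroup A] (p : ℕ) [Fact p.Prime] (σ : AddMonoid.End A) (W : ℕ → AddSubgroup A)

theorem filt_aeval (h1 : ∀ n, ∀ a ∈ W n, σ a ∈ W n) (f : ℤ[X]) (n : ℕ) (a : A) (ha : a ∈ W n) :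
    (aeval σ f : AddMonoid.End A) a ∈ W n := by
  have hit : ∀ (i : ℕ), (σ ^ i) a ∈ W n := by
    intro i
    induction i with
    | zero => exact ha
    | succ m ih => rw [pow_succ']; exact h1 n _ ih
  rw [Polynomial.aeval_eq_sum_range, addEnd_sum_apply]
  refine sum_mem fun i _ => ?_
  exact zsmul_mem (hit i) _

theorem filt_pow (h2 : ∀ n, ∀ a ∈ W n, σ a - a ∈ W (n+1)) (n : ℕ) (a : A) (ha : a ∈ W 0) :
    (aeval σ ((X - 1 : ℤ[X]) ^ n) : AddMonoid.End A) a ∈ W n := by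
  induction n with
  | zero =>
    rw [pow_zero, map_one]; exact ha
  | succ m ih =>
    have : (aeval σ ((X - 1 : ℤ[X]) ^ (m+1)) : AddMonoid.End A) =
      (σ - 1) * aeval σ ((X - 1 : ℤ[X]) ^ m) := by
      rw [pow_succ', map_mul]; simp
    rw [this]
    exact h2 m _ ih

theorem geom_apply (a : A) : (aeval σ (geomPoly p) : AddMonoid.End A) a =
    ∑ i ∈ Finset.range p, σ^[i] a := by
  have hit : ∀ (i : ℕ) a, (σ ^ i) a = σ^[i] a := by
    intro i
    induction i with
    | zero => intro a; rfl
    | succ n ih =>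
      intro a
      rw [pow_succ', Function.iterate_succ_apply', ← ih]
      rfl
  have : (aeval σ (geomPoly p) : AddMonoid.End A) =
      ∑ i ∈ Finset.range p, σ ^ i := by
    simp [geomPoly]
  rw [this, addEnd_sum_apply]
  exact Finset.sum_congr rfl fun i _ => hit i a

theorem filt_norm (h1 : ∀ n, ∀ a ∈ W n, σ a ∈ W n)
    (h2 : ∀ n, ∀ a ∈ W n, σ a - a ∈ W (n+1)) (hp : ∀ a ∈ W 0, p • a ∈ W (p-1)) (a : A) (ha : a ∈ W 0) :
    ∑ i ∈ Finset.range p, σ^[i] a ∈ W (p-1) := by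
  obtain ⟨g, h, h', k, e1, -, -⟩ := geomPoly_key p
  have e2 : geomPoly p = (X - 1) ^ (p-1) - C (p : ℤ) * g := by rw [e1]; ring
  rw [← geom_apply, e2, map_sub]
  refine sub_mem (filt_pow σ W h2 _ a ha) ?_
  have : (aeval σ (C (p:ℤ) * g) : AddMonoid.End A) a =
      p • (aeval σ g : AddMonoid.End A) a := by
    rw [map_mul]; simp
  have h5 := hp _ (filt_aeval σ W h1 g 0 a ha)
  rw [← this] at h5
  exact h5

theorem filt_p (h1 : ∀ n, ∀ a ∈ W n, σ a ∈ W n)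
    (h2 : ∀ n, ∀ a ∈ W n, σ a - a ∈ W (n+1)) (a : A) (ha : a ∈ W 0) (h0 : ∑ i ∈ Finset.range p, σ^[i] a = 0) :
    p • a ∈ W (p-1) := by
  obtain ⟨g, h, h', k, -, -, e3⟩ := geomPoly_key p
  have : (aeval σ (C (p:ℤ)) : AddMonoid.End A) a = p • a := by simp
  have e4 : C (p : ℤ) = h' * geomPoly p + h * (X-1)^(p-1) := by rw [e3]; ring
  rw [← this, e4, map_add, map_mul, map_mul]
  refine add_mem ?_ ?_
  · have : (aeval σ h' * aeval σ (geomPoly p) : AddMonoid.End A) a = 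
      (aeval σ h' : AddMonoid.End A) ((aeval σ (geomPoly p) : AddMonoid.End A) a) := rfl
    rw [geom_apply, h0, map_zero] at this
    exact (congrArg (· ∈ W (p-1)) this).mpr (zero_mem _)
  · exact filt_aeval σ W h1 h _ _ (filt_pow σ W h2 _ a ha)
end P4alg

section P4
variable {K : Type} [Field K] [NumberField K] 
variable {L : Type} [Field L] [NumberField L] [Algebra K L]

theorem og_pow_p {p : ℕ} (hp : p.Prime) {w : Pl K} {k c n : ℤ} (hk : 0 ≤ k) {t : K} (ht : og w k t)
    (hc : og w c (p : K)) (h1 : n ≤ p * k) (h2 : n ≤ c + k) : og w n ((1 + t) ^ p - 1) := by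
  have : (1 + t) ^ p - 1 = t ^ p + p * t * ∑ j ∈ Finset.Ioo 0 p, t ^ (j - 1) * ((p.choose j / p : ℕ) : K) := by
    rw [add_comm, add_pow_prime_eq hp]; simp; ring
  rw [this]
  refine og_add (og_mono (og_pow ht p) h1) ?_
  refine og_mono (og_mul_unit (og_mul hc ht) ?_) h2
  refine og_sum _ _ fun j _ => og_mul_unit ?_ (og_nat _)
  exact og_mono (og_pow (og_mono ht hk) _) (by simp)

theorem ordd_norm_ns [IsGalois K L] {p : ℕ} (h : Module.finrank K L = p) {w : Pl L}
    (hns : NS K w) {y : L} (hy : y ≠ 0) :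
    eI K w * ordd (dn K w) (Algebra.norm K y) = p * ordd w y := by
  rw [ordd_norm w hy, Finset.sum_congr rfl fun g _ => by rw [hns.gact g]]
  rw [Finset.sum_const, Finset.card_univ, ← Nat.card_eq_fintype_card, IsGalois.card_aut_eq_finrank, h]
  simp

theorem sub_one_raise [IsGalois K L] {w : Pl L} (hns : NS K w) (hf : fI K w = 1) (σ : L ≃ₐ[K] L)
    {π : L} (hπ : π ≠ 0) (hπ1 : ordd w π = 1) (i : ℕ) (hi : og w i (σ π / π - 1)) (n : ℤ) (z : L)
    (hz : og w n z) : og w (n + i) (σ z - z) := by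
  suffices H : ∀ j : ℕ, j ≤ i → ∀ (n : ℤ) (z : L), og w n z → og w (n + j) (σ z - z) from
    H i le_rfl n z hz
  clear hz z n
  intro j
  induction j with
  | zero =>
    intro _ n z hz
    simpa using og_sub ((hns.og σ).2 hz) hz
  | succ j ih =>
    intro hj n z hz
    have hπn : og w n (π ^ n) := by
      rw [og_iff (zpow_ne_zero _ hπ), ordd_zpow, hπ1, mul_one]
    have hπn' : og w (-n) (π ^ (-n)) := by
      rw [og_iff (zpow_ne_zero _ hπ), ordd_zpow, hπ1, mul_one]
    obtain ⟨b, hb⟩ := residue_surj hf (x := z * π ^ (-n)) (by simpa using og_mul hz hπn')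
    have hr : og w (n + 1) (z - algebraMap K L b * π ^ n) := by
      have := og_mul hπn hb
      have e : π ^ n * (z * π ^ (-n) - algebraMap K L b) = z - algebraMap K L b * π ^ n := by
        rw [zpow_neg]; field_simp
      rwa [e] at this
    have hr' := ih (by omega) _ _ hr
    have hpos : 0 < i := by omega
    have h0 : σ π / π ≠ 0 := div_ne_zero (by simpa using hπ) hπ
    have hu : Units.mk0 (σ π / π) h0 ∈ Wv w i := (mem_Wv_pos hpos).2 hi
    have hun := (mem_Wv_pos hpos).1 (zpow_mem hu n)
    rw [Units.val_zpow_eq_zpow_val, Units.val_mk0] at hun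
    have h3 : og w (n + i) (algebraMap K L b * (σ π ^ n - π ^ n)) := by
      have := og_mul (og_int (v := w) (algebraMap (𝓞 K) (𝓞 L) b)) (og_mul hπn hun)
      rw [zero_add] at this
      have e : π ^ n * ((σ π / π) ^ n - 1) = σ π ^ n - π ^ n := by
        rw [div_zpow]; field_simp
      rw [e] at this
      exact this
    have e : σ z - z = algebraMap K L b * (σ π ^ n - π ^ n) +
       (σ (z - algebraMap K L b * π ^ n) - (z - algebraMap K L b * π ^ n)) := by
      simp only [map_sub, map_mul, AlgEquiv.commutes, map_zpow₀]; ring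
    rw [e]
    refine og_add (og_mono h3 (by push_cast; omega)) (og_mono hr' (by push_cast; omega))

end P4

section P4b
variable {K : Type} [Field K] [NumberField K] 
variable {L : Type} [Field L] [NumberField L] [Algebra K L]

theorem ram_break [IsGalois K L] {p : ℕ} [hp : Fact p.Prime] (h : Module.finrank K L = p) {w : Pl L}
    (hns : NS K w) (he : eI K w = p) (hf : fI K w = 1) (σ : L ≃ₐ[K] L)
    (hσ : ∀ g, g ∈ Subgroup.zpowers σ) : ∃ i : ℕ, (i : ℤ) ≤ 2 * ordd (dn K w) (p : K) ∧
      (∀ u ∈ Wv w (i+1), normU K L u ∈ Wv (dn K w) (i+1)) ∧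
      ∃ u : Lˣ, u ∈ Wv w 0 ∧ normU K L u = 1 ∧ u ∉ Wv w (i+1) := by
  obtain ⟨π', hπ, hπ1⟩ := ordd_exists w
  set π : L := (π' : L)
  have hp2 := hp.out.two_le
  have hcard : Nat.card (L ≃ₐ[K] L) = p := by rw [IsGalois.card_aut_eq_finrank, h]
  have hσπ0 : σ π ≠ 0 := by simpa using hπ
  have hu0 : σ π / π ≠ 0 := div_ne_zero hσπ0 hπ
  have hne : σ π ≠ π := by
    intro hfix
    have hfix' : ∀ g : L ≃ₐ[K] L, g π = π := by
      intro g
      have hg := hσ g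
      rw [← mem_powers_iff_mem_zpowers] at hg
      obtain ⟨n, rfl⟩ := hg
      simp only
      induction n with
      | zero => rfl
      | succ n ih => rw [pow_succ']; change σ ((σ ^ n) π) = π; rw [ih, hfix]
    obtain ⟨k, hk⟩ := (IsGalois.mem_range_algebraMap_iff_fixed (F := K) π).2 hfix'
    have h1 := ordd_dn w k
    rw [hk, hπ1, he] at h1
    have h2 : (p : ℤ) ∣ 1 := ⟨_, h1⟩
    have h3 := Int.le_of_dvd one_pos h2
    omega
  have hΔ : σ π / π - 1 ≠ 0 := by
    rw [sub_ne_zero]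
    intro h1
    exact hne ((div_eq_one_iff_eq hπ).1 h1)
  have hu_ord : ordd w (σ π / π) = 0 := by
    rw [ordd_div hσπ0 hπ, hns.ordd, sub_self]
  have hΔ0 : og w 0 (σ π / π - 1) := og_sub ((og_iff hu0).2 hu_ord.ge) og_one
  rw [og_iff hΔ] at hΔ0
  obtain ⟨i, hi⟩ := Int.eq_ofNat_of_zero_le hΔ0
  have hi' : og w i (σ π / π - 1) := (og_iff hΔ).2 hi.ge
  have raise := sub_one_raise hns hf σ hπ hπ1 i hi'
  have hpw : ordd w (p : L) = p * ordd (dn K w) (p : K) := by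
    have := ordd_dn w (p : K)
    rw [map_natCast, he] at this
    exact this
  have hp0 : (p : L) ≠ 0 := by exact_mod_cast hp.out.ne_zero
  -- claim 2
  have hclaim2 : ((p : ℤ) - 1) * i ≤ ordd w (p : L) := by
    let W : ℕ → AddSubgroup L := fun n =>
      { carrier := {z | og w (1 + i + n * i) z}
        zero_mem' := og_zero _
        add_mem' := fun ha hb => og_add ha hb
        neg_mem' := fun ha => og_neg ha }
    have hsub : σ π - π = π * (σ π / π - 1) := by field_simp
    have ha0 : σ π - π ≠ 0 := sub_ne_zero.2 hne
    have hord : ordd w (σ π - π) = 1 + i := by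
      rw [hsub, ordd_mul hπ hΔ, hπ1, hi]
    have h3 := filt_p p ((σ : L →+* L) : L →+ L) W (fun n a ha => (hns.og σ).2 ha)
      (fun n a ha => by
        have := raise _ _ (show og w (1 + i + n * i) a from ha)
        refine og_mono this ?_
        push_cast; linarith) (σ π - π)
      (by change og w _ _; rw [og_iff ha0, hord]; simp)
      (by
        have hit : ∀ j : ℕ, ∀ x, ((σ : L →+* L) : L →+ L)^[j] x = (σ ^ j) x := by
          intro j
          induction j with
          | zero => intro x; rfl
          | succ n ih => intro x; rw [Function.iterate_succ_apply', ih, pow_succ']; rfl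
        refine (Finset.sum_congr rfl fun j _ => hit j _).trans ?_
        have : ∀ j : ℕ, (σ ^ j) (σ π - π) = (σ ^ (j+1)) π - (σ ^ j) π := by
          intro j; rw [map_sub, pow_succ]; rfl
        simp_rw [this]
        rw [Finset.sum_range_sub (fun j => (σ ^ j) π), ← hcard, pow_card_eq_one']
        simp)
    replace h3 : og w (1 + i + ((p - 1 : ℕ) : ℤ) * i) (p • (σ π - π)) := h3
    rw [nsmul_eq_mul, og_iff (mul_ne_zero hp0 ha0), ordd_mul hp0 ha0, hord] at h3
    rw [Nat.cast_sub (by omega)] at h3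
    push_cast at h3
    linarith
  refine ⟨i, ?_, ?_, Units.mk0 _ hu0, ?_, ?_, ?_⟩
  · rw [hpw] at hclaim2
    have : 0 ≤ ordd (dn K w) (p : K) := by
      have := ordd_int_nonneg (v := dn K w) (p : 𝓞 K)
      simpa using this
    by_contra hcon
    push Not at hcon
    have h2 : (2 : ℤ) ≤ p := by exact_mod_cast hp2
    nlinarith
  · intro u hu
    let W : ℕ → AddSubgroup (Additive Lˣ) := fun n =>
      Subgroup.toAddSubgroup (Wv w (i + 1 + n * i))
    have h3 := filt_norm p (MonoidHom.toAdditive (galU σ)) W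
      (by
        intro n a ha
        have ha' : (Additive.toMul a) ∈ Wv w (i + 1 + n * i) := ha
        change galU σ (Additive.toMul a) ∈ Wv w (i + 1 + n * i)
        rw [mem_Wv_pos (by omega)] at ha' ⊢
        have := (hns.og σ).2 ha'
        rwa [map_sub, map_one] at this)
      (by
        intro n a ha
        have ha' : (Additive.toMul a) ∈ Wv w (i + 1 + n * i) := ha
        change galU σ (Additive.toMul a) / (Additive.toMul a) ∈ Wv w (i + 1 + (n + 1) * i)
        have h1 := (mem_Wv_pos (by omega)).1 ha'
        rw [mem_Wv_div (by omega), ha'.1, add_zero, galU_val]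
        have := raise _ _ h1
        rw [map_sub, map_one, sub_sub_sub_cancel_right] at this
        refine og_mono this ?_
        push_cast; linarith)
      (by
        intro a ha
        have ha' : (Additive.toMul a) ∈ Wv w (i + 1 + 0 * i) := ha
        change (Additive.toMul a) ^ p ∈ Wv w (i + 1 + (p-1) * i)
        rw [mem_Wv_pos (by omega)] at ha' ⊢
        have := og_pow_p hp.out (by positivity) ha' (og_ordd (p : L)) (n := ((i + 1 + (p-1) * i : ℕ) : ℤ)) ?_ ?_
        · rw [add_sub_cancel] at this
          exact this
        · rw [Nat.cast_add, Nat.cast_mul, Nat.cast_sub (by omega)]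
          push_cast
          have h2 : (2 : ℤ) ≤ p := by exact_mod_cast hp2
          nlinarith
        · rw [Nat.cast_add, Nat.cast_mul, Nat.cast_sub (by omega)]
          push_cast
          linarith)
      (Additive.ofMul u) (by change u ∈ Wv w (i + 1 + 0 * i); simpa using hu)
    have h4 : incU K L (normU K L u) ∈ Wv w (i + 1 + (p-1) * i) := by
      have e : incU K L (normU K L u) = Additive.toMul (∑ j ∈ Finset.range p, (MonoidHom.toAdditive (galU σ))^[j] (Additive.ofMul u)) := by
        rw [toMul_sum]
        apply Units.ext
        rw [incU_val, normU_val, ← prod_pow_gen h σ hσ, Units.coe_prod]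
        refine Finset.prod_congr rfl fun j hj => ?_
        clear hj
        induction j with
        | zero => rfl
        | succ n ih =>
          rw [Function.iterate_succ_apply', pow_succ']
          exact congrArg σ ih
      rw [e]
      exact h3
    rw [mem_Wv_pos (by omega)] at h4 ⊢
    rw [incU_val, ← map_one (algebraMap K L), ← map_sub] at h4
    by_cases hz : (normU K L u : K) - 1 = 0
    · rw [hz]; exact og_zero _
    have hz' : algebraMap K L ((normU K L u : K) - 1) ≠ 0 := by rwa [Ne, map_eq_zero]
    rw [og_iff hz', ordd_dn, he] at h4
    rw [og_iff hz]
    rw [Nat.cast_add, Nat.cast_mul, Nat.cast_sub (by omega)] at h4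
    push_cast at h4 ⊢
    have h2 : (2 : ℤ) ≤ p := by exact_mod_cast hp2
    by_contra hcon
    push Not at hcon
    have : ordd (dn K w) ((normU K L u : K) - 1) ≤ i := by linarith
    nlinarith
  · rw [mem_Wv_zero]; exact hu_ord
  · ext
    have : Algebra.norm K (σ π) = Algebra.norm K π := Algebra.norm_eq_of_algEquiv σ π
    have h0 : Algebra.norm K π ≠ 0 := by rwa [Algebra.norm_ne_zero_iff]
    have h3 : Algebra.norm K (σ π / π) * Algebra.norm K π = Algebra.norm K π := by
      rw [← map_mul, div_mul_cancel₀ _ hπ, this]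
    exact mul_right_cancel₀ h0 (by rw [normU_val, Units.val_mk0, h3, Units.val_one, one_mul])
  · intro hmem
    rw [mem_Wv_pos (by omega), Units.val_mk0, og_iff hΔ, hi] at hmem
    push_cast at hmem
    omega

theorem local_ne_top [IsGalois K L] {p : ℕ} [hp : Fact p.Prime] (h : Module.finrank K L = p) {w : Pl L}
    (hns : NS K w) {m : ℕ} (hm : 2 * ordd (dn K w) (p : K) + 1 ≤ m) :
    (normU K L).range ⊔ Wv (dn K w) m ≠ ⊤ := by
  have hcard : Nat.card (L ≃ₐ[K] L) = p := by rw [IsGalois.card_aut_eq_finrank, h]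
  have : IsCyclic (L ≃ₐ[K] L) := isCyclic_of_prime_card hcard
  obtain ⟨σ, hσ⟩ := IsCyclic.exists_generator (α := L ≃ₐ[K] L)
  have hp2 := hp.out.two_le
  intro htop
  have hef : eI K w * fI K w = p := by
    rcases ns_or_split hp.out h w with h1 | h1
    · exact h1.2.1
    · exact absurd hns h1.1
  have hdec : ∀ x : Kˣ, ∃ y : Lˣ, ∃ t ∈ Wv (dn K w) m, normU K L y * t = x := by
    intro x
    have : x ∈ (normU K L).range ⊔ Wv (dn K w) m := by rw [htop]; trivial
    obtain ⟨_, ⟨y, rfl⟩, t, ht, rfl⟩ := Subgroup.mem_sup.1 this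
    exact ⟨y, t, ht, rfl⟩
  have hordt : ∀ (y : Lˣ) (t : Kˣ), t ∈ Wv (dn K w) m →
      eI K w * ordd (dn K w) ((normU K L y * t : Kˣ) : K) = p * ordd w (y : L) := by
    intro y t ht
    rw [Units.val_mul, ordd_mul (Units.ne_zero _) (Units.ne_zero _), ht.1, add_zero, normU_val]
    exact ordd_norm_ns h hns y.ne_zero
  rcases (Nat.Prime.eq_one_or_self_of_dvd hp.out _ ⟨_, hef.symm⟩) with he | he
  · obtain ⟨x, hx0, hx⟩ := ordd_exists (dn K w)
    obtain ⟨y, t, ht, hyt⟩ := hdec (Units.mk0 _ hx0)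
    have := hordt y t ht
    rw [hyt, he, Units.val_mk0, hx] at this
    have h2 : (p : ℤ) ∣ 1 := ⟨_, by simpa using this⟩
    have h3 := Int.le_of_dvd one_pos h2
    omega
  · have hf : fI K w = 1 := by
      rw [he] at hef
      exact Nat.eq_of_mul_eq_mul_left hp.out.pos (by rw [hef, mul_one])
    obtain ⟨i, hi, hN, u, hu, hu1, hu2⟩ := ram_break h hns he hf σ hσ
    have him : i + 1 ≤ m := by zify; omega
    have hsup : (Wv w 0).map (normU K L) ⊔ Wv (dn K w) (i+1) = Wv (dn K w) 0 := by
      apply le_antisymm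
      · refine sup_le ?_ (Wv_anti (by omega))
        rintro _ ⟨y, hy, rfl⟩
        have := hordt y 1 (one_mem _)
        rw [mul_one, (mem_Wv_zero.1 hy), mul_zero, he] at this
        rw [mem_Wv_zero]
        rcases mul_eq_zero.1 this with h3 | h3
        · omega
        · exact h3
      · intro x hx
        obtain ⟨y, t, ht, hyt⟩ := hdec x
        have := hordt y t ht
        rw [hyt, (mem_Wv_zero.1 hx), mul_zero] at this
        rw [← hyt]
        refine Subgroup.mul_mem_sup ⟨y, ?_, rfl⟩ (Wv_anti him ht)
        refine mem_Wv_zero.2 ?_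
        rcases mul_eq_zero.1 this.symm with h3 | h3
        · omega
        · exact h3
    have h1 : ((Wv (dn K w) (i+1)).comap (normU K L)).relIndex (Wv w 0) =
        (Wv w (i+1)).relIndex (Wv w 0) := by
      rw [Subgroup.relIndex_comap, ← Subgroup.relIndex_sup_right, hsup, relIndex_W, relIndex_W, qI_of_fI hf]
    have h2 := Subgroup.relIndex_mul_relIndex (Wv w (i+1)) ((Wv (dn K w) (i+1)).comap (normU K L) ⊓ Wv w 0)
      (Wv w 0) (le_inf (fun x hx => hN x hx) (Wv_anti (by omega))) inf_le_right
    rw [Subgroup.inf_relIndex_right, h1] at h2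
    have h3 : (Wv w (i+1)).relIndex (Wv w 0) ≠ 0 := relIndex_W_ne_zero
    have h4 : (Wv w (i+1)).relIndex ((Wv (dn K w) (i+1)).comap (normU K L) ⊓ Wv w 0) = 1 := by
      exact Nat.eq_of_mul_eq_mul_right (Nat.pos_of_ne_zero h3) (by rw [h2, one_mul])
    rw [Subgroup.relIndex_eq_one] at h4
    refine hu2 (h4 ⟨?_, hu⟩)
    change normU K L u ∈ Wv (dn K w) (i+1)
    rw [hu1]; exact one_mem _

end P4b

section P5
variable {K : Type} [Field K] [NumberField K] 

theorem prod_sub_root {p : ℕ} (hp : 0 < p) {ζ : K} (hζ : IsPrimitiveRoot ζ p) (y : K) :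
    y ^ p - 1 = ∏ i ∈ Finset.range p, (y - ζ ^ i) := by
  have := congrArg (Polynomial.eval y) (X_pow_sub_C_eq_prod hζ hp (one_pow p))
  simpa [Polynomial.eval_prod] using this

theorem ordd_root {p : ℕ} (hp : 0 < p) {ζ : K} (hζ : ζ ^ p = 1) (w : Pl K) : ordd w ζ = 0 := by
  have h1 : ordd w (ζ ^ p) = 0 := by rw [hζ, ordd_one]
  rw [ordd_pow] at h1
  rcases mul_eq_zero.1 h1 with h | h
  · omega
  · exact h

theorem og_root_sub {p : ℕ} (hp : 0 < p) {ζ : K} (hζ : ζ ^ p = 1) (w : Pl K) (j : ℕ) :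
    og w 0 (1 - ζ ^ j) :=
  og_sub og_one (by
    have h0 : ζ ^ j ≠ 0 := pow_ne_zero _ (by rintro rfl; rw [zero_pow hp.ne'] at hζ; exact zero_ne_one hζ)
    rw [og_iff h0, ordd_pow, ordd_root hp hζ, mul_zero])

theorem sum_ordd_root {p : ℕ} (hp : 0 < p) {ζ : K} (hζ : IsPrimitiveRoot ζ p) (w : Pl K) :
    ∑ k ∈ Finset.range (p-1), ordd w (1 - ζ ^ (k+1)) = ordd w (p : K) := by
  obtain ⟨n, rfl⟩ : ∃ n, p = n + 1 := ⟨p - 1, by omega⟩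
  rw [← ordd_prod]
  · rw [Nat.add_sub_cancel, hζ.prod_one_sub_pow_eq_order]; push_cast; rfl
  · intro i hi h0
    rw [Finset.mem_range] at hi
    exact hζ.pow_ne_one_of_pos_of_lt (l := i + 1) (by omega) (by omega) (sub_eq_zero.1 h0).symm

/-- each difference of roots of unity has order at most that of `p` -/
theorem ordd_root_sub_le {p : ℕ} (hp : 0 < p) {ζ : K} (hζ : IsPrimitiveRoot ζ p) (w : Pl K) {k : ℕ}
    (hk : ζ ^ k ≠ 1) : ordd w (1 - ζ ^ k) ≤ ordd w (p : K) := by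
  have e : ζ ^ k = ζ ^ (k % p) := by
    have h := pow_mod_orderOf ζ k
    rw [← hζ.eq_orderOf] at h
    exact h.symm
  rw [e] at hk ⊢
  have h0 : k % p ≠ 0 := by intro h; rw [h, pow_zero] at hk; exact hk rfl
  have h1 : k % p < p := Nat.mod_lt _ hp
  rw [← sum_ordd_root hp hζ w]
  obtain ⟨j, hj⟩ : ∃ j, k % p = j + 1 := ⟨k % p - 1, by omega⟩
  rw [hj]
  refine Finset.single_le_sum (f := fun k => ordd w (1 - ζ ^ (k+1))) (fun i hi => ?_)
    (Finset.mem_range.2 (by omega))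
  have := og_root_sub hp hζ.pow_eq_one w (i+1)
  rwa [og_iff] at this
  intro h0
  rw [Finset.mem_range] at hi
  exact hζ.pow_ne_one_of_pos_of_lt (l := i + 1) (by omega) (by omega) (sub_eq_zero.1 h0).symm

theorem root_close {p : ℕ} (hp : 0 < p) {ζ : K} (hζ : IsPrimitiveRoot ζ p) (w : Pl K) {y : K} {M : ℤ}
    (hy : og w M (y ^ p - 1)) : ∃ j < p, og w (M - ordd w (p : K)) (y - ζ ^ j) := by
  by_cases hz : ∃ j < p, y - ζ ^ j = 0
  · obtain ⟨j, hj, h⟩ := hz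
    exact ⟨j, hj, by rw [h]; exact og_zero _⟩
  push Not at hz
  obtain ⟨j, hj, hmax⟩ := Finset.exists_max_image (Finset.range p) (fun j => ordd w (y - ζ ^ j))
    ⟨0, Finset.mem_range.2 hp⟩
  rw [Finset.mem_range] at hj
  refine ⟨j, hj, ?_⟩
  have hζ0 : ζ ≠ 0 := hζ.ne_zero hp.ne'
  have hmod : ∀ k, ζ ^ k = ζ ^ (k % p) := fun k => by
    have h := pow_mod_orderOf ζ k
    rw [← hζ.eq_orderOf] at h
    exact h.symm
  have hne : ∀ k, y - ζ ^ k ≠ 0 := fun k => by rw [hmod]; exact hz _ (Nat.mod_lt _ hp)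
  have hmax' : ∀ k, ordd w (y - ζ ^ k) ≤ ordd w (y - ζ ^ j) := fun k => by
    rw [hmod k]; exact hmax _ (Finset.mem_range.2 (Nat.mod_lt _ hp))
  -- shifted
  have hζj0 : ζ ^ j ≠ 0 := pow_ne_zero _ hζ0
  have hy' : (y / ζ ^ j) ^ p - 1 = y ^ p - 1 := by
    rw [div_pow, ← pow_mul, mul_comm j p, pow_mul, hζ.pow_eq_one, one_pow, div_one]
  have hfac : ∀ k, y / ζ ^ j - ζ ^ k = (y - ζ ^ (j + k)) / ζ ^ j := by
    intro k; rw [pow_add]; field_simp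
  have hord : ∀ k, ordd w (y / ζ ^ j - ζ ^ k) = ordd w (y - ζ ^ (j+k)) := by
    intro k
    rw [hfac, ordd_div (hne _) hζj0, ordd_pow, ordd_root hp hζ.pow_eq_one]; simp
  have hne' : ∀ k, y / ζ ^ j - ζ ^ k ≠ 0 := fun k => by rw [hfac]; exact div_ne_zero (hne _) hζj0
  have hprod := prod_sub_root hp hζ (y / ζ ^ j)
  rw [hy'] at hprod
  have hpne : y ^ p - 1 ≠ 0 := by rw [hprod]; exact Finset.prod_ne_zero_iff.2 fun k _ => hne' k
  rw [og_iff hpne, hprod, ordd_prod _ _ (fun k _ => hne' k)] at hy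
  obtain ⟨n, rfl⟩ : ∃ n, p = n + 1 := ⟨p - 1, by omega⟩
  rw [Finset.sum_range_succ'] at hy
  have hle : ∀ k ∈ Finset.range n, ordd w (y / ζ ^ j - ζ ^ (k+1)) ≤ ordd w (1 - ζ ^ (k+1)) := by
    intro k hk
    rw [Finset.mem_range] at hk
    have h1 : (1 : K) - ζ ^ (k+1) ≠ 0 := fun h0 =>
      hζ.pow_ne_one_of_pos_of_lt (l := k + 1) (by omega) (by omega) (sub_eq_zero.1 h0).symm
    rw [← og_iff h1]
    have e : (1 : K) - ζ ^ (k+1) = (y / ζ ^ j - ζ ^ (k+1)) - (y / ζ ^ j - ζ ^ 0) := by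
      rw [pow_zero]; ring
    rw [e]
    refine og_sub (og_ordd _) ((og_iff (hne' 0)).2 ?_)
    rw [hord, hord]
    exact hmax' _
  have h2 := Finset.sum_le_sum hle
  have h3 := sum_ordd_root hp hζ w
  rw [Nat.add_sub_cancel] at h3
  rw [h3] at h2
  have h4 := hord 0
  rw [add_zero] at h4
  rw [h4] at hy
  rw [og_iff (hne j)]
  linarith

variable {F : Type} [Field F] [NumberField F]

/-- the subgroup of local p-th powers -/
def Yv (p : ℕ) (v : Pl F) (m : ℕ) : Subgroup Fˣ := (powMonoidHom p : Fˣ →* Fˣ).range ⊔ Wv v m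

theorem Yv_relIndex (p : ℕ) (v : Pl F) (m : ℕ) :
    ((Wv v 0).map (powMonoidHom p) ⊔ Wv v m).relIndex (Wv v 0) =
      (Wv v m).relIndex ((Wv v m).comap (powMonoidHom p) ⊓ Wv v 0) := by
  set U := Wv v 0
  set W := Wv v m
  have hWU : W ≤ U := Wv_anti (Nat.zero_le _)
  have hUp : U.map (powMonoidHom p) ≤ U := by
    rintro _ ⟨x, hx, rfl⟩
    exact pow_mem hx p
  have h0 : W.relIndex U ≠ 0 := relIndex_W_ne_zero
  have h1 := Subgroup.relIndex_mul_relIndex W (U.map (powMonoidHom p) ⊔ W) U le_sup_right (sup_le hUp hWU)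
  rw [Subgroup.relIndex_sup_right] at h1
  have h2 := Subgroup.relIndex_mul_relIndex W (W.comap (powMonoidHom p) ⊓ U) U
    (le_inf (fun x hx => pow_mem hx p) hWU) inf_le_right
  rw [Subgroup.inf_relIndex_right, Subgroup.relIndex_comap] at h2
  have h3 : W.relIndex (U.map (powMonoidHom p)) ≠ 0 := by
    intro h; rw [h, zero_mul] at h1; exact h0 h1.symm
  rw [mul_comm] at h1
  exact Nat.eq_of_mul_eq_mul_right (Nat.pos_of_ne_zero h3) (h1.trans h2.symm)

theorem Yv_inf (p : ℕ) (hp : 0 < p) (v : Pl F) (m : ℕ) :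
    Yv p v m ⊓ Wv v 0 = (Wv v 0).map (powMonoidHom p) ⊔ Wv v m := by
  apply le_antisymm
  · rintro x ⟨hx, hx0⟩
    obtain ⟨_, ⟨y, rfl⟩, t, ht, rfl⟩ := Subgroup.mem_sup.1 hx
    refine Subgroup.mul_mem_sup ⟨y, ?_, rfl⟩ ht
    have h1 := mem_Wv_zero.1 hx0
    rw [Units.val_mul, ordd_mul (Units.ne_zero _) (Units.ne_zero _), ht.1, add_zero] at h1
    have h2 : ordd v ((y : F) ^ p) = 0 := by simpa using h1
    rw [ordd_pow] at h2
    refine mem_Wv_zero.2 ?_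
    rcases mul_eq_zero.1 h2 with h | h
    · omega
    · exact h
  · refine sup_le ?_ (le_inf le_sup_right (Wv_anti (Nat.zero_le _)))
    rintro _ ⟨x, hx, rfl⟩
    exact ⟨Subgroup.mem_sup_left ⟨x, rfl⟩, pow_mem hx p⟩

theorem Yv_sup_index (p : ℕ) (hp : 0 < p) (v : Pl F) (m : ℕ) :
    (Yv p v m ⊔ Wv v 0).index = p := by
  have : Yv p v m ⊔ Wv v 0 = ((Subgroup.zpowers (Multiplicative.ofAdd (p : ℤ))).comap (ordHom v)) := by
    apply le_antisymm
    · refine sup_le (sup_le ?_ ?_) ?_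
      · rintro _ ⟨x, rfl⟩
        refine ⟨ordd v (x : F), ?_⟩
        change Multiplicative.ofAdd (p : ℤ) ^ (ordd v (x : F)) = Multiplicative.ofAdd (ordd v ((x ^ p : Fˣ) : F))
        rw [Units.val_pow_eq_pow_val, ordd_pow, ← ofAdd_zsmul]; simp [mul_comm]
      · intro x hx
        refine ⟨0, ?_⟩
        change _ = Multiplicative.ofAdd (ordd v (x : F))
        rw [hx.1]; simp
      · intro x hx
        refine ⟨0, ?_⟩
        change _ = Multiplicative.ofAdd (ordd v (x : F))
        rw [hx.1]; simp
    · rintro x ⟨n, hn⟩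
      change Multiplicative.ofAdd (p : ℤ) ^ n = Multiplicative.ofAdd (ordd v (x : F)) at hn
      rw [← ofAdd_zsmul] at hn
      replace hn : n • (p : ℤ) = ordd v (x : F) := Multiplicative.ofAdd.injective hn
      obtain ⟨π, hπ0, hπ⟩ := ordd_exists v
      have e : x = ((Units.mk0 (π : F) hπ0) ^ n) ^ p * (x / ((Units.mk0 (π : F) hπ0) ^ n) ^ p) := by
        rw [mul_div_cancel]
      rw [e]
      refine Subgroup.mul_mem_sup (Subgroup.mem_sup_left ⟨_, rfl⟩) (mem_Wv_zero.2 ?_)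
      rw [Units.val_div_eq_div_val, ordd_div (Units.ne_zero _) (Units.ne_zero _), Units.val_pow_eq_pow_val,
        Units.val_zpow_eq_zpow_val, ordd_pow, ordd_zpow, Units.val_mk0, hπ, ← hn]
      simp [mul_comm]
  rw [this, Subgroup.index_comap_of_surjective]
  · have h1 : (AddSubgroup.zmultiples (p : ℤ)).index = p := by simp
    exact h1
  · intro n
    obtain ⟨π, hπ0, hπ⟩ := ordd_exists v
    refine ⟨(Units.mk0 (π : F) hπ0) ^ (Multiplicative.toAdd n), ?_⟩
    change Multiplicative.ofAdd (ordd v _) = n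
    rw [Units.val_zpow_eq_zpow_val, ordd_zpow, Units.val_mk0, hπ]; simp

theorem Yv_index_aux (p : ℕ) (hp : 0 < p) (v : Pl F) (m : ℕ) :
    (Yv p v m).index = p * (Wv v m).relIndex ((Wv v m).comap (powMonoidHom p) ⊓ Wv v 0) := by
  rw [← Yv_relIndex, ← Yv_inf p hp, Subgroup.inf_relIndex_right,
    ← Subgroup.relIndex_sup_left, mul_comm, ← Subgroup.relIndex_mul_index (le_sup_left : Yv p v m ≤ Yv p v m ⊔ Wv v 0),
    Yv_sup_index p hp]

end P5

section P5b
variable {F : Type} [Field F] [NumberField F] {K : Type} [Field K] [NumberField K] [Algebra F K]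

theorem relIndex_le_of_fun {G : Type*} [CommGroup G] (W T : Subgroup G) (p : ℕ) (j : G → ℕ)
    (hj : ∀ x ∈ T, j x < p) (h : ∀ x ∈ T, ∀ y ∈ T, j x = j y → x / y ∈ W) :
    W.relIndex T ≠ 0 ∧ W.relIndex T ≤ p := by
  let f : (T ⧸ W.subgroupOf T) → Fin p := fun q => ⟨j (q.out : G), hj _ q.out.2⟩
  have hf : Function.Injective f := by
    intro q q' hq
    have h1 : j (q.out : G) = j (q'.out : G) := by simpa [f] using hq
    have h2 := h _ q'.out.2 _ q.out.2 h1.symm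
    rw [← Quotient.out_eq' q, ← Quotient.out_eq' q']
    apply QuotientGroup.eq.2
    rw [Subgroup.mem_subgroupOf]
    simpa [div_eq_inv_mul] using h2
  have := Finite.of_injective f hf
  refine ⟨?_, ?_⟩
  · change Nat.card (T ⧸ W.subgroupOf T) ≠ 0
    exact Nat.card_pos.ne'
  · change Nat.card (T ⧸ W.subgroupOf T) ≤ p
    simpa using Nat.card_le_card_of_injective f hf

theorem Yv_index_gen {p : ℕ} (hp : p.Prime) (v : Pl F) {m e c : ℕ} (hm : 2 * e + 1 ≤ m)
    (h : (Wv v (m - e)).relIndex ((Wv v m).comap (powMonoidHom p) ⊓ Wv v 0) ≠ 0 ∧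
      (Wv v (m - e)).relIndex ((Wv v m).comap (powMonoidHom p) ⊓ Wv v 0) ≤ c) :
    (Yv p v m).index ≠ 0 ∧ (Yv p v m).index ≤ p * c * qI v ^ e := by
  rw [Yv_index_aux p hp.pos]
  set T := (Wv v m).comap (powMonoidHom p) ⊓ Wv v 0
  have hWW : Wv v m ≤ Wv v (m - e) := Wv_anti (by omega)
  have hWT : Wv v m ≤ T := le_inf (fun x hx => pow_mem hx p) (Wv_anti (Nat.zero_le _))
  have h1 := Subgroup.relIndex_mul_relIndex (Wv v m) (Wv v (m-e) ⊓ T) T (le_inf hWW hWT) inf_le_right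
  rw [Subgroup.inf_relIndex_right] at h1
  have h2 : (Wv v m).relIndex (Wv v (m-e)) = qI v ^ e := by
    have := relIndex_W_sub (v := v) (k := m - e) (j := e) (by omega)
    rwa [Nat.sub_add_cancel (by omega)] at this
  have hq : qI v ^ e ≠ 0 := pow_ne_zero _ (by have := one_lt_qI (v := v); omega)
  have h3 : (Wv v m).relIndex (Wv v (m-e) ⊓ T) ≤ qI v ^ e := by
    rw [← h2]; exact Subgroup.relIndex_le_of_le_right inf_le_left (by rw [h2]; exact hq)
  have h4 : (Wv v m).relIndex (Wv v (m-e) ⊓ T) ≠ 0 := by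
    have : (Wv v m).relIndex (Wv v (m-e)) ≠ 0 := by rw [h2]; exact hq
    exact fun h0 => this (Subgroup.relIndex_eq_zero_of_le_right inf_le_left h0)
  rw [← h1]
  refine ⟨mul_ne_zero hp.ne_zero (mul_ne_zero h4 h.1), ?_⟩
  calc _ ≤ p * (qI v ^ e * c) := by gcongr; exact h.2
    _ = _ := by ring

theorem og_T {p : ℕ} (hp : p.Prime) {ζ : K} (hζ : IsPrimitiveRoot ζ p) (w : Pl K) {m e : ℕ}
    (he : ordd (dn F w) (p : F) = e) (hm : 2 * e + 1 ≤ m) {x : Fˣ}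
    (hx : x ∈ (Wv (dn F w) m).comap (powMonoidHom p) ⊓ Wv (dn F w) 0) :
    ∃ j < p, og w (eI F w * ((m - e : ℕ) : ℤ)) (algebraMap F K x - ζ ^ j) := by
  have h1 : og (dn F w) m ((x : F) ^ p - 1) := by
    have hx1 : x ^ p ∈ Wv (dn F w) m := (Subgroup.mem_inf.1 hx).1
    rw [mem_Wv_pos (by omega)] at hx1
    simpa using hx1
  rw [← og_dn_iff (K := F) (w := w)] at h1
  rw [map_sub, map_pow, map_one] at h1
  obtain ⟨j, hj, h2⟩ := root_close hp.pos hζ w h1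
  refine ⟨j, hj, ?_⟩
  have h3 : ordd w (p : K) = eI F w * e := by
    rw [← he, ← ordd_dn, map_natCast]
  rw [h3] at h2
  rw [Nat.cast_sub (by omega), mul_sub]
  exact h2

theorem Yv_index_le {p : ℕ} (hp : p.Prime) {ζ : K} (hζ : IsPrimitiveRoot ζ p) (w : Pl K) {m e : ℕ}
    (he : ordd (dn F w) (p : F) = e) (hm : 2 * e + 1 ≤ m) :
    (Yv p (dn F w) m).index ≠ 0 ∧ (Yv p (dn F w) m).index ≤ p * p * qI (dn F w) ^ e := by
  refine Yv_index_gen hp _ hm ?_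
  have key : ∀ x ∈ (Wv (dn F w) m).comap (powMonoidHom p) ⊓ Wv (dn F w) 0,
      ∃ j < p, og w (eI F w * ((m - e : ℕ) : ℤ)) (algebraMap F K x - ζ ^ j) :=
    fun x hx => og_T hp hζ w he hm hx
  have hT : ∀ x ∈ (Wv (dn F w) m).comap (powMonoidHom p) ⊓ Wv (dn F w) 0, ordd (dn F w) (x : F) = 0 :=
    fun x hx => mem_Wv_zero.1 (Subgroup.mem_inf.1 hx).2
  clear he
  generalize (Wv (dn F w) m).comap (powMonoidHom p) ⊓ Wv (dn F w) 0 = T at key hT ⊢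
  choose! j hj using key
  refine relIndex_le_of_fun _ _ p j (fun x hx => (hj x hx).1) ?_
  intro x hx y hy hxy
  have h1 := (hj x hx).2
  have h2 := (hj y hy).2
  rw [hxy] at h1
  have h3 := og_sub h1 h2
  rw [sub_sub_sub_cancel_right, ← map_sub, og_dn_iff] at h3
  rw [mem_Wv_div (by omega), hT y hy, add_zero]
  exact h3

theorem Yv_index_le_ns {p : ℕ} (hp : p.Prime) (hp2 : p ≠ 2) {ζ : K} (hζ : IsPrimitiveRoot ζ p) (w : Pl K) {m e : ℕ}
    (he : ordd (dn F w) (p : F) = e) (hm : 2 * e + 1 ≤ m) (c : K ≃ₐ[F] K) (hc : c ζ = ζ⁻¹)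
    (hw : gact (c : K ≃+* K) w = w) :
    (Yv p (dn F w) m).index ≠ 0 ∧ (Yv p (dn F w) m).index ≤ p * qI (dn F w) ^ e := by
  have h1 : (Wv (dn F w) (m - e)).relIndex ((Wv (dn F w) m).comap (powMonoidHom p) ⊓ Wv (dn F w) 0) = 1 := by
    rw [Subgroup.relIndex_eq_one]
    intro x hx
    obtain ⟨j, hj, h2⟩ := og_T hp hζ w he hm hx
    have h3 := (og_gact (c : K ≃+* K) w _ _).2 h2
    rw [hw] at h3
    have h3' : og w (eI F w * ((m - e : ℕ) : ℤ)) (algebraMap F K x - ζ⁻¹ ^ j) := by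
      have : (c : K ≃+* K) (algebraMap F K x - ζ ^ j) = algebraMap F K x - ζ⁻¹ ^ j := by
        change c _ = _
        rw [map_sub, map_pow, hc, c.commutes]
      rwa [this] at h3
    have h4 := og_sub h3' h2
    rw [sub_sub_sub_cancel_left] at h4
    have hζ0 : ζ ≠ 0 := hζ.ne_zero hp.ne_zero
    have h5 := og_mul_unit h4 (og_isIntegral (v := w) (x := ζ ^ j) ((hζ.isIntegral hp.pos).pow j |>.tower_top))
    have e1 : (ζ ^ j - ζ⁻¹ ^ j) * ζ ^ j = -(1 - ζ ^ (2 * j)) := by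
      rw [inv_pow, sub_mul, inv_mul_cancel₀ (pow_ne_zero _ hζ0)]; ring
    rw [e1] at h5
    have h6 := og_neg h5
    rw [neg_neg] at h6
    have h7 : ζ ^ (2 * j) = 1 := by
      by_contra hne
      have h8 := ordd_root_sub_le hp.pos hζ w hne
      rw [og_iff (sub_ne_zero.2 (Ne.symm hne))] at h6
      have h9 : ordd w (p : K) = eI F w * e := by
        rw [← he, ← ordd_dn, map_natCast]
      rw [h9] at h8
      have h10 := le_trans h6 h8
      have h11 : (0:ℤ) < eI F w := by exact_mod_cast eI_pos (K := F) w
      have h12 := le_of_mul_le_mul_left h10 h11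
      omega
    have h8 : p ∣ 2 * j := hζ.dvd_of_pow_eq_one _ h7
    have h9 : p ∣ j := by
      rcases (Nat.Prime.dvd_mul hp).1 h8 with h | h
      · exact absurd ((Nat.prime_dvd_prime_iff_eq hp Nat.prime_two).1 h) hp2
      · exact h
    have h10 : ζ ^ j = 1 := by
      obtain ⟨k, rfl⟩ := h9
      rw [pow_mul, hζ.pow_eq_one, one_pow]
    rw [h10, ← map_one (algebraMap F K), ← map_sub, og_dn_iff] at h2
    exact (mem_Wv_pos (by omega)).2 h2
  have := Yv_index_gen hp (dn F w) (m := m) (e := e) (c := 1) hm (by rw [h1]; simp)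
  simpa using this

theorem prod_qI_le {p : ℕ} (hp : p.Prime) (S : Finset (Pl F)) (e : Pl F → ℕ)
    (he : ∀ v ∈ S, ordd v (p : F) = e v) :
    ∏ v ∈ S, qI v ^ e v ≤ p ^ (Module.finrank ℚ F) := by
  have h1 : ∀ v ∈ S, (p : 𝓞 F) ∈ v.asIdeal ^ (e v) := by
    intro v hv
    rw [← og_int_iff]
    have h0 : ((p : 𝓞 F) : F) = (p : F) := by simp
    rw [h0, og_iff (by exact_mod_cast hp.ne_zero), he v hv]
  have h2 : S.inf (fun v => v.asIdeal ^ (e v)) = ∏ v ∈ S, v.asIdeal ^ (e v) :=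
    IsDedekindDomain.inf_pow_eq_prod_of_prime S (fun v => v.asIdeal) e (fun v _ => v.prime)
      (fun v _ w _ hvw h => hvw (IsDedekindDomain.HeightOneSpectrum.ext h))
  have h3 : (p : 𝓞 F) ∈ ∏ v ∈ S, v.asIdeal ^ (e v) := by
    rw [← h2, Submodule.mem_finsetInf]; exact h1
  have h4 := Ideal.absNorm_dvd_absNorm_of_le ((Ideal.span_singleton_le_iff_mem _).2 h3)
  rw [map_prod] at h4
  simp only [map_pow] at h4
  rw [Ideal.absNorm_span_natCast] at h4
  have h5 : Module.finrank ℤ (𝓞 F) = Module.finrank ℚ F := RingOfIntegers.rank F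
  rw [h5] at h4
  have := Nat.le_of_dvd (pow_pos hp.pos _) h4
  exact this

end P5b

section P6
variable {K : Type} [Field K] [NumberField K] 
variable (L : Type) [Field L] [NumberField L] [Algebra K L]

/-- `v` does not split in `L` -/
def NSv (v : Pl K) : Prop := ∃ w : Pl L, dn K w = v ∧ NS K w

variable {L}

theorem card_upS [IsGalois K L] {p : ℕ} (hp : p.Prime) (h : Module.finrank K L = p) (S R : Finset (Pl K))
    (hRS : R ⊆ S) (hR : ∀ v ∈ S, v ∈ R ↔ NSv L v) :
    (upS L S).card + p * R.card = R.card + p * S.card := by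
  classical
  have h1 : (upS L S).card = ∑ v ∈ S, {w : Pl L | dn K w = v}.ncard := by
    rw [Finset.card_eq_sum_card_fiberwise (f := dn K) (t := S)]
    · refine Finset.sum_congr rfl fun v hv => ?_
      rw [← Set.ncard_coe_finset]
      congr 1
      ext w
      simp only [Finset.coe_filter, mem_upS]
      constructor
      · rintro ⟨_, h⟩; exact h
      · intro h
        replace h : dn K w = v := h
        exact ⟨by rw [h]; exact hv, h⟩
    · intro w hw
      exact mem_upS.1 hw
  have h2 : ∀ v ∈ S, {w : Pl L | dn K w = v}.ncard = if v ∈ R then 1 else p := by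
    intro v hv
    obtain ⟨w, rfl⟩ := exists_up (L := L) v
    rcases ns_or_split hp h w with ⟨a, b, c⟩ | ⟨a, b, c, d⟩
    · rw [if_pos ((hR _ hv).2 ⟨w, rfl, a⟩)]; exact c
    · rw [if_neg]
      · exact d
      · intro h'
        obtain ⟨w', hw', hn⟩ := (hR _ hv).1 h'
        apply a
        have h3 : w = w' := hn w hw'.symm
        rw [h3]; exact hn
  rw [h1, Finset.sum_congr rfl h2, Finset.sum_ite, Finset.sum_const, Finset.sum_const]
  have h3 : S.filter (fun v => v ∈ R) = R := by
    ext v; simp only [Finset.mem_filter]; exact ⟨fun h => h.2, fun h => ⟨hRS h, h⟩⟩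
  have h4 := Finset.card_filter_add_card_filter_not (s := S) (fun v => v ∈ R)
  rw [h3] at h4 ⊢
  rw [← h4]
  simp only [smul_eq_mul]
  ring

theorem FI_rho [IsGalois K L] {p : ℕ} [hp : Fact p.Prime] (h : Module.finrank K L = p)
    (S R : Finset (Pl K)) (hS : ClS S) (hram : ∀ w : Pl L, dn K w ∉ S → eI K w = 1)
    (hRS : R ⊆ S) (hR : ∀ v ∈ S, v ∈ R ↔ NSv L v) (r : ℕ)
    (hr : Units.rank L + 1 + (p - 1) * r = p * (Units.rank K + 1)) :
    ((NUS L S).relIndex (US S)) * p = p ^ (R.card + r) := by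
  have h1 := FI h S hS hram
  have h2 := card_upS hp.out h S R hRS hR
  have hp2 := hp.out.two_le
  obtain ⟨q, rfl⟩ : ∃ q, p = q + 1 := ⟨p - 1, by omega⟩
  rw [Nat.add_sub_cancel] at h1 hr
  have h3 : ((NUS L S).relIndex (US S) * (q+1)) ^ q * (q+1) ^ (Units.rank L + (upS L S).card)
      = ((q+1) ^ (R.card + r)) ^ q * (q+1) ^ (Units.rank L + (upS L S).card) := by
    rw [mul_pow, mul_right_comm, h1, ← pow_add, ← pow_mul, ← pow_add]
    congr 1
    zify at h2 hr ⊢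
    linear_combination -hr - h2
  have h4 := Nat.eq_of_mul_eq_mul_right (by positivity) h3
  exact Nat.pow_left_injective (by omega : q ≠ 0) h4

/-- modulus exponent -/
noncomputable def mv (p : ℕ) (v : Pl K) : ℕ := 2 * (ordd v (p : K)).toNat + 1

theorem ordd_nat_nonneg (v : Pl K) (p : ℕ) : 0 ≤ ordd v (p : K) := by
  have := ordd_int_nonneg (v := v) (x := (p : 𝓞 K))
  simpa using this

theorem mv_ge (p : ℕ) (v : Pl K) : 2 * ordd v (p : K) + 1 ≤ mv p v := by
  have := ordd_nat_nonneg v p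
  unfold mv; omega

/-- elements which are local `p`-th powers at all places in `S` -/
noncomputable def YS (p : ℕ) (S : Finset (Pl K)) : Subgroup Kˣ := ⨅ v ∈ S, Yv p v (mv p v)

theorem pow_mem_YS (p : ℕ) (S : Finset (Pl K)) (x : Kˣ) : x ^ p ∈ YS p S := by
  simp only [YS, Subgroup.mem_iInf]
  intro v hv
  exact Subgroup.mem_sup_left ⟨x, rfl⟩

theorem Yv_index_ne_zero (p : ℕ) (hp : 0 < p) (v : Pl K) (m : ℕ) : (Yv p v m).index ≠ 0 := by
  rw [Yv_index_aux p hp]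
  refine mul_ne_zero hp.ne' ?_
  have h0 : (Wv v m).relIndex (Wv v 0) ≠ 0 := relIndex_W_ne_zero
  exact fun h => h0 (Subgroup.relIndex_eq_zero_of_le_right inf_le_right h)

theorem p_le_index {G : Type*} [CommGroup G] {p : ℕ} (hp : p.Prime) (H : Subgroup G) (h1 : H ≠ ⊤)
    (h0 : H.index ≠ 0) (hpow : ∀ x, x ^ p ∈ H) : p ∣ H.index := by
  have : H.FiniteIndex := ⟨h0⟩
  obtain ⟨x, hx⟩ : ∃ x, x ∉ H := by
    by_contra hcon
    push Not at hcon
    exact h1 (eq_top_iff.2 fun x _ => hcon x)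
  have h2 : orderOf (x : G ⧸ H) = p := by
    have := Fact.mk hp
    refine orderOf_eq_prime ?_ ?_
    · rw [← QuotientGroup.mk_pow, QuotientGroup.eq_one_iff]; exact hpow x
    · rwa [Ne, QuotientGroup.eq_one_iff]
  rw [← h2]
  exact orderOf_dvd_natCard _

theorem normU_incU {p : ℕ} (h : Module.finrank K L = p) (x : Kˣ) : normU K L (incU K L x) = x ^ p := by
  ext
  simp [Algebra.norm_algebraMap, h]

theorem C_ne_top [IsGalois K L] {p : ℕ} [hp : Fact p.Prime] (h : Module.finrank K L = p)
    (S : Finset (Pl K)) (hS : ClS S) (hram : ∀ w : Pl L, dn K w ∉ S → eI K w = 1)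
    (hr : Units.rank L + 1 = p * (Units.rank K + 1)) (ST : Finset (Pl K)) (hSST : S ⊆ ST)
    (hT : ∀ v ∈ ST, v ∉ S → ¬ NSv L v) : YS p S ⊔ US ST ≠ ⊤ := by
  classical
  intro htop
  set R := S.filter (fun v => NSv L v)
  have hFI := FI_rho h ST R (ClS_mono hSST hS) (fun w hw => hram w (fun hh => hw (hSST hh)))
    ((Finset.filter_subset _ _).trans hSST)
    (fun v hv => by
      simp only [R, Finset.mem_filter]
      refine ⟨fun h => h.2, fun h => ⟨?_, h⟩⟩
      by_contra hvS
      exact hT v hv hvS h) 0 (by simpa using hr)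
  rw [add_zero] at hFI
  let H : Pl K → Subgroup Kˣ := fun v => (normU K L).range ⊔ Wv v (mv p v)
  have hYH : ∀ v, Yv p v (mv p v) ≤ H v := by
    intro v
    refine sup_le ?_ le_sup_right
    rintro _ ⟨x, rfl⟩
    refine Subgroup.mem_sup_left ⟨incU K L x, ?_⟩
    rw [normU_incU h]; rfl
  have hH0 : ∀ v, (H v).index ≠ 0 := fun v h0 => by
    have hd := Subgroup.index_dvd_of_le (hYH v)
    rw [h0, zero_dvd_iff] at hd
    exact Yv_index_ne_zero p hp.out.pos v (mv p v) hd
  have hHp : ∀ v ∈ R, p ≤ (H v).index := by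
    intro v hv
    obtain ⟨w, rfl, hw⟩ := (Finset.mem_filter.1 hv).2
    refine Nat.le_of_dvd (Nat.pos_of_ne_zero (hH0 _)) (p_le_index hp.out _ ?_ (hH0 _) ?_)
    · exact local_ne_top h hw (mv_ge p _)
    · intro x
      exact hYH _ (Subgroup.mem_sup_left ⟨x, rfl⟩)
  have hidx := index_inf_open R H (mv p) (fun v _ => le_sup_right)
  have h1 : p ^ R.card ≤ (⨅ v ∈ R, H v).index := by
    rw [hidx, ← Finset.prod_const]
    exact Finset.prod_le_prod' hHp
  have h2 : YS p S ≤ ⨅ v ∈ R, H v := by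
    refine le_iInf₂ fun v hv => ?_
    exact (iInf₂_le v (Finset.mem_filter.1 hv).1).trans (hYH v)
  have h3 : NUS L ST ≤ ⨅ v ∈ R, H v := by
    refine le_iInf₂ fun v hv => ?_
    rintro _ ⟨x, _, rfl⟩
    exact Subgroup.mem_sup_left ⟨x, rfl⟩
  have h4 : (⨅ v ∈ R, H v) ⊔ US ST = ⊤ := top_le_iff.1 (htop ▸ sup_le_sup_right h2 _)
  have h5 : (⨅ v ∈ R, H v).index = (⨅ v ∈ R, H v).relIndex (US ST) := by
    rw [← Subgroup.relIndex_sup_left, h4, Subgroup.relIndex_top_right]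
  have hI0 : (NUS L ST).relIndex (US ST) ≠ 0 := by
    intro h0; rw [h0, zero_mul] at hFI
    exact (pow_ne_zero _ hp.out.ne_zero) hFI.symm
  have h6 := Subgroup.relIndex_le_of_le_left h3 hI0
  rw [← h5] at h6
  have h7 := h1.trans h6
  rw [← hFI] at h7
  have := hp.out.two_le
  have := Nat.pos_of_ne_zero hI0
  nlinarith

end P6

section P6b
variable {K : Type} [Field K] [NumberField K] 

open scoped Classical in
theorem US_insert_le {S T2 : Finset (Pl K)} (hS : ClS S) (hST : S ⊆ T2) (v : Pl K) :
    US (insert v T2) ≤ US T2 ⊔ US (insert v S) := by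
  intro x hx
  by_cases hv : v ∈ T2
  · rw [Finset.insert_eq_of_mem hv] at hx
    exact Subgroup.mem_sup_left hx
  obtain ⟨k, hk⟩ := hS.realize (Pi.single v (1:ℤ)) ((Set.finite_singleton v).subset (by
    intro u hu
    by_contra h
    exact hu (Pi.single_eq_of_ne h _)))
  have hvS : v ∉ S := fun h => hv (hST h)
  have hk1 : ordd v (k : K) = 1 := by rw [hk v hvS, Pi.single_eq_same]
  have hkU : k ∈ US (insert v S) := by
    rw [mem_US]
    intro u hu
    rw [Finset.mem_insert, not_or] at hu
    rw [hk u hu.2, Pi.single_eq_of_ne hu.1]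
  have e : x = (x / k ^ (ordd v (x : K))) * k ^ (ordd v (x : K)) := by rw [div_mul_cancel]
  rw [e]
  refine Subgroup.mul_mem_sup ?_ (zpow_mem hkU _)
  rw [mem_US]
  intro u hu
  rw [Units.val_div_eq_div_val, ordd_div (Units.ne_zero _) (Units.ne_zero _), Units.val_zpow_eq_zpow_val, ordd_zpow]
  by_cases huv : u = v
  · subst huv; rw [hk1]; ring
  · rw [(mem_US.1 hx) u (by simp [huv, hu]), hk u (fun h => hu (hST h)), Pi.single_eq_of_ne huv]; ring

open scoped Classical in
theorem exists_larger {S ST : Finset (Pl K)} (hS : ClS S) (hST : S ⊆ ST) (D : Subgroup Kˣ) (hD : US ST ≤ D)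
    (htop : D ≠ ⊤) : ∃ v, ¬ US (insert v ST) ≤ D := by
  by_contra hcon
  push Not at hcon
  have h1 : ∀ T : Finset (Pl K), US (ST ∪ T) ≤ D := by
    intro T
    induction T using Finset.induction_on with
    | empty => simpa using hD
    | insert v T hv ih =>
      rw [Finset.union_insert]
      refine (US_insert_le (ClS_mono hST hS) Finset.subset_union_left v).trans (sup_le ih (hcon v))
  apply htop
  rw [eq_top_iff]
  intro x _
  refine h1 (ordd_support (x : K) (K := K)).toFinset ?_
  rw [mem_US]
  intro v hv
  by_contra h
  exact hv (Finset.mem_union_right _ (by simpa using h))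

theorem mul_index_le {G : Type*} [CommGroup G] {p : ℕ} (hp : p.Prime) {H H' : Subgroup G} (h1 : H ≤ H')
    (hne : ¬ H' ≤ H) (h0 : H.index ≠ 0) (hpow : ∀ x, x ^ p ∈ H) : p * H'.index ≤ H.index := by
  have h2 := Subgroup.relIndex_mul_index h1
  rw [← h2]
  refine Nat.mul_le_mul_right _ ?_
  have h3 : H.relIndex H' ≠ 0 := by intro h; rw [h, zero_mul] at h2; exact h0 h2.symm
  refine Nat.le_of_dvd (Nat.pos_of_ne_zero h3) (p_le_index hp (H.subgroupOf H') ?_ h3 ?_)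
  · rw [Ne, Subgroup.subgroupOf_eq_top]; exact hne
  · intro x; rw [Subgroup.mem_subgroupOf]; exact hpow _

open scoped Classical in
theorem greedy {p : ℕ} (hp : p.Prime) {S : Finset (Pl K)} (hS : ClS S) (v0 : Pl K) (N n : ℕ) :
    ∀ T : Finset (Pl K), v0 ∈ T → (YS p S ⊔ US (S ∪ T)).index ≠ 0 → (YS p S ⊔ US (S ∪ T)).index ≤ n →
    p ^ T.card * (YS p S ⊔ US (S ∪ T)).index ≤ N →
    ∃ T : Finset (Pl K), v0 ∈ T ∧ YS p S ⊔ US (S ∪ T) = ⊤ ∧ p ^ T.card ≤ N := by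
  induction n with
  | zero => intro T _ h1 h2 _; omega
  | succ n ih =>
    intro T hv h0 hn hN
    by_cases htop : YS p S ⊔ US (S ∪ T) = ⊤
    · refine ⟨T, hv, htop, ?_⟩
      rw [htop] at hN
      simpa using hN
    · obtain ⟨v, hvD⟩ := exists_larger hS Finset.subset_union_left _ (le_sup_right : US (S ∪ T) ≤ _) htop
      rw [← Finset.union_insert] at hvD
      have hle : YS p S ⊔ US (S ∪ T) ≤ YS p S ⊔ US (S ∪ insert v T) :=
        sup_le_sup_left (US_mono (Finset.union_subset_union_right (Finset.subset_insert _ _))) _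
      have h1 := mul_index_le hp hle (fun h => hvD (le_sup_right.trans h)) h0
        (fun x => Subgroup.mem_sup_left (pow_mem_YS p S x))
      have h2 : (YS p S ⊔ US (S ∪ insert v T)).index ≠ 0 := fun h => by
        have hd := Subgroup.index_dvd_of_le hle
        rw [h, zero_dvd_iff] at hd
        exact h0 hd
      have hp2 := hp.two_le
      refine ih (insert v T) (Finset.mem_insert_of_mem hv) h2 ?_ ?_
      · have := Nat.pos_of_ne_zero h2
        nlinarith
      · calc _ ≤ p ^ (T.card + 1) * (YS p S ⊔ US (S ∪ insert v T)).index :=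
              Nat.mul_le_mul_right _ (Nat.pow_le_pow_right hp.pos (Finset.card_insert_le _ _))
          _ = p ^ T.card * (p * (YS p S ⊔ US (S ∪ insert v T)).index) := by ring
          _ ≤ p ^ T.card * (YS p S ⊔ US (S ∪ T)).index := Nat.mul_le_mul_left _ h1
          _ ≤ N := hN

theorem core {A : Type} [CommGroup A] [Finite A] {p : ℕ} (hp : p.Prime) {S : Finset (Pl K)} (hS : ClS S)
    (hD0 : (YS p S ⊔ US S).index ≠ 0) (hDA : (YS p S ⊔ US S).index ≤ Nat.card A)
    (Av : Pl K → Subgroup A) (hAv : ∀ v, v ∉ S → (Av v).index ≤ p) (Spl : A → Pl K → Prop)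
    (hspl : ∀ a v, v ∉ S → a ∈ Av v → Spl a v)
    (hC : ∀ a, a ≠ 1 → ∀ ST : Finset (Pl K), S ⊆ ST → (∀ v ∈ ST, v ∉ S → Spl a v) → YS p S ⊔ US ST ≠ ⊤)
    (v0 : Pl K) (hv0 : v0 ∉ S) (x0 : Kˣ) (hx0 : ∀ v ∉ S, v ≠ v0 → ordd v (x0 : K) = 0)
    (hx0D : x0 ∉ YS p S ⊔ US S) : ∃ a, a ≠ 1 ∧ ¬ Spl a v0 := by
  classical
  have hle : YS p S ⊔ US S ≤ YS p S ⊔ US (S ∪ {v0}) := sup_le_sup_left (US_mono Finset.subset_union_left) _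
  have h0 : x0 ∈ US (S ∪ {v0}) := by
    rw [mem_US]; intro v hv
    rw [Finset.mem_union, not_or, Finset.mem_singleton] at hv
    exact hx0 v hv.1 hv.2
  have h1 := mul_index_le hp hle (fun h => hx0D (h (Subgroup.mem_sup_right h0))) hD0
        (fun x => Subgroup.mem_sup_left (pow_mem_YS p S x))
  have h2 : (YS p S ⊔ US (S ∪ {v0})).index ≠ 0 := fun h => by
    have hd := Subgroup.index_dvd_of_le hle
    rw [h, zero_dvd_iff] at hd
    exact hD0 hd
  obtain ⟨T, hT0, hTtop, hTN⟩ := greedy hp hS v0 _ _ {v0} (Finset.mem_singleton_self _) h2 le_rfl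
    (by simpa using h1)
  -- find `a`
  set T' := (T.erase v0).filter (fun v => v ∉ S)
  have h3 : (⨅ v ∈ T', Av v).index ≤ p ^ (T.card - 1) := by
    calc (⨅ v ∈ T', Av v).index = (⨅ v : T', Av v).index := by rw [iInf_subtype]
      _ ≤ ∏ v : T', (Av v).index := Subgroup.index_iInf_le _
      _ ≤ ∏ v : T', p := Finset.prod_le_prod' fun v _ => hAv v (Finset.mem_filter.1 v.2).2
      _ = p ^ T'.card := by simp
      _ ≤ _ := Nat.pow_le_pow_right hp.pos (by
        rw [← Finset.card_erase_of_mem hT0]; exact Finset.card_filter_le _ _)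
  have h4 : ∃ a ∈ (⨅ v ∈ T', Av v), a ≠ 1 := by
    by_contra hcon
    push Not at hcon
    have : (⨅ v ∈ T', Av v) = ⊥ := (Subgroup.eq_bot_iff_forall _).2 hcon
    rw [this, Subgroup.index_bot] at h3
    have h5 : p ^ T.card ≤ p ^ (T.card - 1) := (hTN.trans hDA).trans h3
    have h6 := (Nat.pow_le_pow_iff_right hp.one_lt).1 h5
    have := Finset.card_pos.2 ⟨v0, hT0⟩
    omega
  obtain ⟨a, ha, ha1⟩ := h4
  refine ⟨a, ha1, fun hs => hC a ha1 (S ∪ T) Finset.subset_union_left ?_ hTtop⟩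
  intro v hv hvS
  by_cases hvv : v = v0
  · rw [hvv]; exact hs
  · refine hspl a v hvS ?_
    simp only [Subgroup.mem_iInf] at ha
    refine ha v (Finset.mem_filter.2 ⟨Finset.mem_erase.2 ⟨hvv, ?_⟩, hvS⟩)
    rcases Finset.mem_union.1 hv with h | h
    · exact absurd h hvS
    · exact h

end P6b

section P7
variable {K : Type} [Field K] [NumberField K] {E : Type} [Field E] [NumberField E] [Algebra K E]

theorem kummer_split {p : ℕ} (hp : p.Prime) {ζ : K} (hζ : IsPrimitiveRoot ζ p) {b : Kˣ} {α : E}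
    (hα : α ^ p = algebraMap K E b) (σ : E ≃ₐ[K] E) (hσ : σ α = algebraMap K E ζ * α) (Q : Pl E) {m : ℕ}
    (hm : 2 * ordd (dn K Q) (p : K) + 1 ≤ m) (hb : b ∈ Yv p (dn K Q) m) : gact (σ : E ≃+* E) Q ≠ Q := by
  intro hQ
  have hm1 : 0 < m := by have := ordd_nat_nonneg (dn K Q) p; omega
  obtain ⟨_, ⟨x, rfl⟩, t, ht, rfl⟩ := Subgroup.mem_sup.1 hb
  rw [mem_Wv_pos hm1] at ht
  have hζE : IsPrimitiveRoot (algebraMap K E ζ) p := hζ.map_of_injective (algebraMap K E).injective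
  have hx0 : algebraMap K E x ≠ 0 := by simpa using x.ne_zero
  set β := α / algebraMap K E x with hβ
  have hβp : β ^ p = algebraMap K E t := by
    rw [hβ, div_pow, hα, div_eq_iff (pow_ne_zero _ hx0)]
    simp [mul_comm]
  have hσβ : σ β = algebraMap K E ζ * β := by
    rw [hβ, map_div₀, hσ, σ.commutes, mul_div_assoc]
  have hβ0 : β ≠ 0 := by
    rintro h
    rw [h, zero_pow hp.ne_zero] at hβp
    exact t.ne_zero ((map_eq_zero _).1 hβp.symm)
  have hordβ : ordd Q β = 0 := by
    have h1 : ordd Q (β ^ p) = 0 := by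
      rw [hβp, ordd_dn, (ordd_of_og_one (og_mono ht (by omega))).2, mul_zero]
    rw [ordd_pow] at h1
    rcases mul_eq_zero.1 h1 with h | h
    · exact absurd (by exact_mod_cast h) hp.ne_zero
    · exact h
  have h1 : og Q (eI K Q * m) (β ^ p - 1) := by
    rw [hβp, ← map_one (algebraMap K E), ← map_sub]; exact og_dn ht
  obtain ⟨j, hj, h2⟩ := root_close hp.pos hζE Q h1
  have h3 := (og_gact (σ : E ≃+* E) Q _ _).2 h2
  rw [hQ] at h3
  have e1 : (σ : E ≃+* E) (β - algebraMap K E ζ ^ j) = algebraMap K E ζ * β - algebraMap K E ζ ^ j := by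
    change σ _ = _
    rw [map_sub, hσβ, ← map_pow, σ.commutes]
  rw [e1] at h3
  have h4 := og_sub h2 h3
  have e2 : β - algebraMap K E ζ ^ j - (algebraMap K E ζ * β - algebraMap K E ζ ^ j)
      = (1 - algebraMap K E ζ ^ 1) * β := by ring
  have hne : algebraMap K E ζ ^ 1 ≠ 1 := hζE.pow_ne_one_of_pos_of_lt one_ne_zero hp.one_lt
  have h1ζ : (1 : E) - algebraMap K E ζ ^ 1 ≠ 0 := sub_ne_zero.2 hne.symm
  rw [e2, og_iff (mul_ne_zero h1ζ hβ0), ordd_mul h1ζ hβ0, hordβ, add_zero] at h4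
  have h5 := ordd_root_sub_le hp.pos hζE Q hne
  have h6 : ordd Q (p : E) = eI K Q * ordd (dn K Q) (p : K) := by rw [← ordd_dn, map_natCast]
  have h7 : (0:ℤ) < eI K Q := by exact_mod_cast eI_pos (K := K) Q
  rw [h6] at h4 h5
  nlinarith

theorem kummer_unram [IsGalois K E] {p : ℕ} (hp : p.Prime) (h : Module.finrank K E = p) {ζ : K}
    (hζ : IsPrimitiveRoot ζ p) {b : Kˣ} {α : E}
    (hα : α ^ p = algebraMap K E b) (σ : E ≃ₐ[K] E) (hσ : σ α = algebraMap K E ζ * α) (Q : Pl E)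
    (hQp : ordd (dn K Q) (p : K) = 0) (hb : ordd (dn K Q) (b : K) = 0) : eI K Q = 1 := by
  rcases ns_or_split hp h Q with ⟨hns, hef, -⟩ | ⟨-, h1, -⟩
  swap
  · exact h1
  by_contra he
  have hf : fI K Q = 1 := by
    rcases (Nat.dvd_prime hp).1 (Dvd.intro _ hef) with h1 | h1
    · exact absurd h1 he
    · rw [h1] at hef
      exact Nat.eq_of_mul_eq_mul_left hp.pos (by rw [hef, mul_one])
  have hζE : IsPrimitiveRoot (algebraMap K E ζ) p := hζ.map_of_injective (algebraMap K E).injective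
  have hα0 : α ≠ 0 := by
    rintro h
    rw [h, zero_pow hp.ne_zero] at hα
    exact b.ne_zero ((map_eq_zero _).1 hα.symm)
  have hordα : ordd Q α = 0 := by
    have h1 : ordd Q (α ^ p) = 0 := by
      rw [hα, ordd_dn, hb, mul_zero]
    rw [ordd_pow] at h1
    rcases mul_eq_zero.1 h1 with h | h
    · exact absurd (by exact_mod_cast h) hp.ne_zero
    · exact h
  obtain ⟨y, hy⟩ := residue_surj hf ((og_iff hα0).2 hordα.ge)
  have h3 := (hns.og σ).2 hy
  rw [map_sub, hσ, σ.commutes] at h3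
  have h4 := og_sub hy h3
  have e2 : α - algebraMap K E (y : K) - (algebraMap K E ζ * α - algebraMap K E (y : K))
      = (1 - algebraMap K E ζ ^ 1) * α := by ring
  have hne : algebraMap K E ζ ^ 1 ≠ 1 := hζE.pow_ne_one_of_pos_of_lt one_ne_zero hp.one_lt
  have h1ζ : (1 : E) - algebraMap K E ζ ^ 1 ≠ 0 := sub_ne_zero.2 hne.symm
  rw [e2, og_iff (mul_ne_zero h1ζ hα0), ordd_mul h1ζ hα0, hordα, add_zero] at h4
  have h5 := ordd_root_sub_le hp.pos hζE Q hne
  have h6 : ordd Q (p : E) = eI K Q * ordd (dn K Q) (p : K) := by rw [← ordd_dn, map_natCast]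
  rw [h6, hQp] at h5
  omega

theorem kummer_exists {p : ℕ} (hp : p.Prime) {ζ : K} (hζ : IsPrimitiveRoot ζ p) (b : K)
    (hb : ∀ x, x ^ p ≠ b) : ∃ (E : Type) (_ : Field E) (_ : NumberField E) (_ : Algebra K E),
      IsGalois K E ∧ Module.finrank K E = p ∧ ∃ α : E, α ^ p = algebraMap K E b ∧
        (∃ σ : E ≃ₐ[K] E, σ α = algebraMap K E ζ * α) ∧ Algebra.adjoin K {α} = ⊤ ∧
        ∀ (R : Type) [Field R] (f : K →+* R) (r : R), r ^ p = f b →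
          ∃ g : E →+* R, g.comp (algebraMap K E) = f ∧ g α = r := by
  have H := X_pow_sub_C_irreducible_of_prime hp hb
  have hfact := Fact.mk H
  have hne : (primitiveRoots p K).Nonempty := ⟨ζ, (mem_primitiveRoots hp.pos).2 hζ⟩
  let E := AdjoinRoot (Polynomial.X ^ p - Polynomial.C b)
  have hsf : Polynomial.IsSplittingField K E (Polynomial.X ^ p - Polynomial.C b) :=
    isSplittingField_AdjoinRoot_X_pow_sub_C hne H
  have hfd : FiniteDimensional K E := Polynomial.IsSplittingField.finiteDimensional E (Polynomial.X ^ p - Polynomial.C b)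
  have hcz : CharZero E := charZero_of_injective_algebraMap (algebraMap K E).injective
  let _ : Algebra ℚ E := DivisionRing.toRatAlgebra
  have hst : IsScalarTower ℚ K E := inferInstance
  have hfq : FiniteDimensional ℚ E := FiniteDimensional.trans ℚ K E
  have hroot : (AdjoinRoot.root (Polynomial.X ^ p - Polynomial.C b) : E) ^ p = algebraMap K E b := by
    have := AdjoinRoot.eval₂_root (Polynomial.X ^ p - Polynomial.C b)
    rw [Polynomial.eval₂_sub, Polynomial.eval₂_X_pow, Polynomial.eval₂_C, sub_eq_zero] at this
    exact this
  have hNZ : NeZero p := ⟨hp.ne_zero⟩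
  refine ⟨E, inferInstance, { to_charZero := hcz, to_finiteDimensional := hfq }, inferInstance,
    isGalois_of_isSplittingField_X_pow_sub_C hne H E, finrank_of_isSplittingField_X_pow_sub_C hne H E,
    AdjoinRoot.root _, hroot, ⟨(autEquivZmod H E hζ).symm (Multiplicative.ofAdd ((1 : ℕ) : ZMod p)), ?_⟩,
    AdjoinRoot.adjoinRoot_eq_top, ?_⟩
  · rw [autEquivZmod_symm_apply_natCast H E hroot hζ 1, pow_one, Algebra.smul_def]
  · intro R _ f r hr
    have hev : Polynomial.eval₂ f r (Polynomial.X ^ p - Polynomial.C b) = 0 := by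
      rw [Polynomial.eval₂_sub, Polynomial.eval₂_X_pow, Polynomial.eval₂_C, hr, sub_self]
    refine ⟨AdjoinRoot.lift f r hev, ?_, AdjoinRoot.lift_root hev⟩
    ext x
    exact AdjoinRoot.lift_of hev

end P7

section P7b
variable {K : Type} [Field K] [NumberField K] {E : Type} [Field E] [NumberField E] [Algebra K E]

theorem A_index [IsGalois K E] {p : ℕ} [hp : Fact p.Prime] (h : Module.finrank K E = p) {ζ : K}
    (hζ : IsPrimitiveRoot ζ p) {b : Kˣ} {α : E}
    (hα : α ^ p = algebraMap K E b) (σ : E ≃ₐ[K] E) (hσ : σ α = algebraMap K E ζ * α)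
    {S : Finset (Pl K)} (hS : ClS S) (hSp : ∀ v ∉ S, ordd v (p : K) = 0) (hb : b ∈ US S) (hbY : b ∈ YS p S)
    (r : ℕ) (hr : Units.rank E + 1 + (p - 1) * r = p * (Units.rank K + 1)) :
    ((NUS E S).relIndex (US S)) * p = p ^ r := by
  have := FI_rho h S ∅ hS
    (fun Q hQ => kummer_unram hp.out h hζ hα σ hσ Q (hSp _ hQ) (mem_US.1 hb _ hQ))
    (Finset.empty_subset _) (fun v hv => by
      simp only [Finset.notMem_empty, false_iff]
      rintro ⟨Q, rfl, hQ⟩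
      refine kummer_split hp.out hζ hα σ hσ Q (mv_ge p (dn K Q)) ?_ (hQ.gact σ)
      simp only [YS, Subgroup.mem_iInf] at hbY
      exact hbY _ hv) r hr
  simpa using this

/-- roots of `S`-units are `S`-units -/
theorem US_root {p : ℕ} (hp : p ≠ 0) {S : Finset (Pl K)} {x : Kˣ} (h : x ^ p ∈ US S) : x ∈ US S := by
  intro v hv
  have := mem_US.1 h v hv
  rw [Units.val_pow_eq_pow_val, ordd_pow] at this
  rcases mul_eq_zero.1 this with h | h
  · exact absurd (by exact_mod_cast h) hp
  · exact h

theorem pow_relIndex {G : Type*} [CommGroup G] (H : Subgroup G) [Module.Finite ℤ (Additive H)] {p : ℕ} (hp : p ≠ 0) :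
    (H.map (powMonoidHom p)).relIndex H = p ^ (Module.finrank ℤ (Additive H)) *
      Nat.card (powMonoidHom p : H →* H).ker ∧ Finite (powMonoidHom p : H →* H).ker := by
  obtain ⟨h1, h2⟩ := index_range_nsmul_fg (Additive H) p hp
  refine ⟨?_, h2⟩
  have h3 : (powMonoidHom p : H →* H).range.index = p ^ (Module.finrank ℤ (Additive H)) *
      Nat.card (powMonoidHom p : H →* H).ker := h1
  rw [← h3, Subgroup.relIndex]
  congr 1
  ext x
  rw [Subgroup.mem_subgroupOf]
  constructor
  · rintro ⟨y, hy, h⟩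
    exact ⟨⟨y, hy⟩, Subtype.ext h⟩
  · rintro ⟨y, h⟩
    exact ⟨y, y.2, congrArg Subtype.val h⟩

theorem pow_relIndex_ge {G : Type*} [CommGroup G] (H : Subgroup G) [Module.Finite ℤ (Additive H)] {p : ℕ} (hp : p.Prime)
    {ρ : ℕ} (hρ : ρ ≤ Module.finrank ℤ (Additive H)) :
    p ^ ρ ≤ (H.map (powMonoidHom p)).relIndex H := by
  obtain ⟨h1, h2⟩ := pow_relIndex H hp.ne_zero
  rw [h1]
  calc p ^ ρ ≤ p ^ (Module.finrank ℤ (Additive H)) := Nat.pow_le_pow_right hp.pos hρ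
    _ ≤ _ := Nat.le_mul_of_pos_right _ Nat.card_pos

theorem pow_relIndex_ge' {G : Type*} [CommGroup G] (H : Subgroup G) [Module.Finite ℤ (Additive H)] {p : ℕ} (hp : p.Prime)
    {ρ : ℕ} (hρ : ρ ≤ Module.finrank ℤ (Additive H)) {z : G} (hz : z ∈ H) (hz1 : z ≠ 1) (hzp : z ^ p = 1) :
    p ^ (ρ + 1) ≤ (H.map (powMonoidHom p)).relIndex H := by
  obtain ⟨h1, h2⟩ := pow_relIndex H hp.ne_zero
  rw [h1, pow_succ]
  have h3 : p ∣ Nat.card (powMonoidHom p : H →* H).ker := by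
    have := Fact.mk hp
    let z' : (powMonoidHom p : H →* H).ker := ⟨⟨z, hz⟩, by
      rw [MonoidHom.mem_ker]; exact Subtype.ext hzp⟩
    have h4 : orderOf z' = p := orderOf_eq_prime (Subtype.ext (Subtype.ext hzp))
      (fun h => hz1 (congrArg Subtype.val (congrArg Subtype.val h)))
    have h5 := orderOf_dvd_natCard z'
    rwa [h4] at h5
  exact Nat.mul_le_mul (Nat.pow_le_pow_right hp.pos hρ) (Nat.le_of_dvd Nat.card_pos h3)

theorem inf_YS {p : ℕ} (hp : p ≠ 0) {S : Finset (Pl K)} (hA : ∀ b ∈ US S, b ∈ YS p S → ∃ x, x ^ p = b) :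
    YS p S ⊓ US S = (US S).map (powMonoidHom p) := by
  ext b
  constructor
  · rintro ⟨h1, h2⟩
    obtain ⟨x, rfl⟩ := hA b h2 h1
    exact ⟨x, US_root hp h2, rfl⟩
  · rintro ⟨x, hx, rfl⟩
    exact ⟨pow_mem_YS p S x, pow_mem hx p⟩

theorem YS_index (p : ℕ) (S : Finset (Pl K)) : (YS p S).index = ∏ v ∈ S, (Yv p v (mv p v)).index :=
  index_inf_open S _ (mv p) (fun _ _ => le_sup_right)

theorem D_index {p : ℕ} (hp : p ≠ 0) {S : Finset (Pl K)} (hA : ∀ b ∈ US S, b ∈ YS p S → ∃ x, x ^ p = b) :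
    ((US S).map (powMonoidHom p)).relIndex (US S) * (YS p S ⊔ US S).index =
      ∏ v ∈ S, (Yv p v (mv p v)).index := by
  rw [← inf_YS hp hA, Subgroup.inf_relIndex_right, ← YS_index,
    ← Subgroup.relIndex_mul_index (le_sup_left : YS p S ≤ YS p S ⊔ US S), Subgroup.relIndex_sup_left]

theorem D_index_ne_zero {p : ℕ} (hp : p ≠ 0) {S : Finset (Pl K)} : (YS p S ⊔ US S).index ≠ 0 := by
  intro h
  have hd := Subgroup.index_dvd_of_le (le_sup_left : YS p S ≤ YS p S ⊔ US S)
  rw [h, zero_dvd_iff, YS_index, Finset.prod_eq_zero_iff] at hd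
  obtain ⟨v, _, hv⟩ := hd
  exact Yv_index_ne_zero p (Nat.pos_of_ne_zero hp) v _ hv

theorem mv_eq (p : ℕ) (v : Pl K) : ∃ e : ℕ, ordd v (p : K) = e ∧ mv p v = 2 * e + 1 :=
  ⟨(ordd v (p : K)).toNat, (Int.toNat_of_nonneg (ordd_nat_nonneg v p)).symm, rfl⟩

/-- the local condition off `S` has index at most `p` -/
theorem Yv_one_relIndex {p : ℕ} (hp : p.Prime) {ζ : K} (hζ : IsPrimitiveRoot ζ p) (v : Pl K)
    (hv : ordd v (p : K) = 0) : (Yv p v 1).relIndex (Wv v 0) ≤ p := by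
  obtain ⟨w, rfl⟩ := exists_up (K := K) (L := K) v
  have h1 := (Yv_index_le hp hζ w (m := 1) (e := 0) hv (by omega)).2
  have h2 := Subgroup.relIndex_mul_index (le_sup_left : Yv p (dn K w) 1 ≤ Yv p (dn K w) 1 ⊔ Wv (dn K w) 0)
  rw [Yv_sup_index p hp.pos, Subgroup.relIndex_sup_left] at h2
  rw [← h2, pow_zero, mul_one] at h1
  exact Nat.le_of_mul_le_mul_right h1 hp.pos

end P7b

def Dich (p : ℕ) (F : Type) [Field F] [NumberField F] : Prop :=
  ∃ S : Finset (Pl F), ClS S ∧ ∃ (ι : Type) (_ : Finite ι) (L : ι → Type) (_ : ∀ i, Field (L i))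
    (_ : ∀ i, NumberField (L i)) (_ : ∀ i, Algebra F (L i)),
    (∀ i, IsTotallyReal (L i) ∧ IsGalois F (L i) ∧ Module.finrank F (L i) = p ∧
      ∀ w : Pl (L i), dn F w ∉ S → eI F w = 1) ∧
    ∀ v0, v0 ∉ S → ∀ x0 : Fˣ, (∀ v, v ∉ S → v ≠ v0 → ordd v (x0 : F) = 0) →
      x0 ∈ YS p S ⊔ US S ∨ ∃ i, NSv (L i) v0

theorem rank_totReal (K : Type) [Field K] [NumberField K] [IsTotallyReal K] :
    Units.rank K + 1 = Module.finrank ℚ K := by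
  rw [IsTotallyReal.finrank, Units.rank]
  have h1 : 0 < Fintype.card (InfinitePlace K) := Fintype.card_pos
  have := InfinitePlace.card_eq_nrRealPlaces_add_nrComplexPlaces K
  have := IsTotallyReal.nrComplexPlaces_eq_zero K
  omega

theorem dich_mk {p : ℕ} [hpf : Fact p.Prime] {F : Type} [Field F] [NumberField F] [IsTotallyReal F]
    {S : Finset (Pl F)} (hS : ClS S) {A : Type} [CommGroup A] [Finite A]
    (hDA : (YS p S ⊔ US S).index ≤ Nat.card A) (Av : Pl F → Subgroup A)
    (hAv : ∀ v, v ∉ S → (Av v).index ≤ p)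
    (Lex : ∀ a : A, a ≠ 1 → ∃ (L : Type) (_ : Field L) (_ : NumberField L) (_ : Algebra F L),
      (IsTotallyReal L ∧ IsGalois F L ∧ Module.finrank F L = p ∧
        ∀ w : Pl L, dn F w ∉ S → eI F w = 1) ∧ ∀ v, v ∉ S → a ∈ Av v → ¬ NSv L v) :
    Dich p F := by
  have Lex' : ∀ a : {a : A // a ≠ 1}, ∃ (L : Type) (_ : Field L) (_ : NumberField L) (_ : Algebra F L),
      (IsTotallyReal L ∧ IsGalois F L ∧ Module.finrank F L = p ∧
        ∀ w : Pl L, dn F w ∉ S → eI F w = 1) ∧ ∀ v, v ∉ S → (a : A) ∈ Av v → ¬ NSv L v :=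
    fun a => Lex a.1 a.2
  choose L i1 i2 i3 h1 h2 using Lex'
  refine ⟨S, hS, {a : A // a ≠ 1}, inferInstance, L, i1, i2, i3, h1, ?_⟩
  intro v0 hv0 x0 hx0
  by_contra hcon
  push Not at hcon
  obtain ⟨a, ha1, ha⟩ := core hpf.out hS (D_index_ne_zero hpf.out.ne_zero) hDA Av hAv
    (fun a v => ∀ h : a ≠ 1, ¬ NSv (L ⟨a, h⟩) v)
    (fun a v hv ha h => h2 ⟨a, h⟩ v hv ha) (by
      intro a ha ST hST hT
      obtain ⟨h3, h4, h5, h6⟩ := h1 ⟨a, ha⟩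
      refine C_ne_top (L := L ⟨a, ha⟩) h5 S hS h6 ?_ ST hST (fun v hv hvS => hT v hv hvS ha)
      rw [rank_totReal, rank_totReal, ← h5, mul_comm, Module.finrank_mul_finrank]) v0 hv0 x0 hx0 hcon.1
  push Not at ha
  obtain ⟨h, ha⟩ := ha
  exact hcon.2 _ ha

theorem dich_mk2 {p : ℕ} [hpf : Fact p.Prime] {F : Type} [Field F] [NumberField F] [IsTotallyReal F]
    {S : Finset (Pl F)} (hS : ClS S) {G : Type} [CommGroup G] (A0 B : Subgroup G)
    (h0 : B.relIndex A0 ≠ 0)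
    (hDA : (YS p S ⊔ US S).index ≤ B.relIndex A0) (Cv : Pl F → Subgroup G)
    (hBC : ∀ v, v ∉ S → B ≤ Cv v)
    (hCv : ∀ v, v ∉ S → (Cv v).relIndex A0 ≤ p)
    (Lex : ∀ a ∈ A0, a ∉ B → ∃ (L : Type) (_ : Field L) (_ : NumberField L) (_ : Algebra F L),
      (IsTotallyReal L ∧ IsGalois F L ∧ Module.finrank F L = p ∧
        ∀ w : Pl L, dn F w ∉ S → eI F w = 1) ∧ ∀ v, v ∉ S → a ∈ Cv v → ¬ NSv L v) :
    Dich p F := by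
  have hfin : Finite (A0 ⧸ B.subgroupOf A0) := by
    apply Nat.finite_of_card_ne_zero; exact h0
  refine dich_mk (A := A0 ⧸ B.subgroupOf A0) hS hDA
    (fun v => ((Cv v).subgroupOf A0).map (QuotientGroup.mk' (B.subgroupOf A0))) ?_ ?_
  · intro v hv
    rw [Subgroup.index_map_eq _ (QuotientGroup.mk'_surjective _)]
    · exact hCv v hv
    · rw [QuotientGroup.ker_mk']
      intro x hx
      rw [Subgroup.mem_subgroupOf] at hx ⊢
      exact hBC v hv hx
  · intro a ha
    obtain ⟨a, rfl⟩ := QuotientGroup.mk'_surjective _ a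
    have haB : (a : G) ∉ B := fun h => ha ((QuotientGroup.eq_one_iff _).2 h)
    obtain ⟨L, i1, i2, i3, h1, h2⟩ := Lex a a.2 haB
    refine ⟨L, i1, i2, i3, h1, fun v hv hav => h2 v hv ?_⟩
    obtain ⟨c, hc, hca⟩ := hav
    have h3 : c⁻¹ * a ∈ B.subgroupOf A0 := (QuotientGroup.eq).1 hca
    rw [Subgroup.mem_subgroupOf] at h3
    have h4 := (Cv v).mul_mem (Subgroup.mem_subgroupOf.1 hc) (hBC v hv h3)
    simpa using h4

section signs
variable {F : Type} [Field F] [NumberField F] [IsTotallyReal F]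

noncomputable def rE (v : InfinitePlace F) : F →+* ℝ :=
  InfinitePlace.embedding_of_isReal (IsTotallyReal.isReal v)

theorem rE_coe (v : InfinitePlace F) (x : F) : ((rE v x : ℝ) : ℂ) = v.embedding x :=
  InfinitePlace.embedding_of_isReal_apply _ _

theorem rE_abs (v : InfinitePlace F) (x : F) : |rE v x| = v x :=
  InfinitePlace.norm_embedding_of_isReal (IsTotallyReal.isReal v) x

noncomputable def sgV (v : InfinitePlace F) : Fˣ →* SignTypeˣ :=
  (Units.map (signHom (α := ℝ) : ℝ →* SignType)).comp (Units.map (rE v : F →* ℝ))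

theorem sgV_val (v : InfinitePlace F) (x : Fˣ) : ((sgV v x : SignTypeˣ) : SignType) = SignType.sign (rE v x) := rfl

theorem sgV_eq_one (v : InfinitePlace F) (x : Fˣ) : sgV v x = 1 ↔ 0 < rE v x := by
  rw [Units.ext_iff, sgV_val, Units.val_one]
  exact sign_eq_one_iff

noncomputable def sgn (F : Type) [Field F] [NumberField F] [IsTotallyReal F] :
    Fˣ →* (InfinitePlace F → SignTypeˣ) := MonoidHom.pi (fun v => sgV v)

theorem card_signTypeUnits : Nat.card SignTypeˣ = 2 := by
  rw [Nat.card_eq_fintype_card]; decide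

theorem sign_cast_cases (ε : SignTypeˣ) : ε = 1 ∨ ε = -1 := by
  revert ε; decide

theorem sgn_surj (ε : InfinitePlace F → SignTypeˣ) : ∃ x : Fˣ, sgn F x = ε := by
  classical
  let y : (v : InfinitePlace F) → WithAbs v.1 := fun v => WithAbs.toAbs v.1 (if ε v = 1 then 1 else -1 : F)
  have hd := InfinitePlace.denseRange_algebraMap_pi F
  obtain ⟨x, hx⟩ := Metric.denseRange_iff.1 hd y 1 one_pos
  have hx' : ∀ v : InfinitePlace F, v ((if ε v = 1 then 1 else -1 : F) - x) < 1 := by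
    intro v
    have := (dist_pi_lt_iff one_pos).1 hx v
    rw [dist_eq_norm] at this
    exact this
  have hs : ∀ v : InfinitePlace F, (ε v = 1 → 0 < rE v x) ∧ (ε v ≠ 1 → rE v x < 0) := by
    intro v
    have h := hx' v
    rw [← rE_abs, map_sub, abs_lt] at h
    refine ⟨fun h1 => ?_, fun h1 => ?_⟩
    · rw [if_pos h1, map_one] at h; linarith [h.2]
    · rw [if_neg h1, map_neg, map_one] at h; linarith [h.1]
  have hx0 : x ≠ 0 := by
    rintro rfl
    obtain ⟨v⟩ : Nonempty (InfinitePlace F) := inferInstance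
    have := hs v
    rw [map_zero] at this
    by_cases h : ε v = 1
    · exact lt_irrefl _ (this.1 h)
    · exact lt_irrefl _ (this.2 h)
  refine ⟨Units.mk0 x hx0, ?_⟩
  funext v
  change sgV v _ = _
  by_cases h : ε v = 1
  · rw [h, sgV_eq_one]; exact (hs v).1 h
  · have h2 : ε v = -1 := (sign_cast_cases _).resolve_left h
    rw [h2, Units.ext_iff, sgV_val]
    exact sign_eq_neg_one_iff.2 ((hs v).2 h)

variable {E : Type} [Field E] [NumberField E] [Algebra F E]

theorem norm_pos_ram [IsGalois F E] (h : Module.finrank F E = 2) (v : InfinitePlace F)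
    (hv : ¬ v.IsUnramifiedIn E) (x : Eˣ) : 0 < rE v (Algebra.norm F (x : E)) := by
  obtain ⟨φ, hφ⟩ : ∃ φ : E →+* ℂ, φ.comp (algebraMap F E) = v.embedding :=
    ⟨ComplexEmbedding.lift E v.embedding, ComplexEmbedding.lift_comp_algebraMap E v.embedding⟩
  have hw : (InfinitePlace.mk φ).comap (algebraMap F E) = v := by
    rw [InfinitePlace.comap_mk, hφ, InfinitePlace.mk_embedding]
  rw [← hw, InfinitePlace.isUnramifiedIn_comap, InfinitePlace.not_isUnramified_iff,
    InfinitePlace.isComplex_mk_iff] at hv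
  have hreal : ∀ a : F, starRingEnd ℂ (v.embedding a) = v.embedding a := by
    intro a; rw [← rE_coe]; exact Complex.conj_ofReal _
  obtain ⟨g, hg⟩ := ComplexEmbedding.exists_comp_symm_eq_of_comp_eq (k := F) φ (ComplexEmbedding.conjugate φ) (by
    ext a
    have := RingHom.congr_fun hφ a
    simp only [RingHom.comp_apply] at this ⊢
    rw [ComplexEmbedding.conjugate_coe_eq, this, hreal])
  have hg1 : g.symm ≠ 1 := by
    intro h1
    apply hv.1
    rw [h1] at hg
    exact hg.symm
  have hN : algebraMap F E (Algebra.norm F (x : E)) = x * g.symm x := by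
    classical
    rw [Algebra.norm_eq_prod_automorphisms]
    have : (Finset.univ : Finset (E ≃ₐ[F] E)) = {1, g.symm} := by
      symm
      apply Finset.eq_univ_of_card
      rw [Finset.card_pair (Ne.symm hg1), ← Nat.card_eq_fintype_card, IsGalois.card_aut_eq_finrank, h]
    rw [this, Finset.prod_pair (Ne.symm hg1)]
    rfl
  have h2 : ((rE v (Algebra.norm F (x : E)) : ℝ) : ℂ) = ((Complex.normSq (φ x) : ℝ) : ℂ) := by
    rw [rE_coe, ← hφ, RingHom.comp_apply, hN, map_mul, ← Complex.mul_conj]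
    congr 1
    exact RingHom.congr_fun hg x
  rw [Complex.ofReal_inj] at h2
  rw [h2, Complex.normSq_pos]
  simp

theorem rank_add_ram [IsGalois F E] (h : Module.finrank F E = 2) : ∃ R : Finset (InfinitePlace F),
    (∀ v ∈ R, ¬ v.IsUnramifiedIn E) ∧ Units.rank E + 1 + R.card = 2 * (Units.rank F + 1) := by
  classical
  have hc := InfinitePlace.card_eq_card_isUnramifiedIn (k := F) (K := E)
  set U : Finset (InfinitePlace F) := {w : InfinitePlace F | w.IsUnramifiedIn E} with hU
  refine ⟨Uᶜ, fun v hv => by simpa [hU] using hv, ?_⟩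
  rw [h] at hc
  have h1 : 0 < Fintype.card (InfinitePlace E) := Fintype.card_pos
  have h2 : 0 < Fintype.card (InfinitePlace F) := Fintype.card_pos
  have h3 := Finset.card_add_card_compl U
  rw [Units.rank, Units.rank]
  omega

theorem two_A {S : Finset (Pl F)} (hS : ClS S) (hSp : ∀ v ∉ S, ordd v ((2:ℕ) : F) = 0)
    (hsg : ∀ ε, ∃ x ∈ US S, sgn F x = ε) (b : Fˣ) (hb : b ∈ US S) (hbY : b ∈ YS 2 S) : ∃ x, x ^ 2 = b := by
  by_contra hcon
  push Not at hcon
  have hζ : IsPrimitiveRoot (-1 : F) 2 := IsPrimitiveRoot.neg_one 0 (by norm_num)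
  obtain ⟨E, _, _, _, hG, hd, α, hα, ⟨σ, hσ⟩, -, -⟩ := kummer_exists Nat.prime_two hζ (b : F) (by
    intro x hx
    have hx0 : x ≠ 0 := by rintro rfl; exact b.ne_zero (by rw [← hx]; ring)
    exact hcon (Units.mk0 x hx0) (Units.ext hx))
  obtain ⟨R, hR, hr⟩ := rank_add_ram (F := F) hd
  have hI := A_index hd hζ hα σ hσ hS hSp hb hbY R.card (by simpa using hr)
  let sR : Fˣ →* (R → SignTypeˣ) := MonoidHom.pi (fun v => sgV v.1)
  have h1 : NUS E S ≤ sR.ker := by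
    rintro _ ⟨x, hx, rfl⟩
    rw [MonoidHom.mem_ker]
    funext v
    change sgV v.1 _ = 1
    rw [sgV_eq_one, normU_val]
    exact norm_pos_ram hd v.1 (hR _ v.2) x
  have h2 : sR.ker.relIndex (US S) = 2 ^ R.card := by
    classical
    rw [Subgroup.relIndex_ker]
    have : (US S).map sR = ⊤ := by
      rw [eq_top_iff]
      intro ε _
      obtain ⟨x, hx, hxe⟩ := hsg (fun v => if h : v ∈ R then ε ⟨v, h⟩ else 1)
      refine ⟨x, hx, ?_⟩
      funext v
      have := congrFun hxe v.1
      rw [dif_pos v.2] at this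
      exact this
    rw [this]
    have h5 := card_signTypeUnits
    rw [Nat.card_eq_fintype_card] at h5
    simp [Nat.card_congr Subgroup.topEquiv.toEquiv, Nat.card_pi, h5]
  have h0 : (NUS E S).relIndex (US S) ≠ 0 := by
    intro h; rw [h, zero_mul] at hI; exact absurd hI.symm (by positivity)
  have h3 := Subgroup.relIndex_le_of_le_left (L := US S) h1 h0
  rw [h2, ← hI] at h3
  omega


theorem exists_S2 : ∃ S : Finset (Pl F), ClS S ∧ (∀ v ∉ S, ordd v ((2:ℕ) : F) = 0) ∧
    (∀ ε, ∃ x ∈ US S, sgn F x = ε) := by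
  classical
  obtain ⟨S0, hS0⟩ := exists_ClS F
  choose x hx using sgn_surj (F := F)
  let T : Finset (Pl F) := (Finset.univ : Finset (InfinitePlace F → SignTypeˣ)).biUnion
    (fun ε => (ordd_support (x ε : F)).toFinset)
  refine ⟨S0 ∪ (ordd_support ((2:ℕ) : F)).toFinset ∪ T, ClS_mono (by
    intro v hv; simp [hv]) hS0, ?_, ?_⟩
  · intro v hv
    by_contra h
    apply hv
    rw [Finset.mem_union, Finset.mem_union]
    exact Or.inl (Or.inr (by rw [Set.Finite.mem_toFinset]; exact h))
  · intro ε
    refine ⟨x ε, ?_, hx ε⟩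
    rw [mem_US]
    intro v hv
    by_contra h
    apply hv
    rw [Finset.mem_union]
    exact Or.inr (Finset.mem_biUnion.2 ⟨ε, Finset.mem_univ _, by rw [Set.Finite.mem_toFinset]; exact h⟩)

theorem real_of_adjoin {E : Type} [Field E] [NumberField E] [Algebra F E] (α : E) (had : Algebra.adjoin F {α} = ⊤)
    (h : ∀ φ : E →+* ℂ, (φ α).im = 0) : IsTotallyReal E := by
  refine ⟨fun w => ?_⟩
  rw [← InfinitePlace.mk_embedding w, InfinitePlace.isReal_mk_iff]
  set φ := w.embedding
  rw [ComplexEmbedding.isReal_iff]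
  ext x
  have hx : x ∈ Algebra.adjoin F {α} := by rw [had]; trivial
  have h3 : ∀ y : F, starRingEnd ℂ (φ (algebraMap F E y)) = φ (algebraMap F E y) := by
    intro y
    have := IsTotallyReal.complexEmbedding_isReal (φ.comp (algebraMap F E))
    rw [ComplexEmbedding.isReal_iff] at this
    exact RingHom.congr_fun this y
  rw [ComplexEmbedding.conjugate_coe_eq]
  induction hx using Algebra.adjoin_induction with
  | mem y hy =>
    rw [Set.mem_singleton_iff] at hy
    subst hy
    exact Complex.conj_eq_iff_im.2 (h φ)
  | algebraMap y => exact h3 y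
  | add a b _ _ ha hb => rw [map_add, map_add, ha, hb]
  | mul a b _ _ ha hb => rw [map_mul, map_mul, ha, hb]

theorem im_of_sq {z : ℂ} {r : ℝ} (hr : 0 < r) (h : z ^ 2 = r) : z.im = 0 := by
  have h1 := congrArg Complex.re h
  have h2 := congrArg Complex.im h
  simp [sq] at h1 h2
  by_contra h0
  have : z.re = 0 := by
    have : z.re * z.im = 0 := by linarith
    exact (mul_eq_zero.1 this).resolve_right h0
  rw [this] at h1
  nlinarith [mul_self_nonneg z.im]

theorem dich_two : Dich 2 F := by
  classical
  obtain ⟨S, hS, hSp, hsg⟩ := exists_S2 (F := F)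
  have hA := two_A hS hSp hsg
  have hfact : Fact (Nat.Prime 2) := ⟨Nat.prime_two⟩
  have hζ : IsPrimitiveRoot (-1 : F) 2 := IsPrimitiveRoot.neg_one 0 (by norm_num)
  have hD := D_index two_ne_zero hA
  obtain ⟨hUf, hUr⟩ := US_finite_finrank S
  set n := Module.finrank ℚ F with hn
  have hrk : Units.rank F + 1 = n := rank_totReal F
  -- bounds
  have hge : 2 ^ (Units.rank F + S.card + 1) ≤ ((US S).map (powMonoidHom 2)).relIndex (US S) := by
    refine pow_relIndex_ge' (US S) Nat.prime_two hUr.ge (z := -1) ?_ ?_ (by simp)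
    · rw [mem_US]; intro v _; simp
    · intro h
      have := congrArg Units.val h
      simp at this
      norm_num [neg_eq_iff_add_eq_zero] at this
  have hne : ((US S).map (powMonoidHom 2)).relIndex (US S) ≠ 0 := by
    intro h; rw [h] at hge; exact absurd hge (by simp)
  choose e he hme using fun v : Pl F => mv_eq 2 v
  have hle : ∏ v ∈ S, (Yv 2 v (mv 2 v)).index ≤ 4 ^ S.card * 2 ^ n := by
    calc ∏ v ∈ S, (Yv 2 v (mv 2 v)).index ≤ ∏ v ∈ S, (4 * qI v ^ e v) := by
          apply Finset.prod_le_prod' 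
          intro v hv
          obtain ⟨w, rfl⟩ := exists_up (K := F) (L := F) v
          exact (Yv_index_le Nat.prime_two hζ w (he _) (hme _).ge).2
      _ = 4 ^ S.card * ∏ v ∈ S, qI v ^ e v := by
          rw [Finset.prod_mul_distrib, Finset.prod_const]
      _ ≤ _ := Nat.mul_le_mul_left _ (prod_qI_le Nat.prime_two S e (fun v _ => he v))
  set B := (US S).map (powMonoidHom 2) with hB
  set A0 := (US S) ⊓ (sgn F).ker with hA0
  have hBA : B ≤ A0 := by
    rintro _ ⟨x, hx, rfl⟩
    refine ⟨pow_mem hx 2, ?_⟩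
    change sgn F (x ^ 2) = 1
    funext v
    change sgV v (x ^ 2) = 1
    rw [sgV_eq_one]
    have : rE v x ≠ 0 := by simp
    rw [Units.val_pow_eq_pow_val, map_pow]
    positivity
  have hrel := Subgroup.relIndex_mul_relIndex B A0 (US S) hBA inf_le_left
  have hA0i : A0.relIndex (US S) ≤ 2 ^ n := by
    rw [hA0, Subgroup.inf_relIndex_left, Subgroup.relIndex_ker]
    have h5 := card_signTypeUnits
    rw [Nat.card_eq_fintype_card] at h5
    have hcard : Nat.card (InfinitePlace F → SignTypeˣ) = 2 ^ n := by
      rw [Nat.card_eq_fintype_card, Fintype.card_fun, h5, hn, IsTotallyReal.finrank,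
        InfinitePlace.card_eq_nrRealPlaces_add_nrComplexPlaces, IsTotallyReal.nrComplexPlaces_eq_zero, add_zero]
    rw [← hcard]
    exact Subgroup.card_le_card_group _
  have hDA : (YS 2 S ⊔ US S).index ≤ B.relIndex A0 := by
    have h1 : (YS 2 S ⊔ US S).index ≤ 2 ^ S.card := by
      have h2 : 2 ^ (Units.rank F + S.card + 1) * (YS 2 S ⊔ US S).index ≤ 4 ^ S.card * 2 ^ n :=
        (Nat.mul_le_mul_right _ hge).trans (hD.le.trans hle)
      have h3 : 4 ^ S.card * 2 ^ n = 2 ^ (Units.rank F + S.card + 1) * 2 ^ S.card := by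
        rw [← hrk, show (4:ℕ) = 2 ^ 2 by norm_num, ← pow_mul, ← pow_add, ← pow_add]
        congr 1; ring
      rw [h3] at h2
      exact Nat.le_of_mul_le_mul_left h2 (by positivity)
    refine h1.trans ?_
    have h2 : 2 ^ n * 2 ^ S.card ≤ 2 ^ n * B.relIndex A0 := by
      calc 2 ^ n * 2 ^ S.card = 2 ^ (Units.rank F + S.card + 1) := by
            rw [← hrk, ← pow_add]; congr 1; ring
        _ ≤ _ := hge
        _ = B.relIndex A0 * A0.relIndex (US S) := hrel.symm
        _ ≤ B.relIndex A0 * 2 ^ n := Nat.mul_le_mul_left _ hA0i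
        _ = _ := mul_comm _ _
    exact Nat.le_of_mul_le_mul_left h2 (by positivity)
  refine dich_mk2 hS A0 B ?_ hDA (fun v => Yv 2 v 1) ?_ ?_ ?_
  · intro h; rw [h, zero_mul] at hrel; exact hne hrel.symm
  · rintro v hv _ ⟨x, hx, rfl⟩
    exact Subgroup.mem_sup_left ⟨x, rfl⟩
  · intro v hv
    have h1 := Yv_one_relIndex Nat.prime_two hζ v (hSp v hv)
    have h2 : A0 ≤ Wv v 0 := fun x hx => mem_Wv_zero.2 (mem_US.1 (Subgroup.mem_inf.1 hx).1 v hv)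
    refine (Subgroup.relIndex_le_of_le_right h2 ?_).trans h1
    intro h0
    have := Subgroup.relIndex_dvd_index_of_normal (Yv 2 v 1) (Wv v 0)
    rw [h0, zero_dvd_iff] at this
    exact Yv_index_ne_zero 2 two_pos v 1 this
  · intro a ha haB
    have haU := (Subgroup.mem_inf.1 ha).1
    obtain ⟨E, i1, i2, i3, hG, hd, α, hα, ⟨σ, hσ⟩, had, -⟩ := kummer_exists Nat.prime_two hζ (a : F) (by
      intro x hx
      have hx0 : x ≠ 0 := by rintro rfl; exact a.ne_zero (by rw [← hx]; ring)
      apply haB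
      have hxa : (Units.mk0 x hx0) ^ 2 = a := Units.ext hx
      refine ⟨Units.mk0 x hx0, US_root two_ne_zero ?_, hxa⟩
      rw [hxa]; exact haU)
    refine ⟨E, i1, i2, i3, ⟨?_, hG, hd, ?_⟩, ?_⟩
    · refine real_of_adjoin α had (fun φ => ?_)
      have hs : sgn F a = 1 := (Subgroup.mem_inf.1 ha).2
      have h2 : (φ.comp (algebraMap F E)) (a : F) = ((rE (InfinitePlace.mk (φ.comp (algebraMap F E))) a : ℝ) : ℂ) := by
        rw [rE_coe, InfinitePlace.embedding_mk_eq_of_isReal]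
        exact IsTotallyReal.complexEmbedding_isReal _
      refine im_of_sq ((sgV_eq_one _ _).1 (congrFun hs (InfinitePlace.mk (φ.comp (algebraMap F E))))) ?_
      rw [← h2, ← map_pow, hα]; rfl
    · intro w hw
      exact kummer_unram Nat.prime_two hd hζ hα σ hσ w (hSp _ hw) (mem_US.1 haU _ hw)
    · rintro v hv hav ⟨w, rfl, hw⟩
      refine kummer_split Nat.prime_two hζ hα σ hσ w (m := 1) ?_ hav (hw.gact σ)
      rw [hSp _ hv]; norm_num

end signs

section twist

theorem ringHom_ext_adjoin {K E R : Type} [Field K] [Field E] [Algebra K E] [Field R] {α : E}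
    (had : Algebra.adjoin K {α} = ⊤) (f g : E →+* R)
    (h1 : ∀ x, f (algebraMap K E x) = g (algebraMap K E x)) (h2 : f α = g α) : f = g := by
  ext x
  have hx : x ∈ Algebra.adjoin K {α} := by rw [had]; trivial
  induction hx using Algebra.adjoin_induction with
  | mem y hy =>
    rw [Set.mem_singleton_iff] at hy
    subst hy
    exact h2
  | algebraMap y => exact h1 y
  | add a b _ _ ha hb => rw [map_add, map_add, ha, hb]
  | mul a b _ _ ha hb => rw [map_mul, map_mul, ha, hb]

theorem gact_mul {K E : Type} [Field K] [Field E] [NumberField E] [Algebra K E] (s t : E ≃ₐ[K] E) (Q : Pl E) :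
    gact ((s * t : E ≃ₐ[K] E) : E ≃+* E) Q = gact (s : E ≃+* E) (gact (t : E ≃+* E) Q) := by
  rw [gact_gact]; rfl

theorem gact_one {K E : Type} [Field K] [Field E] [NumberField E] [Algebra K E] (Q : Pl E) :
    gact ((1 : E ≃ₐ[K] E) : E ≃+* E) Q = Q := gact_refl Q

theorem gact_of_sq {K E : Type} [Field K] [Field E] [NumberField E] [Algebra K E] (s : E ≃ₐ[K] E) (Q : Pl E)
    {p : ℕ} (hp : Odd p) (hs : s ^ p = 1) (h : gact (s : E ≃+* E) (gact (s : E ≃+* E) Q) = Q) :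
    gact (s : E ≃+* E) Q = Q := by
  obtain ⟨k, rfl⟩ := hp
  have h1 : ∀ k : ℕ, gact ((s ^ (2 * k) : E ≃ₐ[K] E) : E ≃+* E) Q = Q := by
    intro k
    induction k with
    | zero => exact gact_one Q
    | succ k ih =>
      rw [show 2 * (k + 1) = 2 + 2 * k by ring, pow_add, gact_mul, ih, sq, gact_mul, h]
  have h2 : gact ((s ^ (2 * k + 1) : E ≃ₐ[K] E) : E ≃+* E) Q = gact (s : E ≃+* E) Q := by
    rw [pow_succ', gact_mul, h1]
  rw [← h2, hs, gact_one]

variable {F K E : Type} [Field F] [NumberField F] [Field K] [NumberField K] [Field E] [NumberField E]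
  [Algebra F K] [Algebra K E] [Algebra F E] [IsScalarTower F K E]

theorem twist_aux [IsTotallyReal F] [IsGalois F K] [IsGalois K E] {p : ℕ} (hp : p.Prime) (hp2 : p ≠ 2)
    (hK : Module.finrank F K = 2) (hE : Module.finrank K E = p)
    {ζ : K} (hζ : IsPrimitiveRoot ζ p) (c : K ≃ₐ[F] K) (hc : c ζ = ζ⁻¹)
    (hconj : ∀ φ : K →+* ℂ, ∀ x, φ (c x) = starRingEnd ℂ (φ x)) {a : Kˣ} (ha : (a : K) * c a = 1)
    {α : E} (hα : α ^ p = algebraMap K E a) (σ : E ≃ₐ[K] E) (hσ : σ α = algebraMap K E ζ * α)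
    (had : Algebra.adjoin K {α} = ⊤) (τ : E →+* E) (hτK : ∀ x, τ (algebraMap K E x) = algebraMap K E (c x))
    (hτα : τ α = α⁻¹) {S : Finset (Pl F)} (hSp : ∀ v ∉ S, ordd v (p : F) = 0) (haU : a ∈ US (upS K S)) :
    ∃ (L : Type) (_ : Field L) (_ : NumberField L) (_ : Algebra F L),
      (IsTotallyReal L ∧ IsGalois F L ∧ Module.finrank F L = p ∧
        ∀ w : Pl L, dn F w ∉ S → eI F w = 1) ∧
        ∀ w : Pl K, dn F w ∉ S → a ∈ Yv p w 1 → ¬ NSv L (dn F w) := by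
  have hodd : Odd p := hp.odd_of_ne_two hp2
  have hα0 : α ≠ 0 := by
    rintro rfl
    rw [zero_pow hp.ne_zero] at hα
    exact a.ne_zero ((map_eq_zero (algebraMap K E)).1 hα.symm)
  have hζ0 : ζ ≠ 0 := hζ.ne_zero hp.ne_zero
  obtain ⟨φ0⟩ : Nonempty (K →+* ℂ) := inferInstance
  have hcc : ∀ x, c (c x) = x := by
    intro x
    apply φ0.injective
    rw [hconj, hconj, Complex.conj_conj]
  have hc1 : c ≠ 1 := by
    intro h
    rw [h] at hc
    have h3 : ζ ^ 2 = 1 := by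
      have h4 : ζ = ζ⁻¹ := hc
      rw [sq]; nth_rewrite 2 [h4]; exact mul_inv_cancel₀ hζ0
    have := (hζ.pow_eq_one_iff_dvd 2).1 h3
    have := (Nat.prime_dvd_prime_iff_eq hp Nat.prime_two).1 this
    exact hp2 this
  have hττ : ∀ x, τ (τ x) = x := by
    intro x
    have : τ.comp τ = RingHom.id E := by
      refine ringHom_ext_adjoin had _ _ (fun y => ?_) ?_
      · simp [hτK, hcc]
      · simp [hτα]
    exact RingHom.congr_fun this x
  let t : E ≃ₐ[F] E :=
    { toFun := τ, invFun := τ, left_inv := hττ, right_inv := hττ, map_mul' := map_mul τ, map_add' := map_add τ,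
      commutes' := fun y => by
        change τ (algebraMap F E y) = _
        rw [IsScalarTower.algebraMap_apply F K E, hτK, c.commutes] }
  have ht : ∀ x, t x = τ x := fun _ => rfl
  let s : E ≃ₐ[F] E := σ.restrictScalars F
  have hs : ∀ x, s x = σ x := fun _ => rfl
  have hst : s * t = t * s := by
    have : (s * t : E ≃ₐ[F] E).toRingEquiv.toRingHom = (t * s : E ≃ₐ[F] E).toRingEquiv.toRingHom := by
      refine ringHom_ext_adjoin had _ _ (fun y => ?_) ?_
      · change s (t _) = t (s _)
        rw [hs, hs, ht, ht, hτK, σ.commutes, σ.commutes, hτK]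
      · change s (t _) = t (s _)
        rw [hs, hs, ht, ht, hτα, map_inv₀, hσ, map_mul, hτK, hc, hτα, map_inv₀, mul_inv]
    ext x
    exact RingHom.congr_fun this x
  have hst' : ∀ x, s (t x) = t (s x) := fun x => AlgEquiv.congr_fun hst x
  have ht1 : t ≠ 1 := by
    intro h
    apply hc1
    ext x
    apply (algebraMap K E).injective
    rw [← hτK, ← ht, h]; rfl
  have htt : t ^ 2 = 1 := by ext x; exact hττ x
  have hto : orderOf t = 2 := orderOf_eq_prime htt ht1
  have hσ1 : σ ≠ 1 := by
    intro h
    rw [h] at hσ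
    have h3 : algebraMap K E ζ = 1 := by
      have h4 : α = algebraMap K E ζ * α := hσ
      exact mul_right_cancel₀ hα0 (by rw [← h4, one_mul])
    have h5 : ζ = 1 := (algebraMap K E).injective (by rw [h3, map_one])
    exact hζ.ne_one hp.one_lt h5
  have hσp : σ ^ p = 1 := by
    have h6 : Nat.card (E ≃ₐ[K] E) = p := by rw [IsGalois.card_aut_eq_finrank, hE]
    rw [← h6]; exact pow_card_eq_one'
  have hsp : s ^ p = 1 := by
    have : ∀ n x, (s ^ n) x = (σ ^ n) x := by
      intro n
      induction n with
      | zero => intro x; rfl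
      | succ n ih => intro x; rw [pow_succ, pow_succ]; exact ih (σ x)
    ext x
    rw [this, hσp]; rfl
  have hs1 : s ≠ 1 := by
    intro h; apply hσ1; ext x; rw [← hs, h]; rfl
  have hFE : FiniteDimensional F E := FiniteDimensional.trans F K E
  let L := IntermediateField.fixedField (Subgroup.zpowers t)
  have hmemL : ∀ x, x ∈ L ↔ t x = x := by
    intro x
    rw [IntermediateField.mem_fixedField_iff]
    constructor
    · intro h; exact h t (Subgroup.mem_zpowers t)
    · rintro h _ ⟨k, rfl⟩
      have h7 : t ∈ MulAction.stabilizer (E ≃ₐ[F] E) x := h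
      exact (MulAction.stabilizer (E ≃ₐ[F] E) x).zpow_mem h7 k
  have hLE : Module.finrank L E = 2 := by
    rw [IntermediateField.finrank_fixedField_eq_card, Nat.card_zpowers, hto]
  have hFL : Module.finrank F L = p := by
    have h8 := Module.finrank_mul_finrank F L E
    have h9 := Module.finrank_mul_finrank F K E
    rw [hLE] at h8; rw [hK, hE, ← h8] at h9
    omega
  have hNF : NumberField L := NumberField.of_module_finite F L
  -- automorphism of L
  have hsL : ∀ x : L, s (x : E) ∈ L := by
    intro x
    rw [hmemL, ← hst', (hmemL _).1 x.2]
  have hfix : L.fixingSubgroup = Subgroup.zpowers t := IntermediateField.fixingSubgroup_fixedField _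
  have hsfix : ∃ x : L, s (x : E) ≠ x := by
    by_contra hcon
    push Not at hcon
    have h1 : s ∈ L.fixingSubgroup := by
      rw [IntermediateField.mem_fixingSubgroup_iff]
      intro x hx; exact hcon ⟨x, hx⟩
    rw [hfix] at h1
    have h2 : s ^ 2 = 1 := by
      obtain ⟨k, hk⟩ := h1
      have hk' : t ^ k = s := hk
      rw [← hk', ← zpow_natCast, ← zpow_mul, mul_comm, zpow_mul, zpow_natCast, htt, one_zpow]
    have h3 : orderOf s ∣ Nat.gcd p 2 := Nat.dvd_gcd (orderOf_dvd_of_pow_eq_one hsp) (orderOf_dvd_of_pow_eq_one h2)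
    rw [(Nat.coprime_primes hp Nat.prime_two).2 hp2, Nat.dvd_one, orderOf_eq_one_iff] at h3
    exact hs1 h3
  let gL : L →ₐ[F] L := (s.toAlgHom.comp L.val).codRestrict L.toSubalgebra hsL
  have hgL : ∀ x, ((gL x : L) : E) = s x := fun x => rfl
  let g : L ≃ₐ[F] L := AlgEquiv.ofBijective gL (Algebra.IsAlgebraic.algHom_bijective gL)
  have hg1 : g ≠ 1 := by
    obtain ⟨x, hx⟩ := hsfix
    intro h
    apply hx
    rw [← hgL]
    exact congrArg Subtype.val (AlgEquiv.congr_fun h x)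
  have hGalL : IsGalois F L := by
    apply IsGalois.of_card_aut_eq_finrank
    have h1 := IntermediateField.finrank_fixedField_eq_card (⊤ : Subgroup (L ≃ₐ[F] L))
    have h2 := Module.finrank_mul_finrank F (IntermediateField.fixedField (⊤ : Subgroup (L ≃ₐ[F] L))) L
    rw [h1, hFL, Subgroup.card_top] at h2
    rw [hFL]
    rcases (Nat.dvd_prime hp).1 (Dvd.intro_left _ h2) with h3 | h3
    · exfalso
      apply hg1
      have := (Nat.card_eq_one_iff_unique.1 h3).1
      exact Subsingleton.elim _ _
    · exact h3
  refine ⟨L, inferInstance, hNF, inferInstance, ⟨?_, hGalL, hFL, ?_⟩, ?_⟩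
  · -- totally real
    refine ⟨fun w => ?_⟩
    rw [← InfinitePlace.mk_embedding w, InfinitePlace.isReal_mk_iff, ComplexEmbedding.isReal_iff]
    obtain ⟨Φ, hΦ⟩ : ∃ φ : E →+* ℂ, φ.comp (algebraMap L E) = w.embedding :=
      ⟨ComplexEmbedding.lift E w.embedding, ComplexEmbedding.lift_comp_algebraMap E w.embedding⟩
    have hnorm : ‖Φ α‖ = 1 := by
      have h1 : ‖Φ α‖ ^ p = ‖Φ (algebraMap K E a)‖ := by rw [← norm_pow, ← map_pow, hα]
      have h2 : ‖Φ (algebraMap K E a)‖ = 1 := by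
        have h3 := hconj (Φ.comp (algebraMap K E)) a
        have h4 : Φ.comp (algebraMap K E) a * Φ.comp (algebraMap K E) (c a) = 1 := by
          rw [← map_mul, ha, map_one]
        rw [h3] at h4
        have h5 := congrArg norm h4
        rw [norm_mul, RCLike.norm_conj, norm_one] at h5
        exact (mul_self_eq_one_iff.1 h5).resolve_right (by
          have := norm_nonneg (Φ.comp (algebraMap K E) a); intro h; linarith)
      rw [h2] at h1
      exact (pow_eq_one_iff_of_nonneg (norm_nonneg _) hp.ne_zero).1 h1
    have hΦτ : Φ.comp τ = (starRingEnd ℂ).comp Φ := by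
      refine ringHom_ext_adjoin had _ _ (fun y => ?_) ?_
      · have := hconj (Φ.comp (algebraMap K E)) y
        simpa [hτK] using this
      · have h1 : Φ α * starRingEnd ℂ (Φ α) = 1 := by
          rw [Complex.mul_conj, Complex.normSq_eq_norm_sq, hnorm]; simp
        rw [RingHom.comp_apply, hτα, map_inv₀]
        exact inv_eq_of_mul_eq_one_right h1
    ext x
    rw [ComplexEmbedding.conjugate_coe_eq, ← hΦ, RingHom.comp_apply]
    have h1 := RingHom.congr_fun hΦτ (algebraMap L E x)
    rw [RingHom.comp_apply, RingHom.comp_apply] at h1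
    rw [← h1]
    congr 1
    exact (hmemL _).1 x.2
  · intro w hw
    obtain ⟨Q, rfl⟩ := exists_up (K := L) (L := E) w
    rw [dn_dn (K := F) (L := L)] at hw
    have h1 := eI_eI (K := F) (L := L) Q
    have h2 := eI_eI (K := F) (L := K) Q
    have hwK : dn F (dn K Q) ∉ S := by rwa [dn_dn (K := F) (L := K)]
    have h3 : eI K Q = 1 := by
      refine kummer_unram hp hE hζ hα σ hσ Q ?_ ?_
      · have := ordd_dn (K := F) (dn K Q) (p : F)
        rw [hSp _ hwK, mul_zero, map_natCast] at this
        exact this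
      · exact mem_US.1 haU _ (by rwa [mem_upS])
    rw [h3, one_mul, h1] at h2
    have h4 : eI F (dn K Q) ∣ 2 := by
      rcases ns_or_split Nat.prime_two hK (dn K Q) with ⟨-, h, -⟩ | ⟨-, h, -⟩
      · exact Dvd.intro _ h
      · rw [h]; exact one_dvd _
    have h5 : eI F (dn L Q) ∣ p := by
      rcases ns_or_split hp hFL (dn L Q) with ⟨-, h, -⟩ | ⟨-, h, -⟩
      · exact Dvd.intro _ h
      · rw [h]; exact one_dvd _
    have h6 : eI F (dn L Q) ∣ 2 := (Dvd.intro_left _ h2).trans h4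
    have := Nat.dvd_gcd h5 h6
    rwa [(Nat.coprime_primes hp Nat.prime_two).2 hp2, Nat.dvd_one] at this
  · rintro w hw hY ⟨w', hw', hns⟩
    obtain ⟨Q, rfl⟩ := exists_up (K := K) (L := E) w
    have hQ : gact (σ : E ≃+* E) Q ≠ Q := by
      refine kummer_split hp hζ hα σ hσ Q (m := 1) ?_ hY
      have := ordd_dn (K := F) (dn K Q) (p : F)
      rw [hSp _ hw, mul_zero, map_natCast] at this
      rw [this]; norm_num
    rw [dn_dn (K := F) (L := K)] at hw'
    have h1 : dn L Q = w' := hns _ (by rw [dn_dn (K := F) (L := L), hw'])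
    have h2 : dn L (gact (σ : E ≃+* E) Q) = w' := hns _ (by
      rw [dn_dn (K := F) (L := L), hw', ← dn_dn (K := F) (L := K), dn_gact, dn_dn (K := F) (L := K)])
    have hGal2 : IsGalois L E := by
      apply IsGalois.of_card_aut_eq_finrank
      rw [← Nat.card_congr (IntermediateField.fixingSubgroupEquiv L).toEquiv, hfix, Nat.card_zpowers, hto, hLE]
    obtain ⟨g', hg'⟩ := gact_trans_exists (K := L) Q (gact (σ : E ≃+* E) Q) (h1.trans h2.symm)
    have hg'2 : g' * g' = 1 := by
      have h6 : Nat.card (E ≃ₐ[L] E) = 2 := by rw [IsGalois.card_aut_eq_finrank, hLE]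
      rw [← sq, ← h6]; exact pow_card_eq_one'
    have hg't : g'.restrictScalars F ∈ Subgroup.zpowers t := by
      rw [← hfix, IntermediateField.mem_fixingSubgroup_iff]
      intro x hx
      exact g'.commutes ⟨x, hx⟩
    have hcomm : ∀ x, s (g' x) = g' (s x) := by
      intro x
      have : s * g'.restrictScalars F = g'.restrictScalars F * s := by
        obtain ⟨k, hk⟩ := hg't
        have hk' : t ^ k = g'.restrictScalars F := hk
        rw [← hk']
        exact (Commute.zpow_right hst k)
      exact AlgEquiv.congr_fun this x
    apply hQ
    refine gact_of_sq σ Q hodd hσp ?_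
    have h7 : gact (σ : E ≃+* E) (gact (g' : E ≃+* E) Q) = gact (g' : E ≃+* E) (gact (σ : E ≃+* E) Q) := by
      rw [gact_gact, gact_gact]
      congr 1
      ext x
      exact hcomm x
    rw [← hg', h7, ← hg', ← gact_mul, hg'2, gact_one]

end twist

section odd

theorem rank_totComplex (K : Type) [Field K] [NumberField K] [IsTotallyComplex K] :
    2 * (Units.rank K + 1) = Module.finrank ℚ K := by
  rw [IsTotallyComplex.finrank, Units.rank]
  have h1 : 0 < Fintype.card (InfinitePlace K) := Fintype.card_pos
  have := InfinitePlace.card_eq_nrRealPlaces_add_nrComplexPlaces K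
  have := IsTotallyComplex.nrRealPlaces_eq_zero K
  omega

theorem rank_ker_ge {G H : Type} [CommGroup G] [CommGroup H] (U : Subgroup G) (V : Subgroup H) (f : G →* H)
    (hf : ∀ x ∈ U, f x ∈ V) [Module.Finite ℤ (Additive U)] [Module.Finite ℤ (Additive V)] :
    Module.Finite ℤ (Additive (U ⊓ f.ker : Subgroup G)) ∧
    Module.finrank ℤ (Additive U) ≤ Module.finrank ℤ (Additive V) +
      Module.finrank ℤ (Additive (U ⊓ f.ker : Subgroup G)) := by
  let g : U →* V := (f.comp U.subtype).codRestrict V (fun x => hf x x.2)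
  let ga : Additive U →ₗ[ℤ] Additive V := (MonoidHom.toAdditive g).toIntLinearMap
  let i : Additive (U ⊓ f.ker : Subgroup G) →ₗ[ℤ] Additive U :=
    (MonoidHom.toAdditive (Subgroup.inclusion (inf_le_left : U ⊓ f.ker ≤ U))).toIntLinearMap
  have hi : Function.Injective i := fun x y h => Subgroup.inclusion_injective inf_le_left h
  have hfin : Module.Finite ℤ (Additive (U ⊓ f.ker : Subgroup G)) := Module.Finite.of_injective i hi
  refine ⟨hfin, ?_⟩
  have h1 := Submodule.finrank_quotient_add_finrank (LinearMap.ker ga)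
  rw [ga.quotKerEquivRange.finrank_eq] at h1
  have h2 : LinearMap.ker ga = LinearMap.range i := by
    ext x
    rw [LinearMap.mem_ker, LinearMap.mem_range]
    constructor
    · intro hx
      have hx' : f (Additive.toMul x : U) = 1 := congrArg (fun z : Additive V => ((Additive.toMul z : V) : H)) hx
      exact ⟨Additive.ofMul ⟨(Additive.toMul x : U), ⟨(Additive.toMul x : U).2, hx'⟩⟩, rfl⟩
    · rintro ⟨y, rfl⟩
      have hy := (Additive.toMul y : (U ⊓ f.ker : Subgroup G)).2.2
      exact Subtype.ext hy
  rw [h2, LinearMap.finrank_range_of_inj hi] at h1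
  have h3 : Module.finrank ℤ (LinearMap.range ga) ≤ Module.finrank ℤ (Additive V) := Submodule.finrank_le _
  omega

variable {F K : Type} [Field F] [NumberField F] [Field K] [NumberField K] [Algebra F K]

theorem conj_c [IsTotallyReal F] [IsTotallyComplex K] [IsGalois F K] (hK : Module.finrank F K = 2)
    (c : K ≃ₐ[F] K) (hc : c ≠ 1) (φ : K →+* ℂ) (x : K) : φ (c x) = starRingEnd ℂ (φ x) := by
  obtain ⟨g, hg⟩ := ComplexEmbedding.exists_comp_symm_eq_of_comp_eq (k := F) φ (ComplexEmbedding.conjugate φ) (by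
    have := IsTotallyReal.complexEmbedding_isReal (φ.comp (algebraMap F K))
    rw [ComplexEmbedding.isReal_iff] at this
    rw [← this]; rfl)
  have hg1 : g.symm ≠ 1 := by
    intro h1
    apply IsTotallyComplex.complexEmbedding_not_isReal φ
    rw [h1] at hg
    exact hg.symm
  have h2 : g.symm = c := by
    have h3 : Nat.card (K ≃ₐ[F] K) = 2 := by rw [IsGalois.card_aut_eq_finrank, hK]
    obtain ⟨y, hy, huniq⟩ := (Nat.card_eq_two_iff' (1 : K ≃ₐ[F] K)).1 h3
    rw [huniq _ hg1, huniq _ hc]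
  rw [← h2]
  exact RingHom.congr_fun hg x

theorem inc_YS {p : ℕ} {S : Finset (Pl F)} {x : Fˣ} (hx : x ∈ YS p S) : incU F K x ∈ YS p (upS K S) := by
  simp only [YS, Subgroup.mem_iInf] at hx ⊢
  intro w hw
  have h1 := hx (dn F w) (mem_upS.1 hw)
  obtain ⟨_, ⟨y, rfl⟩, t, ht, rfl⟩ := Subgroup.mem_sup.1 h1
  rw [map_mul]
  refine Subgroup.mul_mem _ (Subgroup.mem_sup_left ⟨incU F K y, by simp⟩) (Subgroup.mem_sup_right ?_)
  obtain ⟨e, he, hm⟩ := mv_eq p (dn F w)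
  obtain ⟨e', he', hm'⟩ := mv_eq p w
  have h2 := ordd_dn w (p : F)
  rw [map_natCast, he, he'] at h2
  rw [hm', mem_Wv_pos (by omega), incU_val]
  rw [hm, mem_Wv_pos (by omega)] at ht
  have h3 := og_dn ht
  rw [map_sub, map_one] at h3
  refine og_mono h3 ?_
  have := eI_pos (K := F) w
  push_cast
  have h5 : (1 : ℤ) ≤ eI F w := by exact_mod_cast this
  nlinarith

theorem odd_A_K [IsTotallyComplex K] {p : ℕ} (hp : p.Prime) {ζ : K} (hζ : IsPrimitiveRoot ζ p)
    {S : Finset (Pl K)} (hS : ClS S) (hSp : ∀ v ∉ S, ordd v (p : K) = 0)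
    (b : Kˣ) (hb : b ∈ US S) (hbY : b ∈ YS p S) : ∃ x, x ^ p = b := by
  by_contra hcon
  push Not at hcon
  have hf : Fact p.Prime := ⟨hp⟩
  obtain ⟨E, _, _, _, hG, hd, α, hα, ⟨σ, hσ⟩, -, -⟩ := kummer_exists hp hζ (b : K) (by
    intro x hx
    have hx0 : x ≠ 0 := by rintro rfl; exact b.ne_zero (by rw [← hx, zero_pow hp.ne_zero])
    exact hcon (Units.mk0 x hx0) (Units.ext hx))
  have hTC : IsTotallyComplex E := isTotallyComplex_of_algebra K E
  have hI := A_index hd hζ hα σ hσ hS hSp hb hbY 0 (by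
    have h1 := rank_totComplex K
    have h2 := rank_totComplex E
    have h3 := Module.finrank_mul_finrank ℚ K E
    rw [hd, ← h1, ← h2] at h3
    rw [mul_zero, add_zero]
    have h4 : 2 * (p * (Units.rank K + 1)) = 2 * (Units.rank E + 1) := by rw [← h3]; ring
    omega)
  rw [pow_zero] at hI
  have := Nat.eq_one_of_mul_eq_one_left hI
  exact hp.one_lt.ne' this

theorem odd_A [IsTotallyComplex K] {p : ℕ} (hp : p.Prime) (hp2 : p ≠ 2) (hK : Module.finrank F K = 2)
    {ζ : K} (hζ : IsPrimitiveRoot ζ p)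
    {S : Finset (Pl F)} (hS : ClS (upS K S)) (hSp : ∀ v ∉ S, ordd v (p : F) = 0)
    (b : Fˣ) (hb : b ∈ US S) (hbY : b ∈ YS p S) : ∃ x, x ^ p = b := by
  obtain ⟨k, hk⟩ := odd_A_K hp hζ hS (fun w hw => by
    have := ordd_dn (K := F) w (p : F)
    rw [hSp _ (by rwa [mem_upS] at hw), mul_zero, map_natCast] at this
    exact this) (incU F K b) (incU_mem_US.2 hb) (inc_YS hbY)
  have h1 := congrArg (normU F K) hk
  rw [map_pow, normU_incU hK] at h1
  obtain ⟨q, hq⟩ := hp.odd_of_ne_two hp2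
  refine ⟨b / normU F K k ^ q, ?_⟩
  rw [div_pow, ← pow_mul, mul_comm q p, pow_mul, h1, ← pow_mul, hq, pow_succ, mul_div_cancel_left]

theorem exists_Sodd (p : ℕ) : ∃ S : Finset (Pl F), ClS S ∧ ClS (upS K S) ∧ (∀ v ∉ S, ordd v (p : F) = 0) := by
  classical
  obtain ⟨S0, hS0⟩ := exists_ClS F
  obtain ⟨S1, hS1⟩ := exists_ClS K
  refine ⟨S0 ∪ (ordd_support (p : F)).toFinset ∪ S1.image (dn F), ClS_mono (by
    intro v hv; simp [hv]) hS0, ClS_mono ?_ hS1, ?_⟩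
  · intro w hw
    rw [mem_upS, Finset.mem_union]
    exact Or.inr (Finset.mem_image_of_mem _ hw)
  · intro v hv
    by_contra h
    apply hv
    rw [Finset.mem_union, Finset.mem_union]
    exact Or.inl (Or.inr (by rw [Set.Finite.mem_toFinset]; exact h))

theorem dich_odd [IsTotallyReal F] [IsTotallyComplex K] [IsGalois F K] {p : ℕ} (hp : p.Prime) (hp2 : p ≠ 2)
    (hK : Module.finrank F K = 2) {ζ : K} (hζ : IsPrimitiveRoot ζ p) (c : K ≃ₐ[F] K) (hc : c ζ = ζ⁻¹) :
    Dich p F := by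
  classical
  have hfact : Fact p.Prime := ⟨hp⟩
  have hζ0 : ζ ≠ 0 := hζ.ne_zero hp.ne_zero
  have hc1 : c ≠ 1 := by
    intro h
    rw [h] at hc
    have h3 : ζ ^ 2 = 1 := by
      have h4 : ζ = ζ⁻¹ := hc
      rw [sq]; nth_rewrite 2 [h4]; exact mul_inv_cancel₀ hζ0
    have := (hζ.pow_eq_one_iff_dvd 2).1 h3
    have := (Nat.prime_dvd_prime_iff_eq hp Nat.prime_two).1 this
    exact hp2 this
  have hconj := conj_c hK c hc1
  obtain ⟨S, hS, hSK, hSp⟩ := exists_Sodd (F := F) (K := K) p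
  have hA := odd_A hp hp2 hK hζ hSK hSp
  have hD := D_index hp.ne_zero hA
  obtain ⟨hUf, hUr⟩ := US_finite_finrank S
  obtain ⟨hUKf, hUKr⟩ := US_finite_finrank (upS K S)
  have hrk : Units.rank F + 1 = Module.finrank ℚ F := rank_totReal F
  have hrkK : Units.rank K = Units.rank F := by
    have h1 := rank_totComplex K
    have h2 := Module.finrank_mul_finrank ℚ F K
    rw [hK, ← hrk, ← h1] at h2
    omega
  let R := S.filter (fun v => NSv K v)
  have hRS : R ⊆ S := Finset.filter_subset _ _
  have hR : ∀ v ∈ S, v ∈ R ↔ NSv K v := fun v hv => by simp [R, hv]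
  have hcard := card_upS Nat.prime_two hK S R hRS hR
  have hRle := Finset.card_le_card hRS
  have hge := pow_relIndex_ge (US S) hp hUr.ge
  choose e he hme using fun v : Pl F => mv_eq p v
  have hle : ∏ v ∈ S, (Yv p v (mv p v)).index ≤ p ^ S.card * p ^ (S \ R).card * p ^ (Module.finrank ℚ F) := by
    calc ∏ v ∈ S, (Yv p v (mv p v)).index ≤ ∏ v ∈ S, (p * (if v ∈ S \ R then p else 1) * qI v ^ e v) := by
          apply Finset.prod_le_prod'
          intro v hv
          by_cases hvR : v ∈ R
          · rw [if_neg (by simp [hvR]), mul_one]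
            obtain ⟨w, rfl, hw⟩ := (hR v hv).1 hvR
            exact (Yv_index_le_ns hp hp2 hζ w (he _) (hme _).ge c hc (hw.gact c)).2
          · rw [if_pos (by simp [hvR, hv])]
            obtain ⟨w, rfl⟩ := exists_up (K := F) (L := K) v
            exact (Yv_index_le hp hζ w (he _) (hme _).ge).2
      _ = p ^ S.card * p ^ (S \ R).card * ∏ v ∈ S, qI v ^ e v := by
          rw [Finset.prod_mul_distrib, Finset.prod_mul_distrib, Finset.prod_const, Finset.prod_ite,
            Finset.prod_const, Finset.prod_const_one, mul_one]
          congr 4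
          ext v; simp
      _ ≤ _ := Nat.mul_le_mul_left _ (prod_qI_le hp S e (fun v _ => he v))
  obtain ⟨hA0f, hA0r⟩ := rank_ker_ge (US (upS K S)) (US S) (normU F K) (fun x hx => normU_mem_US F hx)
  have hsd : (S \ R).card + R.card = S.card := Finset.card_sdiff_add_card_eq_card hRS
  have hNc : ∀ x : K, algebraMap F K (Algebra.norm F x) = x * c x := by
    intro x
    rw [Algebra.norm_eq_prod_automorphisms]
    have : (Finset.univ : Finset (K ≃ₐ[F] K)) = {1, c} := by
      symm
      apply Finset.eq_univ_of_card
      rw [Finset.card_pair (Ne.symm hc1), ← Nat.card_eq_fintype_card, IsGalois.card_aut_eq_finrank, hK]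
    rw [this, Finset.prod_pair (Ne.symm hc1)]
    rfl
  set A0 := US (upS K S) ⊓ (normU F K).ker with hA0
  have hA0r' : (S \ R).card ≤ Module.finrank ℤ (Additive A0) := by omega
  set B := A0.map (powMonoidHom p) with hB
  let z : Kˣ := Units.mk0 ζ hζ0
  have hzp : z ^ p = 1 := Units.ext (by simpa [z] using hζ.pow_eq_one)
  have hge2 : p ^ ((S \ R).card + 1) ≤ B.relIndex A0 := by
    refine pow_relIndex_ge' A0 hp hA0r' (z := z) ?_ ?_ hzp
    · refine ⟨US_root (p := p) hp.ne_zero (by rw [hzp]; exact one_mem _), ?_⟩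
      change normU F K z = 1
      ext
      apply (algebraMap F K).injective
      rw [normU_val, hNc]
      change ζ * c ζ = algebraMap F K 1
      rw [hc, mul_inv_cancel₀ hζ0, map_one]
    · intro h
      exact hζ.ne_one hp.one_lt (congrArg Units.val h)
  have hDA : (YS p S ⊔ US S).index ≤ B.relIndex A0 := by
    refine le_trans ?_ hge2
    have h2 : p ^ (Units.rank F + S.card) * (YS p S ⊔ US S).index ≤
        p ^ S.card * p ^ (S \ R).card * p ^ (Module.finrank ℚ F) :=
      (Nat.mul_le_mul_right _ hge).trans (hD.le.trans hle)
    have h3 : p ^ S.card * p ^ (S \ R).card * p ^ (Module.finrank ℚ F) =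
        p ^ (Units.rank F + S.card) * p ^ ((S \ R).card + 1) := by
      rw [← hrk, ← pow_add, ← pow_add, ← pow_add]
      congr 1; ring
    rw [h3] at h2
    exact Nat.le_of_mul_le_mul_left h2 (pow_pos hp.pos _)
  choose up hup using exists_up (K := F) (L := K)
  have hupS : ∀ v, v ∉ S → up v ∉ upS K S := fun v hv => by rwa [mem_upS, hup]
  have hupp : ∀ v, v ∉ S → ordd (up v) (p : K) = 0 := by
    intro v hv
    have := ordd_dn (K := F) (up v) (p : F)
    rw [hup, hSp _ hv, mul_zero, map_natCast] at this
    exact this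
  refine dich_mk2 hS A0 B ?_ hDA (fun v => Yv p (up v) 1) ?_ ?_ ?_
  · intro h
    rw [h] at hge2
    exact absurd hge2 (by simp [hp.ne_zero])
  · rintro v hv _ ⟨x, hx, rfl⟩
    exact Subgroup.mem_sup_left ⟨x, rfl⟩
  · intro v hv
    have h1 := Yv_one_relIndex hp hζ (up v) (hupp v hv)
    have h2 : A0 ≤ Wv (up v) 0 := fun x hx => mem_Wv_zero.2 (mem_US.1 (Subgroup.mem_inf.1 hx).1 _ (hupS v hv))
    refine (Subgroup.relIndex_le_of_le_right h2 ?_).trans h1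
    intro h0
    have := Subgroup.relIndex_dvd_index_of_normal (Yv p (up v) 1) (Wv (up v) 0)
    rw [h0, zero_dvd_iff] at this
    exact Yv_index_ne_zero p hp.pos (up v) 1 this
  · intro a ha haB
    have haU := (Subgroup.mem_inf.1 ha).1
    have haN : normU F K a = 1 := (Subgroup.mem_inf.1 ha).2
    have hac : (a : K) * c a = 1 := by
      rw [← hNc, ← normU_val, haN]; simp
    obtain ⟨E, i1, i2, i3, hG, hd, α, hα, ⟨σ, hσ⟩, had, hlift⟩ := kummer_exists hp hζ (a : K) (by
      intro x hx
      have hx0 : x ≠ 0 := by rintro rfl; exact a.ne_zero (by rw [← hx, zero_pow hp.ne_zero])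
      apply haB
      have hxa : (Units.mk0 x hx0) ^ p = a := Units.ext hx
      refine ⟨Units.mk0 x hx0, ⟨US_root hp.ne_zero (by rw [hxa]; exact haU), ?_⟩, hxa⟩
      change normU F K _ = 1
      have h1 : normU F K (Units.mk0 x hx0) ^ p = 1 := by rw [← map_pow, hxa, haN]
      set y := normU F K (Units.mk0 x hx0)
      ext
      obtain ⟨v⟩ : Nonempty (InfinitePlace F) := inferInstance
      apply (rE v).injective
      have h2 : (rE v (y : F)) ^ p = 1 := by
        rw [← map_pow, ← Units.val_pow_eq_pow_val, h1]; simp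
      have hodd := hp.odd_of_ne_two hp2
      rw [Units.val_one, map_one]
      exact hodd.strictMono_pow.injective (by simpa using h2))
    obtain ⟨τ, hτ1, hτ2⟩ := hlift E ((algebraMap K E).comp (c : K →+* K)) α⁻¹ (by
      rw [inv_pow, hα, RingHom.comp_apply]
      apply inv_eq_of_mul_eq_one_right
      rw [← map_mul]
      exact (congrArg (algebraMap K E) hac).trans (map_one _))
    let _ : Algebra F E := ((algebraMap K E).comp (algebraMap F K)).toAlgebra
    have _ : IsScalarTower F K E := IsScalarTower.of_algebraMap_eq' rfl
    obtain ⟨L, j1, j2, j3, hL1, hL2⟩ := twist_aux hp hp2 hK hd hζ c hc hconj hac hα σ hσ had τ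
      (fun x => RingHom.congr_fun hτ1 x) hτ2 hSp haU
    refine ⟨L, j1, j2, j3, hL1, fun v hv hav => ?_⟩
    have := hL2 (up v) (by rwa [hup]) hav
    rwa [hup] at this

end odd

theorem dich_base {F : Type} [Field F] [NumberField F] [IsTotallyReal F] {p : ℕ} (hp : p.Prime) :
    ∃ (F1 : Type) (_ : Field F1) (_ : NumberField F1) (_ : Algebra F F1), IsTotallyReal F1 ∧ Dich p F1 := by
  by_cases hp2 : p = 2
  · subst hp2
    exact ⟨F, inferInstance, inferInstance, inferInstance, inferInstance, dich_two⟩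
  have hne : NeZero p := ⟨hp.ne_zero⟩
  let K := CyclotomicField p F
  have hFD : FiniteDimensional F K := IsCyclotomicExtension.finiteDimensional {p} F K
  have hNK : NumberField K := NumberField.of_module_finite F K
  have hGal : IsGalois F K := IsCyclotomicExtension.isGalois {p} F K
  let ζ : K := IsCyclotomicExtension.zeta p F K
  have hζ : IsPrimitiveRoot ζ p := IsCyclotomicExtension.zeta_spec p F K
  have hζ0 : ζ ≠ 0 := hζ.ne_zero hp.ne_zero
  have had : Algebra.adjoin F {ζ} = ⊤ := IsCyclotomicExtension.adjoin_primitive_root_eq_top hζ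
  have hreal : ∀ (φ : K →+* ℂ) (y : F), starRingEnd ℂ (φ (algebraMap F K y)) = φ (algebraMap F K y) := by
    intro φ y
    have := IsTotallyReal.complexEmbedding_isReal (φ.comp (algebraMap F K))
    rw [ComplexEmbedding.isReal_iff] at this
    exact RingHom.congr_fun this y
  have hinv : ∀ φ : K →+* ℂ, starRingEnd ℂ (φ ζ) = φ ζ⁻¹ := by
    intro φ
    have h1 : ‖φ ζ‖ = 1 := by
      have h2 : (φ ζ) ^ p = 1 := by rw [← map_pow, hζ.pow_eq_one, map_one]
      exact Complex.norm_eq_one_of_pow_eq_one h2 hp.ne_zero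
    have h3 : φ ζ * starRingEnd ℂ (φ ζ) = 1 := by
      rw [Complex.mul_conj, Complex.normSq_eq_norm_sq, h1]; simp
    rw [map_inv₀]
    exact (inv_eq_of_mul_eq_one_right h3).symm
  obtain ⟨φ0⟩ : Nonempty (K →+* ℂ) := inferInstance
  obtain ⟨g, hg⟩ := ComplexEmbedding.exists_comp_symm_eq_of_comp_eq (k := F) φ0 (ComplexEmbedding.conjugate φ0) (by
    ext y
    exact (hreal φ0 y).symm)
  let c : K ≃ₐ[F] K := g.symm
  have hc0 : ∀ x, φ0 (c x) = starRingEnd ℂ (φ0 x) := fun x => RingHom.congr_fun hg x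
  have hc : c ζ = ζ⁻¹ := φ0.injective (by rw [hc0, hinv])
  have hcc : c ^ 2 = 1 := by
    ext x
    apply φ0.injective
    change φ0 (c (c x)) = φ0 x
    rw [hc0, hc0, Complex.conj_conj]
  have hc1 : c ≠ 1 := by
    intro h
    rw [h] at hc
    have h3 : ζ ^ 2 = 1 := by
      have h4 : ζ = ζ⁻¹ := hc
      rw [sq]; nth_rewrite 2 [h4]; exact mul_inv_cancel₀ hζ0
    have := (hζ.pow_eq_one_iff_dvd 2).1 h3
    have := (Nat.prime_dvd_prime_iff_eq hp Nat.prime_two).1 this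
    exact hp2 this
  have hconj : ∀ (φ : K →+* ℂ) x, φ (c x) = starRingEnd ℂ (φ x) := by
    intro φ x
    have : φ.comp (c : K →+* K) = (starRingEnd ℂ).comp φ := by
      refine ringHom_ext_adjoin had _ _ (fun y => ?_) ?_
      · change φ (c _) = starRingEnd ℂ (φ _)
        rw [c.commutes, hreal]
      · change φ (c _) = starRingEnd ℂ (φ _)
        rw [hc, hinv]
    exact RingHom.congr_fun this x
  have hco : orderOf c = 2 := orderOf_eq_prime hcc hc1
  let F1 := IntermediateField.fixedField (Subgroup.zpowers c)
  have hmem : ∀ x ∈ F1, c x = x := by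
    intro x hx
    rw [IntermediateField.mem_fixedField_iff] at hx
    exact hx c (Subgroup.mem_zpowers c)
  have hdeg : Module.finrank F1 K = 2 := by
    rw [IntermediateField.finrank_fixedField_eq_card, Nat.card_zpowers, hco]
  have hNF : NumberField F1 := NumberField.of_module_finite F F1
  have hTR : IsTotallyReal F1 := by
    refine ⟨fun w => ?_⟩
    rw [← InfinitePlace.mk_embedding w, InfinitePlace.isReal_mk_iff, ComplexEmbedding.isReal_iff]
    obtain ⟨Φ, hΦ⟩ : ∃ φ : K →+* ℂ, φ.comp (algebraMap F1 K) = w.embedding :=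
      ⟨ComplexEmbedding.lift K w.embedding, ComplexEmbedding.lift_comp_algebraMap K w.embedding⟩
    ext x
    rw [ComplexEmbedding.conjugate_coe_eq, ← hΦ, RingHom.comp_apply, ← hconj]
    congr 1
    exact hmem _ x.2
  have hTC : IsTotallyComplex K := by
    refine ⟨fun w => ?_⟩
    rw [← InfinitePlace.mk_embedding w, InfinitePlace.isComplex_mk_iff, ComplexEmbedding.isReal_iff]
    intro h
    apply hc1
    ext x
    apply w.embedding.injective
    rw [hconj]
    exact RingHom.congr_fun h x
  have hGal1 : IsGalois F1 K := IsGalois.tower_top_intermediateField F1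
  let c1 : K ≃ₐ[F1] K := { (c : K ≃+* K) with commutes' := fun y => hmem _ y.2 }
  exact ⟨F1, inferInstance, hNF, inferInstance, hTR, dich_odd hp hp2 hdeg hζ c1 hc⟩

/-- `ψ` is a character of the ideal class group, viewed on ideals. -/
structure ICh (F : Type) [Field F] [NumberField F] {A : Type} [CommGroup A]
    (ψ : Ideal (𝓞 F) → A) : Prop where
  mul : ∀ I J : Ideal (𝓞 F), I ≠ ⊥ → J ≠ ⊥ → ψ (I * J) = ψ I * ψ J
  prin : ∀ x : 𝓞 F, x ≠ 0 → ψ (Ideal.span {x}) = 1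

section P9
variable {F : Type} [Field F] [NumberField F] {A : Type} [CommGroup A] {ψ : Ideal (𝓞 F) → A}

theorem ICh.one (h : ICh F ψ) : ψ ⊤ = 1 := by
  have := h.prin 1 one_ne_zero
  rwa [Ideal.span_singleton_one] at this

theorem ICh.pow (h : ICh F ψ) {I : Ideal (𝓞 F)} (hI : I ≠ ⊥) (n : ℕ) : ψ (I ^ n) = ψ I ^ n := by
  induction n with
  | zero => simpa using h.one
  | succ n ih => rw [pow_succ, h.mul _ _ (pow_ne_zero n hI) hI, ih, pow_succ]

/-- a character trivial on all primes outside a finite set is trivial -/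
theorem ICh.trivial (h : ICh F ψ) (T : Finset (Pl F)) (hT : ∀ P, P ∉ T → ψ P.asIdeal = 1)
    (I : Ideal (𝓞 F)) (hI : I ≠ ⊥) : ψ I = 1 := by
  have key : ∀ J : Ideal (𝓞 F), J ≠ ⊥ → (∀ P : Pl F, P.asIdeal ∣ J → P ∉ T) → ψ J = 1 := by
    intro J
    induction J using UniqueFactorizationMonoid.induction_on_prime with
    | h₁ => intro h; exact absurd rfl h
    | h₂ x hx =>
      intro _ _
      have : x = ⊤ := by simpa using hx
      rw [this, h.one]
    | h₃ a q ha hq ih =>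
      intro h0 hd
      let P : Pl F := ⟨q, Ideal.isPrime_of_prime hq, hq.ne_zero⟩
      rw [h.mul _ _ hq.ne_zero ha, ih ha (fun P hP => hd P (hP.mul_left _)), mul_one]
      exact hT P (hd P (Dvd.intro _ rfl))
  classical
  set Q : Ideal (𝓞 F) := ∏ P ∈ T, P.asIdeal with hQ
  have hQ0 : Q ≠ ⊥ := Finset.prod_ne_zero_iff.2 fun P _ => P.ne_bot
  obtain ⟨a, ha⟩ := IsDedekindDomain.exists_sup_span_eq (I := I * Q) (J := I) Ideal.mul_le_left
    (mul_ne_zero hI hQ0)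
  have hPQ : ∀ P ∈ T, P.asIdeal ∣ Q := fun P hP => Finset.dvd_prod_of_mem _ hP
  have haI : I ∣ Ideal.span {a} := Ideal.dvd_iff_le.2 (by rw [← ha]; exact le_sup_right)
  obtain ⟨J, hJ⟩ := haI
  have hsup : Q ⊔ J = ⊤ := by
    rw [hJ, ← Ideal.mul_sup] at ha
    have : I * (Q ⊔ J) = I * ⊤ := by simpa using ha
    exact mul_left_cancel₀ hI this
  have hJT : ∀ P : Pl F, P.asIdeal ∣ J → P ∉ T := by
    intro P hP hPT
    have h1 : Q ⊔ J ≤ P.asIdeal := sup_le (Ideal.le_of_dvd (hPQ P hPT)) (Ideal.le_of_dvd hP)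
    rw [hsup] at h1
    exact P.isPrime.ne_top (top_le_iff.1 h1)
  by_cases ha0 : a = 0
  · have hJ0 : J = ⊥ := by
      rw [ha0] at hJ
      have : I * J = 0 := by rw [← hJ]; simp
      exact (mul_eq_zero.1 this).resolve_left hI
    refine key I hI fun P _ hPT => hJT P (by rw [hJ0]; exact dvd_zero _) hPT
  · have hJ0 : J ≠ ⊥ := by
      rintro rfl
      rw [Ideal.mul_bot, Ideal.span_singleton_eq_bot] at hJ
      exact ha0 hJ
    have := h.prin a ha0
    rwa [hJ, h.mul _ _ hI hJ0, key J hJ0 hJT, mul_one] at this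

theorem ordd_eq_count (v : Pl F) {x : 𝓞 F} (hx : x ≠ 0) : ordd v (x : F) =
    (Associates.mk v.asIdeal).count (Associates.mk (Ideal.span {x} : Ideal (𝓞 F))).factors := by
  have := v.intValuation_if_neg hx
  rw [ordd]
  have h2 := v.valuation_of_algebraMap (K := F) x
  rw [show (x : F) = algebraMap (𝓞 F) F x from rfl, h2, this, WithZero.log_exp]; ring

theorem ICh.place_int (h : ICh F ψ) {p : ℕ} (hA : ∀ a : A, a ^ p = 1) (v0 : Pl F) (x : 𝓞 F)
    (hx : x ≠ 0) (h1 : (p : ℤ) ∣ ordd v0 (x : F) - 1)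
    (h0 : ∀ v, v ≠ v0 → (p : ℤ) ∣ ordd v (x : F)) (hp : 1 < p) : ψ v0.asIdeal = 1 := by
  classical
  set I : Ideal (𝓞 F) := Ideal.span {x} with hI
  have hI0 : I ≠ 0 := by simpa [hI] using hx
  set n : Pl F → ℕ := fun v => (Associates.mk v.asIdeal).count (Associates.mk I).factors with hn
  have hord : ∀ v, ordd v (x : F) = n v := fun v => ordd_eq_count v hx
  have hfac := Ideal.finprod_heightOneSpectrum_factorization hI0
  have hfin := Ideal.hasFiniteMulSupport hI0
  set T : Finset (Pl F) := insert v0 hfin.toFinset with hT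
  rw [finprod_eq_prod_of_mulSupport_subset (s := T) _ (by
    intro v hv; exact Finset.mem_coe.2 (Finset.mem_insert_of_mem ((Set.Finite.mem_toFinset hfin).2 hv)))] at hfac
  set J : Ideal (𝓞 F) := ∏ v ∈ T, v.asIdeal ^ (n v / p) with hJ
  have hJ0 : J ≠ ⊥ := Finset.prod_ne_zero_iff.2 fun P _ => pow_ne_zero _ P.ne_bot
  have hIJ : I = v0.asIdeal * J ^ p := by
    rw [← hfac, hJ, ← Finset.prod_pow]
    have hite : v0.asIdeal = ∏ v ∈ T, (if v = v0 then v.asIdeal else 1) := by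
      rw [Finset.prod_ite_eq' T v0 (fun v => v.asIdeal), if_pos (Finset.mem_insert_self _ _)]
    conv_rhs => rw [hite]
    rw [← Finset.prod_mul_distrib]
    refine Finset.prod_congr rfl fun v _ => ?_
    change v.asIdeal ^ (n v) = _
    rw [← pow_mul]
    by_cases hv : v = v0
    · rw [if_pos hv, ← pow_succ']
      congr 1
      subst hv
      rw [hord] at h1
      obtain ⟨c, hc⟩ := h1
      have hp' : (1 : ℤ) < p := by exact_mod_cast hp
      have : (n v : ℤ) / p = c := by
        rw [show (n v : ℤ) = 1 + p * c by linarith, Int.add_mul_ediv_left _ _ (by omega),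
          Int.ediv_eq_zero_of_lt (by norm_num) hp', zero_add]
      zify
      rw [this]; linarith
    · rw [if_neg hv, one_mul]
      congr 1
      have := h0 v hv
      rw [hord] at this
      exact (Nat.div_mul_cancel (by exact_mod_cast this)).symm
  have h3 := h.prin x hx
  rw [← hI, hIJ, h.mul _ _ v0.ne_bot (pow_ne_zero _ hJ0), h.pow hJ0, hA, mul_one] at h3
  exact h3

theorem ICh.place (h : ICh F ψ) {p : ℕ} (hA : ∀ a : A, a ^ p = 1) (v0 : Pl F) (z : Fˣ)
    (h1 : (p : ℤ) ∣ ordd v0 (z : F) - 1)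
    (h0 : ∀ v, v ≠ v0 → (p : ℤ) ∣ ordd v (z : F)) (hp : 1 < p) : ψ v0.asIdeal = 1 := by
  obtain ⟨d, hd, hy⟩ := exists_den {v0} (fun _ => (z : F))
  obtain ⟨y, hy⟩ := hy v0 (by simp)
  have hd' : (d : F) ≠ 0 := by simpa using hd
  have hx : ((d ^ (p - 1) * y : 𝓞 F) : F) = (d : F) ^ p * z := by
    push_cast
    change (d : F) ^ (p - 1) * (y : F) = _
    rw [hy, ← mul_assoc, ← pow_succ, Nat.sub_add_cancel hp.le]
  have hx0 : (d ^ (p - 1) * y : 𝓞 F) ≠ 0 := by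
    intro h
    rw [h] at hx
    have : (d : F) ^ p * z ≠ 0 := mul_ne_zero (pow_ne_zero _ hd') z.ne_zero
    exact this (by rw [← hx]; simp)
  have hord : ∀ v : Pl F, ordd v ((d ^ (p - 1) * y : 𝓞 F) : F) = p * ordd v (d : F) + ordd v (z : F) := by
    intro v; rw [hx, ordd_mul (pow_ne_zero _ hd') z.ne_zero, ordd_pow]
  refine h.place_int hA v0 _ hx0 ?_ (fun v hv => ?_) hp
  · rw [hord, add_sub_assoc]; exact dvd_add (dvd_mul_right _ _) h1
  · rw [hord]; exact dvd_add (dvd_mul_right _ _) (h0 v hv)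

theorem dvd_ordd_of_Yv {p : ℕ} {v : Pl F} {m : ℕ} {y : Fˣ} (hy : y ∈ Yv p v m) :
    (p : ℤ) ∣ ordd v (y : F) := by
  obtain ⟨a, ⟨c, rfl⟩, b, hb, rfl⟩ := Subgroup.mem_sup.1 hy
  have hb' : ordd v (b : F) = 0 := hb.1
  rw [Units.val_mul, ordd_mul (Units.ne_zero _) b.ne_zero, hb']
  simp

theorem ICh.place_D (h : ICh F ψ) {p : ℕ} (hp : p.Prime) (hA : ∀ a : A, a ^ p = 1)
    {S : Finset (Pl F)} {v0 : Pl F} (hv0 : v0 ∉ S) (x0 : Fˣ) (hx1 : ordd v0 (x0 : F) = 1)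
    (hx : ∀ v, v ∉ S → v ≠ v0 → ordd v (x0 : F) = 0) (hD : x0 ∈ YS p S ⊔ US S) :
    ψ v0.asIdeal = 1 := by
  obtain ⟨y, hy, u, hu, rfl⟩ := Subgroup.mem_sup.1 hD
  have hm : ∀ v, ordd v ((y * u : Fˣ) : F) = ordd v (y : F) + ordd v (u : F) := fun v => by
    rw [Units.val_mul, ordd_mul y.ne_zero u.ne_zero]
  refine h.place hA v0 y ?_ (fun v hv => ?_) hp.one_lt
  · rw [hm, mem_US.1 hu v0 hv0, add_zero] at hx1
    simp [hx1]
  · by_cases hvS : v ∈ S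
    · have : y ∈ Yv p v (mv p v) := by
        simp only [YS, Subgroup.mem_iInf] at hy; exact hy v hvS
      exact dvd_ordd_of_Yv this
    · have := hx v hvS hv
      rw [hm, mem_US.1 hu v hvS, add_zero] at this
      simp [this]

theorem relNorm_ne_bot {M : Type} [Field M] [NumberField M] [Algebra F M] {I : Ideal (𝓞 M)}
    (hI : I ≠ ⊥) : Ideal.relNorm (𝓞 F) I ≠ ⊥ := fun h => hI (Ideal.relNorm_eq_bot_iff.1 h)

theorem ICh.comp (h : ICh F ψ) (M : Type) [Field M] [NumberField M] [Algebra F M] :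
    ICh M (fun I : Ideal (𝓞 M) => ψ (Ideal.relNorm (𝓞 F) I)) where
  mul I J hI hJ := by
    rw [map_mul, h.mul _ _ (relNorm_ne_bot hI) (relNorm_ne_bot hJ)]
  prin x hx := by
    rw [Ideal.relNorm_singleton]
    exact h.prin _ (by simpa using hx)

theorem ICh.step [IsTotallyReal F] (h : ICh F ψ) {p : ℕ} (hp : p.Prime) (hA : ∀ a : A, a ^ p = 1)
    (hD : Dich p F) : ∃ (M : Type) (_ : Field M) (_ : NumberField M) (_ : Algebra F M),
      IsTotallyReal M ∧ ∀ I : Ideal (𝓞 M), I ≠ ⊥ → ψ (Ideal.relNorm (𝓞 F) I) = 1 := by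
  obtain ⟨S, hS, ι, _, L, i1, i2, i3, hL, hd⟩ := hD
  let E := AlgebraicClosure F
  have : ∀ i, FiniteDimensional F (L i) := fun i =>
    Module.finite_of_finrank_pos (by rw [(hL i).2.2.1]; exact hp.pos)
  let f : ∀ i, L i →ₐ[F] E := fun i => IsAlgClosed.lift
  let M : IntermediateField F E := ⨆ i, (f i).fieldRange
  have hfd : ∀ i, FiniteDimensional F (f i).fieldRange := fun i =>
    Module.Finite.of_surjective ((f i).rangeRestrict.toLinearMap) (f i).rangeRestrict_surjective
  have hMf : FiniteDimensional F M := IntermediateField.finiteDimensional_iSup_of_finite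
  let _ : NumberField M := NumberField.of_module_finite F M
  have hle : ∀ i, (f i).fieldRange ≤ M := fun i => le_iSup (fun i => (f i).fieldRange) i
  refine ⟨M, inferInstance, inferInstance, inferInstance, ?_, ?_⟩
  · refine ⟨fun w => ?_⟩
    rw [← InfinitePlace.mk_embedding w, InfinitePlace.isReal_mk_iff, ComplexEmbedding.isReal_iff]
    set φ := w.embedding
    have hreal : M ≤ (⊤ : IntermediateField F E) := le_top
    let φ' : E →+* ℂ := ComplexEmbedding.lift E φ
    have hφ' : φ'.comp (algebraMap M E) = φ := ComplexEmbedding.lift_comp_algebraMap E φ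
    let R : IntermediateField F E := (RingHom.eqLocusField φ' (ComplexEmbedding.conjugate φ')).toIntermediateField (by
      intro x
      have := IsTotallyReal.complexEmbedding_isReal (φ'.comp (algebraMap F E))
      rw [ComplexEmbedding.isReal_iff] at this
      exact (RingHom.congr_fun this x).symm)
    have hMR : M ≤ R := by
      refine iSup_le fun i => ?_
      rintro _ ⟨y, rfl⟩
      have hi := (hL i).1
      have := IsTotallyReal.complexEmbedding_isReal (φ'.comp (f i : L i →+* E))
      rw [ComplexEmbedding.isReal_iff] at this
      exact (RingHom.congr_fun this y).symm
    ext x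
    have h1 : φ' x = ComplexEmbedding.conjugate φ' x := hMR x.2
    have h2 : φ' (x : E) = φ x := RingHom.congr_fun hφ' x
    change star (φ x) = φ x
    rw [← h2]
    exact h1.symm
  · classical
    refine (h.comp M).trivial (upS M S) (fun P hP => ?_)
    rw [mem_upS] at hP
    change ψ (Ideal.relNorm (𝓞 F) P.asIdeal) = 1
    rw [relNorm_place, h.pow (dn F P).ne_bot]
    set v0 := dn F P with hv0
    obtain ⟨x0, hx0⟩ := hS.realize (fun v => if v = v0 then 1 else 0)
      ((Set.finite_singleton v0).subset (by intro v hv; by_contra hc; exact hv (if_neg hc)))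
    have hx1 : ordd v0 (x0 : F) = 1 := by rw [hx0 v0 hP, if_pos rfl]
    have hx2 : ∀ v, v ∉ S → v ≠ v0 → ordd v (x0 : F) = 0 := fun v hv hne => by
      rw [hx0 v hv, if_neg hne]
    rcases hd v0 hP x0 hx2 with hD | ⟨i, w, hw, hns⟩
    · rw [h.place_D hp hA hP x0 hx1 hx2 hD, one_pow]
    · obtain ⟨hr, hg, hfr, hun⟩ := hL i
      let g : L i →ₐ[F] M := (IntermediateField.inclusion (hle i)).comp (f i).rangeRestrict
      let _ : Algebra (L i) M := g.toRingHom.toAlgebra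
      have : IsScalarTower F (L i) M := IsScalarTower.of_algebraMap_eq fun x => (g.commutes x).symm
      have hdd : dn F (dn (L i) P) = v0 := dn_dn (K := F) (L := L i) P
      have hwP : dn (L i) P = w := hns _ (by rw [hdd, hw])
      have hff := fI_fI (K := F) (L := L i) P
      rcases ns_or_split hp hfr w with ⟨_, hef, _⟩ | ⟨hn, _⟩
      · rw [hun w (by rw [hw]; exact hP), one_mul] at hef
        rw [hff, hwP, hef, pow_mul, hA, one_pow]
      · exact absurd hns hn

end P9

section P10

theorem ICh.map {F : Type} [Field F] [NumberField F] {A B : Type} [CommGroup A] [CommGroup B]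
    {ψ : Ideal (𝓞 F) → A} (h : ICh F ψ) (q : A →* B) : ICh F (fun I => q (ψ I)) where
  mul I J hI hJ := by rw [h.mul I J hI hJ, map_mul]
  prin x hx := by rw [h.prin x hx, map_one]

theorem card_pow_range_lt {A : Type} [CommGroup A] [Finite A] {p : ℕ} (hp : p.Prime)
    (hd : p ∣ Nat.card A) : Nat.card (powMonoidHom p : A →* A).range < Nat.card A := by
  haveI : Fact p.Prime := ⟨hp⟩
  obtain ⟨x, hx⟩ := exists_prime_orderOf_dvd_card' p hd
  refine lt_of_le_of_ne (Nat.card_le_card_of_injective _ Subtype.val_injective) fun h => ?_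
  have htop : (powMonoidHom p : A →* A).range = ⊤ := Subgroup.eq_top_of_card_eq _ h
  have hsurj := MonoidHom.range_eq_top.1 htop
  have hinj := Finite.injective_iff_surjective.2 hsurj
  have : x = 1 := hinj (by simp [← hx, pow_orderOf_eq_one])
  rw [this, orderOf_one] at hx
  exact hp.one_lt.ne hx

theorem main_ind (n : ℕ) : ∀ (F : Type) [Field F] [NumberField F] [IsTotallyReal F] (A : Type)
    [CommGroup A] [Finite A], Nat.card A = n → ∀ ψ : Ideal (𝓞 F) → A, ICh F ψ →
    ∃ (M : Type) (_ : Field M) (_ : NumberField M) (_ : Algebra F M),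
      IsTotallyReal M ∧ ∀ I : Ideal (𝓞 M), I ≠ ⊥ → ψ (Ideal.relNorm (𝓞 F) I) = 1 := by
  induction n using Nat.strong_induction_on with
  | _ n ih =>
  intro F _ _ _ A _ _ hn ψ hψ
  by_cases h1 : n = 1
  · have : Subsingleton A := (Nat.card_eq_one_iff_unique.1 (hn.trans h1)).1
    exact ⟨F, inferInstance, inferInstance, inferInstance, inferInstance,
      fun I _ => Subsingleton.elim _ _⟩
  obtain ⟨p, hp, hd⟩ := Nat.exists_prime_and_dvd h1
  rw [← hn] at hd
  obtain ⟨F1, _, _, _, _, hD⟩ := dich_base (F := F) hp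
  set B := (powMonoidHom p : A →* A).range with hB
  have hψ1 := hψ.comp F1
  obtain ⟨M1, _, _, _, _, hM1⟩ := (hψ1.map (QuotientGroup.mk' B)).step hp (by
    intro a
    obtain ⟨a, rfl⟩ := QuotientGroup.mk'_surjective B a
    rw [← map_pow]
    exact (QuotientGroup.eq_one_iff _).2 ⟨a, rfl⟩) hD
  let _ : Algebra F M1 := ((algebraMap F1 M1).comp (algebraMap F F1)).toAlgebra
  have : IsScalarTower F F1 M1 := IsScalarTower.of_algebraMap_eq fun x => rfl
  have hB1 : ∀ I : Ideal (𝓞 M1), I ≠ ⊥ → ψ (Ideal.relNorm (𝓞 F) I) ∈ B := by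
    intro I hI
    have := hM1 I hI
    rw [Ideal.relNorm_relNorm] at this
    exact (QuotientGroup.eq_one_iff _).1 this
  classical
  have hψ2 := hψ.comp M1
  let ψ3 : Ideal (𝓞 M1) → B := fun I => if h : ψ (Ideal.relNorm (𝓞 F) I) ∈ B then ⟨_, h⟩ else 1
  have hψ3 : ∀ I : Ideal (𝓞 M1), I ≠ ⊥ → (ψ3 I : A) = ψ (Ideal.relNorm (𝓞 F) I) := by
    intro I hI
    simp only [ψ3]
    rw [dif_pos (hB1 I hI)]
  have hI3 : ICh M1 ψ3 := by
    refine ⟨fun I J hI hJ => ?_, fun x hx => ?_⟩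
    · apply Subtype.ext
      rw [hψ3 _ (mul_ne_zero hI hJ), Subgroup.coe_mul, hψ3 I hI, hψ3 J hJ]
      exact hψ2.mul I J hI hJ
    · apply Subtype.ext
      rw [hψ3 _ (by simpa using hx)]
      exact hψ2.prin x hx
  obtain ⟨M, _, _, _, hMr, hM⟩ := ih (Nat.card B) (hn ▸ card_pow_range_lt hp hd) M1 B rfl ψ3 hI3
  let _ : Algebra F M := ((algebraMap M1 M).comp (algebraMap F M1)).toAlgebra
  have : IsScalarTower F M1 M := IsScalarTower.of_algebraMap_eq fun x => rfl
  refine ⟨M, inferInstance, inferInstance, inferInstance, hMr, fun I hI => ?_⟩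
  have h2 := hM I hI
  have h3 := hψ3 _ (relNorm_ne_bot (F := M1) hI)
  rw [h2, Ideal.relNorm_relNorm] at h3
  exact h3.symm

theorem main_cl (F : Type) [Field F] [NumberField F] [IsTotallyReal F] :
    ∃ (M : Type) (_ : Field M) (_ : NumberField M) (_ : Algebra F M),
      IsTotallyReal M ∧ ∀ I : Ideal (𝓞 M), I ≠ ⊥ → (Ideal.relNorm (𝓞 F) I).IsPrincipal := by
  classical
  let ψ : Ideal (𝓞 F) → ClassGroup (𝓞 F) := fun I =>
    if h : I ≠ ⊥ then ClassGroup.mk0 ⟨I, mem_nonZeroDivisors_of_ne_zero h⟩ else 1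
  have hψ : ∀ I (h : I ≠ ⊥), ψ I = ClassGroup.mk0 ⟨I, mem_nonZeroDivisors_of_ne_zero h⟩ :=
    fun I h => dif_pos h
  have hI : ICh F ψ := by
    refine ⟨fun I J hI hJ => ?_, fun x hx => ?_⟩
    · rw [hψ _ (mul_ne_zero hI hJ), hψ I hI, hψ J hJ, ← map_mul]; rfl
    · rw [hψ _ (by simpa using hx)]
      exact (ClassGroup.mk0_eq_one_iff _).2 ⟨x, rfl⟩
  obtain ⟨M, i1, i2, i3, hr, hM⟩ := main_ind _ F (ClassGroup (𝓞 F)) rfl ψ hI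
  refine ⟨M, i1, i2, i3, hr, fun I h => ?_⟩
  have := hM I h
  rw [hψ _ (relNorm_ne_bot h)] at this
  exact (ClassGroup.mk0_eq_one_iff _).1 this

end P10

theorem final_aux (F : IntermediateField ℚ ℂ) [FiniteDimensional ℚ F]
    (hF : TotallyReal F) :
    ∃ (L : IntermediateField ℚ ℂ) (_ : FiniteDimensional ℚ L) (_ : TotallyReal L)
      (h : F ≤ L), ∀ I : Ideal (𝓞 L), I ≠ ⊥ → (idealNorm F L h I).IsPrincipal := by
  have hFr : IsTotallyReal F := by
    refine ⟨fun w => ?_⟩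
    rw [← InfinitePlace.mk_embedding w, InfinitePlace.isReal_mk_iff, ComplexEmbedding.isReal_iff]
    ext x
    exact Complex.conj_eq_iff_im.2 (hF w.embedding x)
  obtain ⟨M, _, _, _, hMr, hM⟩ := main_cl F
  let f : M →ₐ[F] ℂ := IsAlgClosed.lift
  let g : M →ₐ[ℚ] ℂ := f.toRingHom.toRatAlgHom
  let L : IntermediateField ℚ ℂ := g.fieldRange
  have hgf : ∀ x, g x = f x := fun x => rfl
  have hfd : FiniteDimensional ℚ L :=
    Module.Finite.of_surjective (g.rangeRestrict.toLinearMap) g.rangeRestrict_surjective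
  let e : M ≃+* L := RingEquiv.ofBijective (g.rangeRestrict : M →+* g.range)
    ⟨fun a b hab => g.toRingHom.injective (congrArg Subtype.val hab), g.rangeRestrict_surjective⟩
  have he : ∀ x, ((e x : L) : ℂ) = f x := fun x => rfl
  have hLr : TotallyReal L := by
    intro φ x
    have := IsTotallyReal.complexEmbedding_isReal (φ.comp (e : M →+* L))
    rw [ComplexEmbedding.isReal_iff] at this
    obtain ⟨y, rfl⟩ := e.surjective x
    exact Complex.conj_eq_iff_im.1 (RingHom.congr_fun this y)
  have h : F ≤ L := fun x hx => ⟨algebraMap F M ⟨x, hx⟩, f.commutes ⟨x, hx⟩⟩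
  refine ⟨L, hfd, hLr, h, fun I hI => ?_⟩
  let E : 𝓞 M ≃+* 𝓞 L := RingOfIntegers.mapRingEquiv e
  have hE : ∀ x, ((E x : 𝓞 L) : L) = e (x : M) := fun x => rfl
  have hI' : I.comap (E : 𝓞 M →+* 𝓞 L) ≠ ⊥ := by
    intro hb
    apply hI
    rw [eq_bot_iff]
    intro x hx
    obtain ⟨y, rfl⟩ := E.surjective x
    have : y ∈ I.comap (E : 𝓞 M →+* 𝓞 L) := hx
    rw [hb] at this
    rw [(Submodule.mem_bot _).1 this, map_zero]
    exact Submodule.zero_mem _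
  have key : idealNorm F L h I = Ideal.relNorm (𝓞 F) (I.comap (E : 𝓞 M →+* 𝓞 L)) := by
    rw [Ideal.relNorm_apply]
    unfold idealNorm
    let _ : Algebra F L := (IntermediateField.inclusion h).toRingHom.toAlgebra
    let e' : M ≃ₐ[F] L := AlgEquiv.ofRingEquiv (f := e) (fun x => Subtype.ext (f.commutes x))
    have hnorm : ∀ x : 𝓞 M, ((Algebra.intNorm (𝓞 F) (𝓞 M) x : 𝓞 F) : F) =
        Algebra.norm F ((E x : 𝓞 L) : L) := by
      intro x
      have h1 := Algebra.algebraMap_intNorm (A := 𝓞 F) (K := F) (L := M) (B := 𝓞 M) x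
      have h2 := Algebra.norm_eq_of_algEquiv e' (x : M)
      exact h1.trans h2.symm
    congr 1
    ext y
    constructor
    · rintro ⟨x, hx, hy⟩
      obtain ⟨z, rfl⟩ := E.surjective x
      refine ⟨z, hx, ?_⟩
      apply RingOfIntegers.ext
      rw [hnorm z]; exact hy.symm
    · rintro ⟨z, hz, rfl⟩
      exact ⟨E z, hz, hnorm z⟩
  rw [key]
  exact hM _ (hI')

/-- For every totally real number field `F` there is a finite totally real
extension `L` of `F` such that the norm-induced homomorphism `Cl(𝓞_L) → Cl(𝓞_F)` is
trivial: the relative norm of every nonzero ideal of `𝓞_L` is a principal ideal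
of `𝓞_F`. -/
theorem stmt_6 (F : IntermediateField ℚ ℂ) [FiniteDimensional ℚ F]
    (hF : TotallyReal F) :
    ∃ (L : IntermediateField ℚ ℂ) (_ : FiniteDimensional ℚ L) (_ : TotallyReal L)
      (h : F ≤ L), ∀ I : Ideal (𝓞 L), I ≠ ⊥ → (idealNorm F L h I).IsPrincipal := by
  exact final_aux F hF
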